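/- Let ω(·,t) be the vorticity of a solution of the 2D incompressible Euler equations on the cylinder S = ℝ × [0,2π] (vorticity transported along the flow of u given by the cylindrical Biot–Savart law), with ω₀ nonnegative, bounded, and compactly supported, and suppose the uniform first-moment bound sup_{t≥0} ∫_S |x₁| ω(x,t) dx < ∞ holds. Then for every α > 1, lim_{t→∞} (t log^α t)^{−1/3} · d(t) = 0, where d(t) = sup{|x₁ − y₁| : x, y ∈ supp ω(·,t)}. -/

import Mathlib

open MeasureTheory Real Filter Topology

/-- The strip `S = ℝ × [0,2π]`. -/
noncomputable def strip : Set (ℝ × ℝ) := Set.univ ×ˢ Set.Icc 0 (2 * Real.pi)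

/-- First component of `∇ₓ^⊥G(x,y)`, i.e. `∂G/∂x₂(x,y)`, for the cylinder Green
function `G(x,y) = -(1/2)log(cosh(x₁-y₁) - cos(x₂-y₂))`. -/
noncomputable def K1 (x y : ℝ × ℝ) : ℝ :=
  -Real.sin (x.2 - y.2) / (2 * (Real.cosh (x.1 - y.1) - Real.cos (x.2 - y.2)))

/-- Second component of `∇ₓ^⊥G(x,y)`, i.e. `-∂G/∂x₁(x,y)`. -/
noncomputable def K2 (x y : ℝ × ℝ) : ℝ :=
  Real.sinh (x.1 - y.1) / (2 * (Real.cosh (x.1 - y.1) - Real.cos (x.2 - y.2)))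

/-- Horizontal diameter of the support of `ω t`. -/
noncomputable def horizDiam (ω : ℝ → ℝ × ℝ → ℝ) (t : ℝ) : ℝ :=
  sSup {r : ℝ | ∃ x y : ℝ × ℝ, ω t x ≠ 0 ∧ ω t y ≠ 0 ∧ r = |x.1 - y.1|}

section part1
/-- The denominator `cosh(x₁-y₁) - cos(x₂-y₂)`. -/
noncomputable def DD (x y : ℝ × ℝ) : ℝ := Real.cosh (x.1 - y.1) - Real.cos (x.2 - y.2)

lemma cosh_sub_one_eq (a : ℝ) : Real.cosh a - 1 = 2 * Real.sinh (a / 2) ^ 2 := by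
  have h := Real.cosh_two_mul (a / 2)
  have h2 := Real.cosh_sq (a / 2)
  rw [show 2 * (a / 2) = a by ring] at h
  rw [h, h2]; ring

lemma abs_le_abs_sinh (a : ℝ) : |a| ≤ |Real.sinh a| := by
  rw [Real.abs_sinh]
  exact Real.self_le_sinh_iff.2 (abs_nonneg a)

lemma half_sq_le (a : ℝ) : a ^ 2 / 2 ≤ Real.cosh a - 1 := by
  rw [cosh_sub_one_eq]
  have h := abs_le_abs_sinh (a / 2)
  have h2 := sq_le_sq.2 h
  nlinarith

lemma DD_nonneg (x y : ℝ × ℝ) : 0 ≤ DD x y := by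
  unfold DD
  have := Real.one_le_cosh (x.1 - y.1)
  have := Real.cos_le_one (x.2 - y.2)
  linarith

lemma continuous_DD (x : ℝ × ℝ) : Continuous (fun y => DD x y) := by
  unfold DD; fun_prop

lemma measurableSet_strip : MeasurableSet strip :=
  MeasurableSet.univ.prod measurableSet_Icc

lemma sin_sq_sinh_sq (x y : ℝ × ℝ) :
    Real.sin (x.2 - y.2) ^ 2 + Real.sinh (x.1 - y.1) ^ 2 ≤ DD x y * (DD x y + 2) := by
  unfold DD
  have h1 := Real.sin_sq_add_cos_sq (x.2 - y.2)
  have h2 := Real.cosh_sq (x.1 - y.1)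
  have h3 := Real.one_le_cosh (x.1 - y.1)
  have h4 := Real.cos_le_one (x.2 - y.2)
  have h5 : 0 ≤ (Real.cosh (x.1 - y.1) - Real.cos (x.2 - y.2)) * (1 - Real.cos (x.2 - y.2)) :=
    mul_nonneg (by linarith) (by linarith)
  nlinarith

lemma vol_cos_set (c s : ℝ) (hs : 0 ≤ s) :
    volume ({b | 1 - Real.cos (c - b) ≤ s} ∩ Set.Icc 0 (2 * π)) ≤
      ENNReal.ofReal (2 * (π * √(s / 2))) := by
  set S : Set ℝ := {b | 1 - Real.cos (c - b) ≤ s} with hS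
  have hSm : MeasurableSet S := by
    apply measurableSet_le <;> fun_prop
  have h2π : (0:ℝ) < 2 * π := by positivity
  have h1 : volume (S ∩ Set.Icc 0 (2 * π)) ≤ volume (S ∩ Set.Ioc 0 (0 + 2 * π)) := by
    have : S ∩ Set.Icc 0 (2 * π) ⊆ (S ∩ Set.Ioc 0 (0 + 2 * π)) ∪ {0} := by
      rintro b ⟨hb, hb0, hb1⟩
      rcases eq_or_lt_of_le hb0 with h | h
      · right; exact h.symm
      · left; exact ⟨hb, h, by simpa using hb1⟩
    refine (measure_mono this).trans ((measure_union_le _ _).trans ?_)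
    simp
  have h2 : volume (S ∩ Set.Ioc 0 (0 + 2 * π)) =
      volume (S ∩ Set.Ioc (c - π) (c - π + 2 * π)) := by
    apply (isAddFundamentalDomain_Ioc h2π 0 volume).measure_set_eq
      (isAddFundamentalDomain_Ioc h2π (c - π) volume) hSm
    rintro ⟨g, hg⟩
    obtain ⟨n, rfl⟩ := AddSubgroup.mem_zmultiples_iff.1 hg
    ext b
    simp only [Set.mem_preimage, hS, Set.mem_setOf_eq, AddSubgroup.mk_vadd, vadd_eq_add]
    rw [show c - (n • (2 * π) + b) = (c - b) - n * (2 * π) by simp; ring,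
      Real.cos_sub_int_mul_two_pi]
  rw [h2] at h1
  refine h1.trans ?_
  have h3 : S ∩ Set.Ioc (c - π) (c - π + 2 * π) ⊆
      Set.Icc (c - π * √(s / 2)) (c + π * √(s / 2)) := by
    rintro b ⟨hb, hb0, hb1⟩
    have hb' : 1 - Real.cos (c - b) ≤ s := hb
    have habs : |c - b| ≤ π := abs_le.2 ⟨by linarith, by linarith⟩
    have h := Real.cos_le_one_sub_mul_cos_sq habs
    have hπ := Real.pi_pos
    have h4 : ((c - b) / π) ^ 2 ≤ s / 2 := by
      have : 2 / π ^ 2 * (c - b) ^ 2 = 2 * ((c - b) / π) ^ 2 := by field_simp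
      linarith
    have h5 := Real.abs_le_sqrt h4
    rw [abs_div, abs_of_pos hπ, div_le_iff₀ hπ] at h5
    have h6 := abs_le.1 h5
    constructor <;> nlinarith [h6.1, h6.2]
  refine (measure_mono h3).trans ?_
  rw [Real.volume_Icc]
  apply ENNReal.ofReal_le_ofReal
  linarith

lemma vol_DD (x : ℝ × ℝ) (s : ℝ) (hs : 0 ≤ s) :
    volume ({y | DD x y ≤ s} ∩ strip) ≤ ENNReal.ofReal (4 * π * s) := by
  have hsub : {y | DD x y ≤ s} ∩ strip ⊆
      Set.Icc (x.1 - √(2 * s)) (x.1 + √(2 * s)) ×ˢ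
        ({b | 1 - Real.cos (x.2 - b) ≤ s} ∩ Set.Icc 0 (2 * π)) := by
    rintro y ⟨hy, -, hy2⟩
    have hD : DD x y ≤ s := hy
    unfold DD at hD
    have h1 := half_sq_le (x.1 - y.1)
    have h2 := Real.one_le_cosh (x.1 - y.1)
    have h3 := Real.cos_le_one (x.2 - y.2)
    have h4 : (x.1 - y.1) ^ 2 ≤ 2 * s := by linarith
    have h5 := abs_le.1 (Real.abs_le_sqrt h4)
    refine ⟨⟨by linarith [h5.2], by linarith [h5.1]⟩, ?_, hy2⟩
    show 1 - Real.cos (x.2 - y.2) ≤ s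
    linarith
  refine (measure_mono hsub).trans ?_
  rw [Measure.volume_eq_prod, Measure.prod_prod, Real.volume_Icc]
  refine (mul_le_mul_right (vol_cos_set x.2 s hs) _).trans ?_
  rw [← ENNReal.ofReal_mul (by linarith [Real.sqrt_nonneg (2 * s)])]
  apply ENNReal.ofReal_le_ofReal
  have h : √(2 * s) * √(s / 2) = s := by
    rw [← Real.sqrt_mul (by positivity), show 2 * s * (s / 2) = s ^ 2 by ring,
      Real.sqrt_sq hs]
  have : (x.1 + √(2 * s) - (x.1 - √(2 * s))) * (2 * (π * √(s / 2))) =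
    4 * π * (√(2 * s) * √(s / 2)) := by ring
  rw [this, h]

/-- Singular weight. -/
noncomputable def WW (x y : ℝ × ℝ) : ℝ := if DD x y ≤ 1 then DD x y ^ (-(3/4) : ℝ) else 0

lemma WW_nonneg (x y) : 0 ≤ WW x y := by
  unfold WW; split_ifs
  · exact Real.rpow_nonneg (DD_nonneg x y) _
  · exact le_rfl

lemma measurable_WW (x) : Measurable (WW x) := by
  unfold WW
  apply Measurable.ite
  · exact measurableSet_le (continuous_DD x).measurable measurable_const
  · exact (continuous_DD x).measurable.pow_const _
  · exact measurable_const

lemma exists_lintegral_WW : ∃ C : ℝ, 0 ≤ C ∧ ∀ x : ℝ × ℝ,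
    ∫⁻ y in strip, ENNReal.ofReal (WW x y) ≤ ENNReal.ofReal C := by
  set q : ℝ := (2:ℝ) ^ (3/4 : ℝ) with hq
  have hq0 : 0 < q := by positivity
  have hq2 : q / 2 < 1 := by
    rw [div_lt_one (by norm_num)]
    calc q < (2:ℝ) ^ (1:ℝ) := Real.rpow_lt_rpow_of_exponent_lt (by norm_num) (by norm_num)
      _ = 2 := by simp
  have hgeo := summable_geometric_of_lt_one (r := q / 2) (by positivity) hq2
  refine ⟨∑' j : ℕ, (q * (4 * π)) * (q / 2) ^ j, tsum_nonneg (fun j => by positivity), fun x => ?_⟩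
  have hpt : ∀ y, ENNReal.ofReal (WW x y) ≤
      ∑' j : ℕ, Set.indicator {y | DD x y ≤ (1/2) ^ j}
        (fun _ => ENNReal.ofReal (q ^ (j + 1))) y := by
    intro y
    unfold WW
    split_ifs with h
    · rcases eq_or_lt_of_le (DD_nonneg x y) with h0 | h0
      · rw [← h0, Real.zero_rpow (by norm_num)]; simp
      · obtain ⟨n, hn1, hn2⟩ := exists_nat_pow_near_of_lt_one h0 h
          (y := (1/2 : ℝ)) (by norm_num) (by norm_num)
        refine le_trans ?_ (ENNReal.le_tsum n)
        rw [Set.indicator_of_mem (by exact hn2)]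
        apply ENNReal.ofReal_le_ofReal
        calc DD x y ^ (-(3/4) : ℝ) ≤ ((1/2 : ℝ) ^ (n+1)) ^ (-(3/4) : ℝ) :=
              Real.rpow_le_rpow_of_nonpos (by positivity) hn1.le (by norm_num)
          _ = q ^ (n + 1) := by
            rw [hq, one_div, inv_pow, Real.inv_rpow (by positivity), ← Real.rpow_neg (by positivity),
              neg_neg, ← Real.rpow_natCast, ← Real.rpow_natCast, ← Real.rpow_mul (by norm_num),
              ← Real.rpow_mul (by norm_num), mul_comm]
    · simp
  calc ∫⁻ y in strip, ENNReal.ofReal (WW x y)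
      ≤ ∫⁻ y in strip, ∑' j : ℕ, Set.indicator {y | DD x y ≤ (1/2) ^ j}
        (fun _ => ENNReal.ofReal (q ^ (j + 1))) y := lintegral_mono hpt
    _ = ∑' j : ℕ, ∫⁻ y in strip, Set.indicator {y | DD x y ≤ (1/2) ^ j}
        (fun _ => ENNReal.ofReal (q ^ (j + 1))) y := by
      apply lintegral_tsum
      intro j
      exact (measurable_const.indicator
        (measurableSet_le (continuous_DD x).measurable measurable_const)).aemeasurable
    _ ≤ ∑' j : ℕ, ENNReal.ofReal ((q * (4 * π)) * (q / 2) ^ j) := by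
      apply ENNReal.tsum_le_tsum
      intro j
      have hm : MeasurableSet {y | DD x y ≤ (1/2) ^ j} :=
        measurableSet_le (continuous_DD x).measurable measurable_const
      rw [lintegral_indicator hm, lintegral_const, Measure.restrict_apply MeasurableSet.univ,
        Set.univ_inter, Measure.restrict_apply hm]
      refine (mul_le_mul_right (vol_DD x _ (by positivity)) _).trans ?_
      rw [← ENNReal.ofReal_mul (by positivity)]
      apply ENNReal.ofReal_le_ofReal
      apply le_of_eq
      rw [div_pow, div_pow, one_pow]; ring
    _ = ENNReal.ofReal (∑' j : ℕ, (q * (4 * π)) * (q / 2) ^ j) := by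
      rw [ENNReal.ofReal_tsum_of_nonneg (fun j => by positivity) (hgeo.mul_left _)]

end part1

section part2
/-- A nonnegative bounded density on the strip with bounded mass. -/
structure Dens (M m : ℝ) (w : ℝ × ℝ → ℝ) : Prop where
  nonneg : ∀ y, 0 ≤ w y
  le : ∀ y, w y ≤ M
  int : IntegrableOn w strip
  mass : ∫ y in strip, w y ≤ m

lemma exists_integral_WW : ∃ C : ℝ, 0 ≤ C ∧ ∀ x : ℝ × ℝ,
    IntegrableOn (WW x) strip ∧ ∫ y in strip, WW x y ≤ C := by
  obtain ⟨C, hC, h⟩ := exists_lintegral_WW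
  refine ⟨C, hC, fun x => ⟨⟨(measurable_WW x).aestronglyMeasurable, ?_⟩, ?_⟩⟩
  · rw [hasFiniteIntegral_iff_ofReal (Eventually.of_forall (WW_nonneg x))]
    exact (h x).trans_lt ENNReal.ofReal_lt_top
  · rw [integral_eq_lintegral_of_nonneg_ae (Eventually.of_forall (WW_nonneg x))
      (measurable_WW x).aestronglyMeasurable]
    exact ENNReal.toReal_le_of_le_ofReal hC (h x)

/-- generic pointwise bounds -/
lemma kern_bound (x y : ℝ × ℝ) (n : ℝ) (hn : n ^ 2 ≤ DD x y * (DD x y + 2)) :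
    |n / (2 * DD x y)| ≤ 1 + WW x y := by
  have hD := DD_nonneg x y
  have hW := WW_nonneg x y
  rcases eq_or_lt_of_le hD with h0 | h0
  · rw [← h0]; simp; linarith
  rw [abs_div, abs_of_pos (by positivity : 0 < 2 * DD x y), div_le_iff₀ (by positivity)]
  by_cases h : DD x y ≤ 1
  · have hWW : WW x y = DD x y ^ (-(3/4) : ℝ) := by unfold WW; rw [if_pos h]
    have h1 : DD x y ^ (1/2 : ℝ) ≤ WW x y * DD x y := by
      rw [hWW]
      nth_rewrite 3 [← Real.rpow_one (DD x y)]
      rw [← Real.rpow_add h0]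
      exact Real.rpow_le_rpow_of_exponent_ge h0 h (by norm_num)
    have h2 : |n| ≤ 2 * DD x y ^ (1/2 : ℝ) := by
      rw [← Real.sqrt_eq_rpow]
      apply abs_le_of_sq_le_sq
      · rw [mul_pow, Real.sq_sqrt hD]; nlinarith
      · positivity
    nlinarith
  · push Not at h
    have h2 : |n| ≤ 2 * DD x y := by
      apply abs_le_of_sq_le_sq
      · nlinarith
      · positivity
    nlinarith

lemma kern_reg_bound (x y : ℝ × ℝ) (n e : ℝ) (he : 0 < e) (he1 : e ≤ 1)
    (hn : n ^ 2 ≤ DD x y * (DD x y + 2)) :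
    |n / (2 * DD x y) - n / (2 * (DD x y + e))| ≤ e ^ (1/4 : ℝ) * (1 + WW x y) := by
  have hD := DD_nonneg x y
  have hW := WW_nonneg x y
  rcases eq_or_lt_of_le hD with h0 | h0
  · rw [← h0] at hn
    have : n = 0 := by nlinarith
    rw [this]; simp; positivity
  have hee : e ≤ e ^ (1/4 : ℝ) := by
    nth_rewrite 1 [← Real.rpow_one e]
    exact Real.rpow_le_rpow_of_exponent_ge he he1 (by norm_num)
  have heq : n / (2 * DD x y) - n / (2 * (DD x y + e)) =
      n / (2 * DD x y) * (e / (DD x y + e)) := by field_simp; ring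
  rw [heq, abs_mul, abs_div, abs_of_pos (by positivity : 0 < 2 * DD x y),
    abs_of_pos (by positivity : 0 < e / (DD x y + e))]
  by_cases h : DD x y ≤ 1
  · have hWW : WW x y = DD x y ^ (-(3/4) : ℝ) := by unfold WW; rw [if_pos h]
    have h2 : |n| ≤ 2 * DD x y ^ (1/2 : ℝ) := by
      rw [← Real.sqrt_eq_rpow]
      apply abs_le_of_sq_le_sq
      · rw [mul_pow, Real.sq_sqrt hD]; nlinarith
      · positivity
    have h3 : |n| / (2 * DD x y) ≤ DD x y ^ (-(1/2) : ℝ) := by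
      rw [div_le_iff₀ (by positivity)]
      have : DD x y ^ (-(1/2) : ℝ) * DD x y = DD x y ^ (1/2 : ℝ) := by
        nth_rewrite 2 [← Real.rpow_one (DD x y)]
        rw [← Real.rpow_add h0]; norm_num
      nlinarith
    have h4 : e / (DD x y + e) ≤ (e / DD x y) ^ (1/4 : ℝ) := by
      calc e / (DD x y + e) = (e / (DD x y + e)) ^ (1:ℝ) := by rw [Real.rpow_one]
        _ ≤ (e / (DD x y + e)) ^ (1/4 : ℝ) :=
          Real.rpow_le_rpow_of_exponent_ge (by positivity)
            (by rw [div_le_one (by positivity)]; linarith) (by norm_num)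
        _ ≤ (e / DD x y) ^ (1/4 : ℝ) := by
          apply Real.rpow_le_rpow (by positivity) _ (by norm_num)
          gcongr; linarith
    calc _ ≤ DD x y ^ (-(1/2) : ℝ) * (e / DD x y) ^ (1/4 : ℝ) := by gcongr
      _ = e ^ (1/4 : ℝ) * WW x y := by
        rw [hWW, Real.div_rpow he.le hD, div_eq_mul_inv (e ^ (1/4 : ℝ)), ← Real.rpow_neg hD, mul_comm,
          mul_assoc, ← Real.rpow_add h0]
        norm_num
      _ ≤ _ := by
        apply mul_le_mul_of_nonneg_left _ (by positivity); linarith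
  · push Not at h
    have h2 : |n| ≤ 2 * DD x y := by
      apply abs_le_of_sq_le_sq
      · nlinarith
      · positivity
    have h3 : |n| / (2 * DD x y) ≤ 1 := by rw [div_le_one (by positivity)]; exact h2
    have h4 : e / (DD x y + e) ≤ e := by
      rw [div_le_iff₀ (by positivity)]; nlinarith
    calc _ ≤ 1 * e := by gcongr
      _ ≤ e ^ (1/4 : ℝ) * 1 := by linarith
      _ ≤ _ := by
        apply mul_le_mul_of_nonneg_left _ (by positivity); linarith

/-- regularized kernels -/
noncomputable def K1e (e : ℝ) (x y : ℝ × ℝ) : ℝ :=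
  -Real.sin (x.2 - y.2) / (2 * (DD x y + e))
noncomputable def K2e (e : ℝ) (x y : ℝ × ℝ) : ℝ :=
  Real.sinh (x.1 - y.1) / (2 * (DD x y + e))
noncomputable def p1e (e : ℝ) (x y : ℝ × ℝ) : ℝ :=
  Real.sin (x.2 - y.2) * Real.sinh (x.1 - y.1) / (2 * (DD x y + e) ^ 2)
noncomputable def q1e (e : ℝ) (x y : ℝ × ℝ) : ℝ :=
  -Real.cos (x.2 - y.2) / (2 * (DD x y + e)) + Real.sin (x.2 - y.2) ^ 2 / (2 * (DD x y + e) ^ 2)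
noncomputable def p2e (e : ℝ) (x y : ℝ × ℝ) : ℝ :=
  Real.cosh (x.1 - y.1) / (2 * (DD x y + e)) - Real.sinh (x.1 - y.1) ^ 2 / (2 * (DD x y + e) ^ 2)

/-- linear form with given coefficients -/
noncomputable def lf (p q : ℝ) : (ℝ × ℝ) →L[ℝ] ℝ :=
  p • ContinuousLinearMap.fst ℝ ℝ ℝ + q • ContinuousLinearMap.snd ℝ ℝ ℝ

lemma lf_apply (p q : ℝ) (z : ℝ × ℝ) : lf p q z = p * z.1 + q * z.2 := by simp [lf]

lemma norm_lf_le (p q : ℝ) : ‖lf p q‖ ≤ |p| + |q| := by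
  apply ContinuousLinearMap.opNorm_le_bound _ (by positivity)
  intro z
  rw [lf_apply, Real.norm_eq_abs]
  have h1 : |z.1| ≤ ‖z‖ := norm_fst_le z
  have h2 : |z.2| ≤ ‖z‖ := norm_snd_le z
  calc |p * z.1 + q * z.2| ≤ |p * z.1| + |q * z.2| := abs_add_le _ _
    _ = |p| * |z.1| + |q| * |z.2| := by rw [abs_mul, abs_mul]
    _ ≤ |p| * ‖z‖ + |q| * ‖z‖ := by gcongr
    _ = _ := by ring

lemma hasFDerivAt_DD (x y : ℝ × ℝ) :
    HasFDerivAt (fun x => DD x y) (lf (Real.sinh (x.1 - y.1)) (Real.sin (x.2 - y.2))) x := by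
  have h1 : HasFDerivAt (fun x : ℝ × ℝ => x.1 - y.1) (ContinuousLinearMap.fst ℝ ℝ ℝ) x :=
    hasFDerivAt_fst.sub_const _
  have h2 : HasFDerivAt (fun x : ℝ × ℝ => x.2 - y.2) (ContinuousLinearMap.snd ℝ ℝ ℝ) x :=
    hasFDerivAt_snd.sub_const _
  have := h1.cosh.sub h2.cos
  unfold DD
  refine this.congr_fderiv ?_
  ext <;> simp [lf]

lemma hasFDerivAt_K1e (e : ℝ) (he : 0 < e) (x y : ℝ × ℝ) :
    HasFDerivAt (fun x => K1e e x y) (lf (p1e e x y) (q1e e x y)) x := by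
  have h2 : HasFDerivAt (fun x : ℝ × ℝ => x.2 - y.2) (ContinuousLinearMap.snd ℝ ℝ ℝ) x :=
    hasFDerivAt_snd.sub_const _
  have hD := hasFDerivAt_DD x y
  have hpos : 0 < DD x y + e := by linarith [DD_nonneg x y]
  have hinv : HasFDerivAt (fun x => (2 * (DD x y + e))⁻¹) _ x :=
    (hasDerivAt_inv (by positivity : 2 * (DD x y + e) ≠ 0)).comp_hasFDerivAt x
      ((hD.add_const e).const_mul 2)
  have := (h2.sin.neg).mul hinv
  unfold K1e
  simp only [div_eq_mul_inv]
  refine this.congr_fderiv ?_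
  have hne := hpos.ne'
  apply ContinuousLinearMap.ext
  rintro ⟨z1, z2⟩
  simp [lf, p1e, q1e]
  field_simp
  ring

lemma hasFDerivAt_K2e (e : ℝ) (he : 0 < e) (x y : ℝ × ℝ) :
    HasFDerivAt (fun x => K2e e x y) (lf (p2e e x y) (-p1e e x y)) x := by
  have h2 : HasFDerivAt (fun x : ℝ × ℝ => x.1 - y.1) (ContinuousLinearMap.fst ℝ ℝ ℝ) x :=
    hasFDerivAt_fst.sub_const _
  have hD := hasFDerivAt_DD x y
  have hpos : 0 < DD x y + e := by linarith [DD_nonneg x y]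
  have hinv : HasFDerivAt (fun x => (2 * (DD x y + e))⁻¹) _ x :=
    (hasDerivAt_inv (by positivity : 2 * (DD x y + e) ≠ 0)).comp_hasFDerivAt x
      ((hD.add_const e).const_mul 2)
  have := (h2.sinh).mul hinv
  unfold K2e
  simp only [div_eq_mul_inv]
  refine this.congr_fderiv ?_
  have hne := hpos.ne'
  apply ContinuousLinearMap.ext
  rintro ⟨z1, z2⟩
  simp [lf, p1e, p2e]
  field_simp
  ring

lemma coef_bounds (e : ℝ) (he : 0 < e) (x y : ℝ × ℝ) :
    |p1e e x y| ≤ 1 + 2 / (DD x y + e) ∧ |q1e e x y| ≤ 1 + 2 / (DD x y + e) ∧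
    |p2e e x y| ≤ 1 + 2 / (DD x y + e) := by
  have hD := DD_nonneg x y
  have hpos : 0 < DD x y + e := by linarith
  have hss := sin_sq_sinh_sq x y
  have hcosh : Real.cosh (x.1 - y.1) ≤ DD x y + 1 := by
    unfold DD; linarith [Real.cos_le_one (x.2 - y.2)]
  have hcosh0 := Real.cosh_pos (x.1 - y.1)
  have hcos := Real.abs_cos_le_one (x.2 - y.2)
  set S := Real.sin (x.2 - y.2) with hS
  set H := Real.sinh (x.1 - y.1) with hH
  set D := DD x y with hDdef
  have key : ∀ n : ℝ, 0 ≤ n → n ≤ D * (D + 2) → n / (2 * (D + e) ^ 2) ≤ 1/2 + 1 / (D + e) := by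
    intro n hn0 hn
    rw [div_le_iff₀ (by positivity)]
    have : (1/2 + 1 / (D + e)) * (2 * (D + e) ^ 2) = (D + e) ^ 2 + 2 * (D + e) := by
      field_simp
    rw [this]; nlinarith
  have h2e : (2:ℝ) / (D + e) = 2 * (1 / (D + e)) := by ring
  have hinv : 0 < 1 / (D + e) := by positivity
  rw [h2e]
  refine ⟨?_, ?_, ?_⟩
  · unfold p1e
    rw [abs_div, abs_of_pos (by positivity : 0 < 2 * (D + e) ^ 2)]
    refine (key _ (abs_nonneg _) ?_).trans (by linarith)
    rw [abs_mul]
    nlinarith [sq_abs S, sq_abs H, sq_nonneg (|S| - |H|)]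
  · unfold q1e
    refine (abs_add_le _ _).trans ?_
    have h1 : |-Real.cos (x.2 - y.2) / (2 * (D + e))| ≤ 1/2 * (1 / (D + e)) := by
      rw [abs_div, abs_neg, abs_of_pos (by positivity : 0 < 2 * (D + e)), div_le_iff₀ (by positivity)]
      have : 1/2 * (1 / (D + e)) * (2 * (D + e)) = 1 := by field_simp
      rw [this]; exact hcos
    have h2 : |S ^ 2 / (2 * (D + e) ^ 2)| ≤ 1/2 + 1 / (D + e) := by
      rw [abs_of_nonneg (by positivity)]
      exact key _ (sq_nonneg _) (by nlinarith)
    linarith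
  · unfold p2e
    refine (abs_sub _ _).trans ?_
    have h1 : |Real.cosh (x.1 - y.1) / (2 * (D + e))| ≤ 1/2 + 1/2 * (1 / (D + e)) := by
      rw [abs_of_nonneg (by positivity), div_le_iff₀ (by positivity)]
      have : (1/2 + 1/2 * (1 / (D + e))) * (2 * (D + e)) = (D + e) + 1 := by field_simp
      rw [this]; linarith
    have h2 : |H ^ 2 / (2 * (D + e) ^ 2)| ≤ 1/2 + 1 / (D + e) := by
      rw [abs_of_nonneg (by positivity)]
      exact key _ (sq_nonneg _) (by nlinarith)
    linarith

lemma Ke_bound (e : ℝ) (he : 0 < e) (x y : ℝ × ℝ) (n : ℝ) (hn : n ^ 2 ≤ DD x y * (DD x y + 2)) :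
    |n / (2 * (DD x y + e))| ≤ 1 + 1 / e := by
  have hD := DD_nonneg x y
  have h : |n| ≤ DD x y + 1 := abs_le_of_sq_le_sq (by nlinarith) (by positivity)
  rw [abs_div, abs_of_pos (by positivity : 0 < 2 * (DD x y + e)), div_le_iff₀ (by positivity)]
  have : (1 + 1 / e) * (2 * (DD x y + e)) = 2 * DD x y + 2 * e + 2 * (DD x y / e) + 2 := by
    field_simp
    ring
  rw [this]
  have : 0 ≤ DD x y / e := by positivity
  linarith

lemma log_pointwise (x y : ℝ × ℝ) (J : ℕ) :
    1 / (DD x y + (1/2) ^ J) ≤ 1 + ∑ j ∈ Finset.range (J + 1),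
      Set.indicator {y | DD x y ≤ (1/2) ^ j} (fun _ => (2:ℝ) ^ (j + 1)) y := by
  have hD := DD_nonneg x y
  have hnn : ∀ j ∈ Finset.range (J + 1),
      0 ≤ Set.indicator {y | DD x y ≤ (1/2) ^ j} (fun _ => (2:ℝ) ^ (j + 1)) y := fun j _ =>
    Set.indicator_nonneg (fun _ _ => by positivity) y
  have hsum := Finset.sum_nonneg hnn
  have hsingle : ∀ n ≤ J, DD x y ≤ (1/2) ^ n → (2:ℝ) ^ (n + 1) ≤ ∑ j ∈ Finset.range (J + 1),
      Set.indicator {y | DD x y ≤ (1/2) ^ j} (fun _ => (2:ℝ) ^ (j + 1)) y := by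
    intro n hn h
    have := Finset.single_le_sum hnn (Finset.mem_range.2 (Nat.lt_succ_of_le hn))
    rwa [Set.indicator_of_mem (by exact h)] at this
  have hhalf : ∀ n : ℕ, (1/2 : ℝ) ^ n * 2 ^ n = 1 := by
    intro n; rw [← mul_pow]; norm_num
  by_cases h1 : DD x y ≤ (1/2) ^ J
  · have := hsingle J le_rfl h1
    have h2 : 1 / (DD x y + (1/2) ^ J) ≤ 2 ^ J := by
      rw [div_le_iff₀ (by positivity)]
      nlinarith [hhalf J, pow_pos (show (0:ℝ) < 2 by norm_num) J]
    have : (2:ℝ) ^ J ≤ 2 ^ (J + 1) := by gcongr <;> norm_num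
    linarith
  · push Not at h1
    have h0 : 0 < DD x y := lt_trans (by positivity) h1
    by_cases h2 : DD x y ≤ 1
    · obtain ⟨n, hn1, hn2⟩ := exists_nat_pow_near_of_lt_one h0 h2
          (y := (1/2 : ℝ)) (by norm_num) (by norm_num)
      have hnJ : n ≤ J := by
        by_contra hcon
        push Not at hcon
        have : (1/2 : ℝ) ^ n ≤ (1/2) ^ J := pow_le_pow_of_le_one (by norm_num) (by norm_num) hcon.le
        linarith
      have := hsingle n hnJ hn2
      have h3 : 1 / (DD x y + (1/2) ^ J) ≤ 2 ^ (n + 1) := by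
        rw [div_le_iff₀ (by positivity)]
        have h5 := pow_pos (show (0:ℝ) < 2 by norm_num) (n+1)
        have h6 := pow_pos (show (0:ℝ) < 1/2 by norm_num) J
        nlinarith [hhalf (n+1), mul_pos h5 h6]
      linarith
    · push Not at h2
      have : 1 / (DD x y + (1/2) ^ J) ≤ 1 := by
        rw [div_le_one (by positivity)]
        have h6 := pow_pos (show (0:ℝ) < 1/2 by norm_num) J
        linarith
      linarith

end part2

section part3
/-- bounded field, well approximated by divergence free fields with slowly growing gradients -/
structure GoodField (U C : ℝ) (v : ℝ × ℝ → ℝ × ℝ) : Prop where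
  bdd : ∀ x, ‖v x‖ ≤ U
  reg : ∀ J : ℕ, ∃ g : ℝ × ℝ → ℝ × ℝ, ∃ g' : ℝ × ℝ → (ℝ × ℝ) →L[ℝ] (ℝ × ℝ),
    (∀ x, HasFDerivAt g (g' x) x) ∧ (∀ x, ‖g' x‖ ≤ C * (J + 1)) ∧
    (∀ x, (g' x (1, 0)).1 + (g' x (0, 1)).2 = 0) ∧ (∀ x, ‖v x - g x‖ ≤ C * (1/2) ^ J)

section dens
variable {M m : ℝ} {w : ℝ × ℝ → ℝ}

lemma DD_eq (x y : ℝ × ℝ) : Real.cosh (x.1 - y.1) - Real.cos (x.2 - y.2) = DD x y := rfl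

lemma sin_sq_le (x y : ℝ × ℝ) : (-Real.sin (x.2 - y.2)) ^ 2 ≤ DD x y * (DD x y + 2) := by
  have := sin_sq_sinh_sq x y; nlinarith [sq_nonneg (Real.sinh (x.1 - y.1))]
lemma sinh_sq_le (x y : ℝ × ℝ) : (Real.sinh (x.1 - y.1)) ^ 2 ≤ DD x y * (DD x y + 2) := by
  have := sin_sq_sinh_sq x y; nlinarith [sq_nonneg (Real.sin (x.2 - y.2))]

lemma abs_K1_le (x y : ℝ × ℝ) : |K1 x y| ≤ 1 + WW x y := kern_bound x y _ (sin_sq_le x y)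
lemma abs_K2_le (x y : ℝ × ℝ) : |K2 x y| ≤ 1 + WW x y := kern_bound x y _ (sinh_sq_le x y)

lemma measurable_K1 : Measurable (fun p : (ℝ × ℝ) × (ℝ × ℝ) => K1 p.1 p.2) := by
  unfold K1; fun_prop
lemma measurable_K2 : Measurable (fun p : (ℝ × ℝ) × (ℝ × ℝ) => K2 p.1 p.2) := by
  unfold K2; fun_prop

/-- dominated integrals -/
lemma Dens.dom (hw : Dens M m w) (hM : 0 ≤ M) {CW : ℝ}
    (hCW : ∀ x : ℝ × ℝ, IntegrableOn (WW x) strip ∧ ∫ y in strip, WW x y ≤ CW)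
    (x : ℝ × ℝ) (f : ℝ × ℝ → ℝ) (hf : Measurable f) (c : ℝ) (hc : 0 ≤ c)
    (hb : ∀ y, |f y| ≤ c * (1 + WW x y)) :
    IntegrableOn (fun y => f y * w y) strip ∧ ∫ y in strip, |f y| * w y ≤ c * (m + M * CW) := by
  have hbi : IntegrableOn (fun y => c * (w y + M * WW x y)) strip :=
    ((hw.int.add ((hCW x).1.const_mul M)).const_mul c)
  have hpt : ∀ y, |f y| * w y ≤ c * (w y + M * WW x y) := by
    intro y
    have h1 := hw.nonneg y
    have h2 := hw.le y
    have h3 := WW_nonneg x y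
    calc |f y| * w y ≤ c * (1 + WW x y) * w y := by gcongr; exact hb y
      _ = c * (w y + w y * WW x y) := by ring
      _ ≤ _ := by gcongr
  have hint : IntegrableOn (fun y => f y * w y) strip := by
    refine Integrable.mono' hbi (hf.aestronglyMeasurable.mul hw.int.aestronglyMeasurable) ?_
    refine Eventually.of_forall fun y => ?_
    rw [Real.norm_eq_abs, abs_mul, abs_of_nonneg (hw.nonneg y)]
    exact hpt y
  refine ⟨hint, ?_⟩
  calc ∫ y in strip, |f y| * w y ≤ ∫ y in strip, c * (w y + M * WW x y) := by
        apply integral_mono_of_nonneg _ hbi (Eventually.of_forall hpt)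
        exact Eventually.of_forall fun y => mul_nonneg (abs_nonneg _) (hw.nonneg y)
    _ = c * ((∫ y in strip, w y) + M * ∫ y in strip, WW x y) := by
        rw [integral_const_mul, integral_add hw.int ((hCW x).1.const_mul M), integral_const_mul]
    _ ≤ _ := by
        have h1 := hw.mass
        have h2 := (hCW x).2
        gcongr

lemma Dens.abs_int_le (hw : Dens M m w) (f : ℝ × ℝ → ℝ) (B : ℝ)
    (hB : ∫ y in strip, |f y| * w y ≤ B) : |∫ y in strip, f y * w y| ≤ B := by
  refine (abs_integral_le_integral_abs).trans (le_of_eq_of_le ?_ hB)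
  congr 1; ext y
  rw [abs_mul, abs_of_nonneg (hw.nonneg y)]

lemma Dens.log_int (hw : Dens M m w) (hM : 0 ≤ M) (x : ℝ × ℝ) (J : ℕ) :
    IntegrableOn (fun y => 1 / (DD x y + (1/2) ^ J) * w y) strip ∧
    ∫ y in strip, 1 / (DD x y + (1/2) ^ J) * w y ≤ m + M * (8 * π) * (J + 1) := by
  have hmeas : ∀ j : ℕ, MeasurableSet {y | DD x y ≤ (1/2) ^ j} := fun j =>
    measurableSet_le (continuous_DD x).measurable measurable_const
  have hvol : ∀ j : ℕ, (volume.restrict strip) {y | DD x y ≤ (1/2) ^ j} ≤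
      ENNReal.ofReal (4 * π * (1/2) ^ j) := fun j => by
    rw [Measure.restrict_apply (hmeas j)]; exact vol_DD x _ (by positivity)
  have hind : ∀ j : ℕ, IntegrableOn
      (Set.indicator {y | DD x y ≤ (1/2) ^ j} (fun _ => (2:ℝ) ^ (j + 1))) strip := by
    intro j
    refine IntegrableOn.integrable_indicator ?_ (hmeas j)
    exact integrableOn_const ((hvol j).trans_lt ENNReal.ofReal_lt_top).ne
  have hindle : ∀ j : ℕ, ∫ y in strip,
      (Set.indicator {y | DD x y ≤ (1/2) ^ j} (fun _ => (2:ℝ) ^ (j + 1))) y ≤ 8 * π := by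
    intro j
    rw [integral_indicator (hmeas j), setIntegral_const, smul_eq_mul]
    have : (volume.restrict strip).real {y | DD x y ≤ (1/2) ^ j} ≤ 4 * π * (1/2) ^ j :=
      ENNReal.toReal_le_of_le_ofReal (by positivity) (hvol j)
    calc _ ≤ 4 * π * (1/2) ^ j * 2 ^ (j + 1) := by gcongr
      _ = 8 * π * ((1/2) ^ j * 2 ^ j) := by ring
      _ = 8 * π := by rw [← mul_pow]; norm_num
  have hbi : IntegrableOn (fun y => w y + M * ∑ j ∈ Finset.range (J + 1),
      Set.indicator {y | DD x y ≤ (1/2) ^ j} (fun _ => (2:ℝ) ^ (j + 1)) y) strip :=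
    hw.int.add ((integrable_finsetSum _ (fun j _ => hind j)).const_mul M)
  have hpos : ∀ y, 0 < DD x y + (1/2) ^ J := fun y => by
    have := DD_nonneg x y; positivity
  have hpt : ∀ y, 1 / (DD x y + (1/2) ^ J) * w y ≤ w y + M * ∑ j ∈ Finset.range (J + 1),
      Set.indicator {y | DD x y ≤ (1/2) ^ j} (fun _ => (2:ℝ) ^ (j + 1)) y := by
    intro y
    have h1 := hw.nonneg y
    have h2 := hw.le y
    have h0 : 0 ≤ ∑ j ∈ Finset.range (J + 1),
      Set.indicator {y | DD x y ≤ (1/2) ^ j} (fun _ => (2:ℝ) ^ (j + 1)) y :=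
      Finset.sum_nonneg fun j _ => Set.indicator_nonneg (fun _ _ => by positivity) y
    have h3 := mul_le_mul_of_nonneg_right (log_pointwise x y J) h1
    have h4 := mul_le_mul_of_nonneg_left h2 h0
    nlinarith
  have hnn : ∀ y, 0 ≤ 1 / (DD x y + (1/2) ^ J) * w y := fun y => by
    have h1 := hw.nonneg y
    have := hpos y
    positivity
  constructor
  · refine Integrable.mono' hbi (AEStronglyMeasurable.mul ?_ hw.int.aestronglyMeasurable) ?_
    · have := (continuous_DD x).measurable
      exact (by fun_prop : Measurable fun y => 1 / (DD x y + (1/2) ^ J)).aestronglyMeasurable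
    · refine Eventually.of_forall fun y => ?_
      rw [Real.norm_eq_abs, abs_of_nonneg (hnn y)]
      exact hpt y
  · calc _ ≤ _ := integral_mono_of_nonneg (Eventually.of_forall hnn) hbi (Eventually.of_forall hpt)
      _ = (∫ y in strip, w y) + M * ∑ j ∈ Finset.range (J + 1), ∫ y in strip,
          Set.indicator {y | DD x y ≤ (1/2) ^ j} (fun _ => (2:ℝ) ^ (j + 1)) y := by
        rw [integral_add hw.int ((integrable_finsetSum _ (fun j _ => hind j)).const_mul M),
          integral_const_mul, integral_finsetSum _ (fun j _ => hind j)]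
      _ ≤ m + M * ∑ j ∈ Finset.range (J + 1), 8 * π := by
        have := hw.mass
        gcongr with j hj
        exact hindle j
      _ = _ := by simp; ring

/-- differentiation of a regularized potential -/
lemma Dens.deriv (hw : Dens M m w) (hM : 0 ≤ M) (J : ℕ) (f p q : ℝ × ℝ → ℝ × ℝ → ℝ)
    (hfm : ∀ x, Measurable (f x)) (hpm : ∀ x, Measurable (p x)) (hqm : ∀ x, Measurable (q x))
    (hd : ∀ x y, HasFDerivAt (fun x => f x y) (lf (p x y) (q x y)) x)
    (hf : ∀ x y, |f x y| ≤ 1 + 1 / (1/2) ^ J)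
    (hp : ∀ x y, |p x y| ≤ 1 + 2 / (DD x y + (1/2) ^ J))
    (hq : ∀ x y, |q x y| ≤ 1 + 2 / (DD x y + (1/2) ^ J)) (x : ℝ × ℝ) :
    HasFDerivAt (fun x => ∫ y in strip, f x y * w y)
      (lf (∫ y in strip, p x y * w y) (∫ y in strip, q x y * w y)) x ∧
    |∫ y in strip, p x y * w y| ≤ 3 * m + 2 * (M * (8 * π) * (J + 1)) ∧
    |∫ y in strip, q x y * w y| ≤ 3 * m + 2 * (M * (8 * π) * (J + 1)) := by
  set e : ℝ := (1/2) ^ J with he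
  have he0 : 0 < e := by positivity
  have hbd : ∀ g : ℝ × ℝ → ℝ × ℝ → ℝ, (∀ x, Measurable (g x)) →
      (∀ x y, |g x y| ≤ 1 + 2 / (DD x y + e)) → ∀ x,
      IntegrableOn (fun y => g x y * w y) strip ∧
      |∫ y in strip, g x y * w y| ≤ 3 * m + 2 * (M * (8 * π) * (J + 1)) := by
    intro g hgm hg x
    obtain ⟨hl1, hl2⟩ := hw.log_int hM x J
    have hbi : IntegrableOn (fun y => w y + 2 * (1 / (DD x y + e) * w y)) strip :=
      hw.int.add (hl1.const_mul 2)
    have hpt : ∀ y, |g x y| * w y ≤ w y + 2 * (1 / (DD x y + e) * w y) := by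
      intro y
      calc |g x y| * w y ≤ (1 + 2 / (DD x y + e)) * w y :=
            mul_le_mul_of_nonneg_right (hg x y) (hw.nonneg y)
        _ = _ := by ring
    refine ⟨?_, ?_⟩
    · refine Integrable.mono' hbi ((hgm x).aestronglyMeasurable.mul hw.int.aestronglyMeasurable) ?_
      refine Eventually.of_forall fun y => ?_
      rw [Real.norm_eq_abs, abs_mul, abs_of_nonneg (hw.nonneg y)]
      exact hpt y
    · apply hw.abs_int_le
      calc ∫ y in strip, |g x y| * w y ≤ ∫ y in strip, (w y + 2 * (1 / (DD x y + e) * w y)) := by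
            apply integral_mono_of_nonneg _ hbi (Eventually.of_forall hpt)
            exact Eventually.of_forall fun y => mul_nonneg (abs_nonneg _) (hw.nonneg y)
        _ = (∫ y in strip, w y) + 2 * ∫ y in strip, 1 / (DD x y + e) * w y := by
            rw [integral_add hw.int (hl1.const_mul 2), integral_const_mul]
        _ ≤ _ := by
            have := hw.mass
            linarith
  refine ⟨?_, (hbd p hpm hp x).2, (hbd q hqm hq x).2⟩
  have hlfm : ∀ x, AEStronglyMeasurable (fun y => w y • lf (p x y) (q x y))
      (volume.restrict strip) := by
    intro x
    apply hw.int.aestronglyMeasurable.smul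
    unfold lf
    exact ((hpm x).aestronglyMeasurable.smul_const _).add
      ((hqm x).aestronglyMeasurable.smul_const _)
  have hnorm : ∀ x y, ‖w y • lf (p x y) (q x y)‖ ≤ (2 + 4 / e) * w y := by
    intro x y
    rw [norm_smul, Real.norm_eq_abs, abs_of_nonneg (hw.nonneg y), mul_comm]
    apply mul_le_mul_of_nonneg_right _ (hw.nonneg y)
    refine (norm_lf_le _ _).trans ?_
    have h1 := hp x y
    have h2 := hq x y
    have h3 : 2 / (DD x y + e) ≤ 2 / e := by
      gcongr; linarith [DD_nonneg x y]
    have : (4:ℝ) / e = 2 / e + 2 / e := by ring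
    linarith
  have key := hasFDerivAt_integral_of_dominated_of_fderiv_le (μ := volume.restrict strip)
    (F := fun x y => f x y * w y) (F' := fun x y => w y • lf (p x y) (q x y)) (x₀ := x)
    (s := Set.univ) (bound := fun y => (2 + 4 / e) * w y) univ_mem
    (Eventually.of_forall fun x => (hfm x).aestronglyMeasurable.mul hw.int.aestronglyMeasurable)
    (by
      refine Integrable.mono' (hw.int.const_mul (1 + 1 / e))
        ((hfm x).aestronglyMeasurable.mul hw.int.aestronglyMeasurable) ?_
      refine Eventually.of_forall fun y => ?_
      rw [Real.norm_eq_abs, abs_mul, abs_of_nonneg (hw.nonneg y)]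
      exact mul_le_mul_of_nonneg_right (hf x y) (hw.nonneg y))
    (hlfm x) (Eventually.of_forall fun y x _ => hnorm x y) (hw.int.const_mul _)
    (Eventually.of_forall fun y x _ => (hd x y).mul_const (w y))
  refine key.congr_fderiv ?_
  have hFi : Integrable (fun y => w y • lf (p x y) (q x y)) (volume.restrict strip) :=
    Integrable.mono' (hw.int.const_mul (2 + 4 / e)) (hlfm x) (Eventually.of_forall (hnorm x))
  apply ContinuousLinearMap.ext
  rintro z
  rw [ContinuousLinearMap.integral_apply hFi, lf_apply, ← integral_mul_const, ← integral_mul_const,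
    ← integral_add ((hbd p hpm hp x).1.mul_const _) ((hbd q hqm hq x).1.mul_const _)]
  congr 1; ext y
  simp only [smul_apply, lf_apply, smul_eq_mul]
  ring

end dens

lemma exists_goodField (M m : ℝ) (hM : 0 < M) (hm : 0 < m) : ∃ U C : ℝ, 0 < U ∧ 1 ≤ C ∧
    ∀ w, Dens M m w →
      GoodField U C (fun x => (∫ y in strip, K1 x y * w y, ∫ y in strip, K2 x y * w y)) := by
  obtain ⟨CW, hCW0, hCW⟩ := exists_integral_WW
  set U := 1 * (m + M * CW) with hU
  have hU0 : 0 < U := by positivity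
  set B := 2 * (3 * m + 2 * (M * (8 * π) * 4)) with hB
  have hB0 : 0 < B := by positivity
  refine ⟨U, 1 + B + U, hU0, by linarith, fun w hw => ⟨?_, ?_⟩⟩
  · intro x
    have m1 : Measurable (K1 x) := by unfold K1; fun_prop
    have m2 : Measurable (K2 x) := by unfold K2; fun_prop
    have h1 := hw.abs_int_le _ _ (hw.dom hM.le hCW x (K1 x) m1 1 zero_le_one
      (by simpa using abs_K1_le x)).2
    have h2 := hw.abs_int_le _ _ (hw.dom hM.le hCW x (K2 x) m2 1 zero_le_one
      (by simpa using abs_K2_le x)).2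
    rw [Prod.norm_def]
    exact max_le h1 h2
  · intro J
    set e : ℝ := (1/2) ^ (4 * J) with he
    have he0 : 0 < e := by positivity
    have he1 : e ≤ 1 := pow_le_one₀ (by norm_num) (by norm_num)
    have he4 : e ^ (1/4 : ℝ) = (1/2) ^ J := by
      rw [he, pow_mul', ← Real.rpow_natCast, ← Real.rpow_mul (by positivity)]
      norm_num
    have mK1 : ∀ x, Measurable (K1e e x) := fun x => by unfold K1e DD; fun_prop
    have mK2 : ∀ x, Measurable (K2e e x) := fun x => by unfold K2e DD; fun_prop
    have mp1 : ∀ x, Measurable (p1e e x) := fun x => by unfold p1e DD; fun_prop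
    have mq1 : ∀ x, Measurable (q1e e x) := fun x => by unfold q1e DD; fun_prop
    have mp2 : ∀ x, Measurable (p2e e x) := fun x => by unfold p2e DD; fun_prop
    have D1 := hw.deriv hM.le (4 * J) (K1e e) (p1e e) (q1e e) mK1 mp1 mq1
      (hasFDerivAt_K1e e he0) (fun x y => Ke_bound e he0 x y _ (sin_sq_le x y))
      (fun x y => (coef_bounds e he0 x y).1) (fun x y => (coef_bounds e he0 x y).2.1)
    have D2 := hw.deriv hM.le (4 * J) (K2e e) (p2e e) (fun x y => -p1e e x y) mK2 mp2
      (fun x => (mp1 x).neg)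
      (hasFDerivAt_K2e e he0) (fun x y => Ke_bound e he0 x y _ (sinh_sq_le x y))
      (fun x y => (coef_bounds e he0 x y).2.2)
      (fun x y => by rw [abs_neg]; exact (coef_bounds e he0 x y).1)
    refine ⟨fun x => (∫ y in strip, K1e e x y * w y, ∫ y in strip, K2e e x y * w y), fun x =>
      (lf (∫ y in strip, p1e e x y * w y) (∫ y in strip, q1e e x y * w y)).prod
      (lf (∫ y in strip, p2e e x y * w y) (∫ y in strip, -p1e e x y * w y)),
      fun x => (D1 x).1.prodMk (D2 x).1, fun x => ?_, fun x => ?_, fun x => ?_⟩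
    · have hBJ : 2 * (3 * m + 2 * (M * (8 * π) * (((4 * J : ℕ) : ℝ) + 1))) ≤
          (1 + B + U) * (J + 1) := by
        have hJ : (0:ℝ) ≤ J := Nat.cast_nonneg J
        have hMπ : 0 < M * (8 * π) := by positivity
        push_cast
        have : 2 * (3 * m + 2 * (M * (8 * π) * (4 * J + 1))) ≤ B * (J + 1) := by
          rw [hB]; nlinarith [mul_nonneg hm.le hJ]
        nlinarith
      refine le_trans ?_ hBJ
      rw [ContinuousLinearMap.opNorm_prod, Prod.norm_def]
      apply max_le
      · exact (norm_lf_le _ _).trans (by linarith [(D1 x).2.1, (D1 x).2.2])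
      · exact (norm_lf_le _ _).trans (by linarith [(D2 x).2.1, (D2 x).2.2])
    · simp [lf_apply, integral_neg]
    · have hdiff : ∀ (k ke : ℝ × ℝ → ℝ), Measurable k → Measurable ke →
          (∀ y, |k y| ≤ 1 + WW x y) → (∀ y, |ke y| ≤ 1 + 1 / e) →
          (∀ y, |k y - ke y| ≤ e ^ (1/4 : ℝ) * (1 + WW x y)) →
          |(∫ y in strip, k y * w y) - ∫ y in strip, ke y * w y| ≤ U * (1/2) ^ J := by
        intro k ke hk hke hb1 hb2 hb3
        have i1 := (hw.dom hM.le hCW x k hk 1 zero_le_one (by simpa using hb1)).1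
        have i2 := (hw.dom hM.le hCW x ke hke (1 + 1/e) (by positivity) (fun y =>
          (hb2 y).trans (le_mul_of_one_le_right (by positivity) (by linarith [WW_nonneg x y])))).1
        rw [← integral_sub i1 i2]
        have := hw.abs_int_le _ _ (hw.dom hM.le hCW x (fun y => k y - ke y) (hk.sub hke)
          (e ^ (1/4 : ℝ)) (by positivity) hb3).2
        rw [he4] at this
        simp only [sub_mul] at this
        refine this.trans (le_of_eq ?_)
        rw [hU]; ring
      have m1 : Measurable (K1 x) := by unfold K1; fun_prop
      have m2 : Measurable (K2 x) := by unfold K2; fun_prop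
      have h1 := hdiff (K1 x) (K1e e x) m1 (mK1 x) (abs_K1_le x)
        (fun y => Ke_bound e he0 x y _ (sin_sq_le x y))
        (fun y => kern_reg_bound x y _ e he0 he1 (sin_sq_le x y))
      have h2 := hdiff (K2 x) (K2e e x) m2 (mK2 x) (abs_K2_le x)
        (fun y => Ke_bound e he0 x y _ (sinh_sq_le x y))
        (fun y => kern_reg_bound x y _ e he0 he1 (sinh_sq_le x y))
      have h3 : U * (1/2 : ℝ) ^ J ≤ (1 + B + U) * (1/2) ^ J := by gcongr; linarith
      rw [Prod.norm_def]
      exact (max_le h1 h2).trans h3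

end part3

section part4
/-- modulus of continuity of a good field -/
lemma GoodField.modulus {U C : ℝ} {v : ℝ × ℝ → ℝ × ℝ} (hv : GoodField U C v) (J : ℕ)
    (x y : ℝ × ℝ) : ‖v x - v y‖ ≤ C * (J + 1) * ‖x - y‖ + 2 * C * (1/2) ^ J := by
  obtain ⟨g, g', hg, hg', -, hvg⟩ := hv.reg J
  have h1 := Convex.norm_image_sub_le_of_norm_hasFDerivWithin_le (s := Set.univ) (x := y) (y := x)
    (fun z _ => (hg z).hasFDerivWithinAt) (fun z _ => hg' z) convex_univ trivial trivial
  have h2 := hvg x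
  have h3 := hvg y
  calc ‖v x - v y‖ = ‖(v x - g x) + (g x - g y) - (v y - g y)‖ := by congr 1; abel
    _ ≤ ‖v x - g x‖ + ‖g x - g y‖ + ‖v y - g y‖ :=
      (norm_sub_le _ _).trans (add_le_add_left (norm_add_le _ _) _)
    _ ≤ _ := by linarith

lemma dyadic_choice (s : ℝ) (hs0 : 0 < s) (hs1 : s ≤ 1) : ∃ k : ℕ,
    ((1/2 : ℝ)) ^ (4 * k) ≤ 16 * s ^ 4 ∧ (3/2 : ℝ) ^ k * s ≤ 1 ∧
    (4 * (k : ℝ) + 1) * (3/2 : ℝ) ^ k * s ≤ 12 ∧ (4 * (k : ℝ) + 1) * s ≤ 12 := by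
  obtain ⟨k, hk1, hk2⟩ := exists_nat_pow_near_of_lt_one hs0 hs1 (by norm_num : (0:ℝ) < 1/2)
    (by norm_num)
  have hb : (4 * (k : ℝ) + 1) ≤ 12 * (4/3 : ℝ) ^ k := by
    have := one_add_mul_le_pow (by norm_num : (-2:ℝ) ≤ 1/3) k
    norm_num at this
    have hk : (0:ℝ) ≤ k := Nat.cast_nonneg k
    linarith
  have h3 : (4 * (k : ℝ) + 1) * (3/2 : ℝ) ^ k * s ≤ 12 := by
    calc (4 * (k : ℝ) + 1) * (3/2 : ℝ) ^ k * s ≤ 12 * (4/3 : ℝ) ^ k * (3/2 : ℝ) ^ k * (1/2) ^ k := by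
          gcongr
      _ = 12 * ((4/3) * (3/2) * (1/2)) ^ k := by rw [mul_pow, mul_pow]; ring
      _ = 12 := by norm_num
  refine ⟨k, ?_, ?_, h3, ?_⟩
  · have : (1/2 : ℝ) ^ k ≤ 2 * s := by rw [pow_succ] at hk1; linarith
    calc (1/2 : ℝ) ^ (4 * k) = ((1/2 : ℝ) ^ k) ^ 4 := by rw [← pow_mul]; ring_nf
      _ ≤ (2 * s) ^ 4 := by gcongr
      _ = _ := by ring
  · calc (3/2 : ℝ) ^ k * s ≤ (3/2) ^ k * (1/2) ^ k := by gcongr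
      _ = (3/4) ^ k := by rw [← mul_pow]; norm_num
      _ ≤ 1 := pow_le_one₀ (by norm_num) (by norm_num)
  · refine le_trans ?_ h3
    have : (1:ℝ) ≤ (3/2) ^ k := one_le_pow₀ (by norm_num)
    have hk : (0:ℝ) ≤ 4 * k + 1 := by positivity
    nlinarith [mul_le_mul_of_nonneg_left this (mul_nonneg hk hs0.le)]

lemma GoodField.hol {U C : ℝ} {v : ℝ × ℝ → ℝ × ℝ} (hv : GoodField U C v) (hC : 1 ≤ C) (s : ℝ)
    (hs0 : 0 < s) (hs1 : s ≤ 1) (x y : ℝ × ℝ) (hxy : ‖x - y‖ ≤ s ^ 4) :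
    ‖v x - v y‖ ≤ 44 * C * s ^ 3 := by
  obtain ⟨k, h1, h2, h3, h4⟩ := dyadic_choice s hs0 hs1
  have hm := hv.modulus (4 * k) x y
  push_cast at hm
  have hs3 : 0 < s ^ 3 := by positivity
  calc ‖v x - v y‖ ≤ C * (4 * k + 1) * ‖x - y‖ + 2 * C * (1/2) ^ (4 * k) := hm
    _ ≤ C * (4 * k + 1) * s ^ 4 + 2 * C * (16 * s ^ 4) := by gcongr
    _ = C * s ^ 3 * ((4 * k + 1) * s) + 32 * C * s ^ 3 * s := by ring
    _ ≤ C * s ^ 3 * 12 + 32 * C * s ^ 3 * 1 := by gcongr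
    _ = _ := by ring

lemma GoodField.continuous {U C : ℝ} {v : ℝ × ℝ → ℝ × ℝ} (hv : GoodField U C v) (hC : 1 ≤ C) :
    Continuous v := by
  rw [Metric.continuous_iff]
  intro b ε hε
  obtain ⟨s, hs0, hs1, hs⟩ : ∃ s : ℝ, 0 < s ∧ s ≤ 1 ∧ 44 * C * s ^ 3 < ε := by
    refine ⟨min 1 (ε / (45 * C)), by positivity, min_le_left _ _, ?_⟩
    set s := min 1 (ε / (45 * C)) with hs
    have h0 : 0 < s := by positivity
    have h1 : s ≤ 1 := min_le_left _ _
    have h2 : s ≤ ε / (45 * C) := min_le_right _ _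
    rw [le_div_iff₀ (by positivity)] at h2
    have h3 : s ^ 3 ≤ s := pow_le_of_le_one h0.le h1 (by norm_num)
    nlinarith [mul_le_mul_of_nonneg_left h3 (by linarith : (0:ℝ) ≤ C), mul_pos (by linarith : (0:ℝ) < C) h0]
  refine ⟨s ^ 4, by positivity, fun a ha => ?_⟩
  rw [dist_eq_norm] at ha ⊢
  exact (hv.hol hC s hs0 hs1 a b ha.le).trans_lt hs

/-- quantitative stability -/
lemma stability {C : ℝ} (hC : 1 ≤ C) {e e' : ℝ → ℝ × ℝ} {a b : ℝ} (hab : b - a ≤ 1 / (10 * C))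
    (hd : ∀ t ∈ Set.Icc a b, HasDerivWithinAt e (e' t) (Set.Icc a b) t)
    (hb : ∀ t ∈ Set.Icc a b, ∀ J : ℕ, ‖e' t‖ ≤ C * (J + 1) * ‖e t‖ + 2 * C * (1/2) ^ J)
    (s : ℝ) (hs0 : 0 < s) (hs1 : s ≤ 1) (ha : ‖e a‖ ≤ s ^ 4) :
    ∀ t ∈ Set.Icc a b, ‖e t‖ ≤ 10 * s ^ 3 ∧ ‖e' t‖ ≤ 152 * C * s ^ 3 := by
  intro t ht
  obtain ⟨k, h1, h2, h3, h4⟩ := dyadic_choice s hs0 hs1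
  have hs3 : 0 < s ^ 3 := by positivity
  have hK : 0 < C * (4 * k + 1) := by positivity
  have hg := norm_le_gronwallBound_of_norm_deriv_right_le (f := e) (f' := e') (δ := s ^ 4)
    (K := C * (4 * k + 1)) (ε := 2 * C * (16 * s ^ 4)) (a := a) (b := b)
    (fun t ht => (hd t ht).continuousWithinAt)
    (fun t ht => by
      have := hd t ⟨ht.1, ht.2.le⟩
      exact ((this.mono_of_mem_nhdsWithin (Icc_mem_nhdsGE_of_mem ht))))
    ha (fun t ht => by
      have := hb t ⟨ht.1, ht.2.le⟩ (4 * k)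
      push_cast at this
      refine this.trans ?_
      gcongr) t ht
  rw [gronwallBound_of_K_ne_0 hK.ne'] at hg
  set q := C * (4 * k + 1) * (t - a) with hq
  have hta : 0 ≤ t - a := by linarith [ht.1]
  have hq0 : 0 ≤ q := by positivity
  have htC : C * (t - a) ≤ 1 / 10 := by
    have : t - a ≤ 1 / (10 * C) := by linarith [ht.2]
    rw [le_div_iff₀ (by positivity)] at this
    linarith
  have hq1 : q ≤ (2/5) * k + 1/10 := by
    have : q = (4 * k + 1) * (C * (t - a)) := by rw [hq]; ring
    rw [this]
    calc (4 * k + 1) * (C * (t - a)) ≤ (4 * k + 1) * (1/10 : ℝ) := by gcongr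
      _ = _ := by ring
  have he1 : Real.exp q ≤ 2 * (3/2) ^ k := by
    have hA : Real.exp (2/5) ≤ 3/2 := by
      have h5 : Real.exp (2/5) ^ 5 ≤ (3/2 : ℝ) ^ 5 := by
        rw [← Real.exp_nat_mul]
        have : ((5 : ℕ) : ℝ) * (2/5) = 1 + 1 := by norm_num
        rw [this, Real.exp_add]
        have := Real.exp_one_lt_d9
        have h0 := Real.exp_pos 1
        nlinarith
      exact le_of_pow_le_pow_left₀ (by norm_num) (by norm_num) h5
    have hB : Real.exp (1/10) ≤ 2 := by
      have := Real.exp_bound_div_one_sub_of_interval (x := 1/10) (by norm_num) (by norm_num)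
      norm_num at this ⊢; linarith
    calc Real.exp q ≤ Real.exp (k * (2/5) + 1/10) := by
          apply Real.exp_le_exp.2; linarith
      _ = Real.exp (2/5) ^ k * Real.exp (1/10) := by rw [Real.exp_add, Real.exp_nat_mul]
      _ ≤ (3/2) ^ k * 2 := by gcongr
      _ = _ := by ring
  have hexp : Real.exp q - 1 ≤ q * Real.exp q := by
    have := Real.add_one_le_exp (-q)
    have h0 := Real.exp_pos q
    have : Real.exp q * (-q + 1) ≤ Real.exp q * Real.exp (-q) := by gcongr
    rw [← Real.exp_add] at this
    simp at this
    linarith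
  have hmain : ‖e t‖ ≤ 10 * ((3/2) ^ k * s ^ 4) := by
    calc ‖e t‖ ≤ s ^ 4 * Real.exp q + 2 * C * (16 * s ^ 4) / (C * (4 * k + 1)) * (Real.exp q - 1) := hg
      _ ≤ s ^ 4 * Real.exp q + 2 * C * (16 * s ^ 4) / (C * (4 * k + 1)) * (q * Real.exp q) := by
        gcongr
      _ = s ^ 4 * Real.exp q + 32 * s ^ 4 * (C * (t - a)) * Real.exp q := by
        rw [hq]; field_simp; ring
      _ ≤ s ^ 4 * Real.exp q + 32 * s ^ 4 * (1/10) * Real.exp q := by gcongr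
      _ = (42/10) * s ^ 4 * Real.exp q := by ring
      _ ≤ (42/10) * s ^ 4 * (2 * (3/2) ^ k) := by gcongr
      _ ≤ _ := by
        have : 0 < (3/2) ^ k * s ^ 4 := by positivity
        linarith
  constructor
  · calc ‖e t‖ ≤ 10 * (((3/2) ^ k * s) * s ^ 3) := hmain.trans (le_of_eq (by ring))
      _ ≤ 10 * (1 * s ^ 3) := by gcongr
      _ = _ := by ring
  · have := hb t ht (4 * k)
    push_cast at this
    calc ‖e' t‖ ≤ C * (4 * k + 1) * ‖e t‖ + 2 * C * (1/2) ^ (4 * k) := this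
      _ ≤ C * (4 * k + 1) * (10 * ((3/2) ^ k * s ^ 4)) + 2 * C * (16 * s ^ 4) := by gcongr
      _ = 10 * C * s ^ 3 * ((4 * k + 1) * (3/2) ^ k * s) + 32 * C * s ^ 3 * s := by ring
      _ ≤ 10 * C * s ^ 3 * 12 + 32 * C * s ^ 3 * 1 := by gcongr
      _ = _ := by ring

lemma stability_zero {C : ℝ} (hC : 1 ≤ C) {e e' : ℝ → ℝ × ℝ} {a b : ℝ} (hab : b - a ≤ 1 / (10 * C))
    (hd : ∀ t ∈ Set.Icc a b, HasDerivWithinAt e (e' t) (Set.Icc a b) t)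
    (hb : ∀ t ∈ Set.Icc a b, ∀ J : ℕ, ‖e' t‖ ≤ C * (J + 1) * ‖e t‖ + 2 * C * (1/2) ^ J)
    (ha : e a = 0) : ∀ t ∈ Set.Icc a b, e t = 0 := by
  intro t ht
  have h : ∀ s : ℝ, 0 < s → s ≤ 1 → ‖e t‖ ≤ 10 * s := fun s h0 h1 => by
    have := (stability hC hab hd hb s h0 h1 (by rw [ha, norm_zero]; positivity) t ht).1
    have h3 : s ^ 3 ≤ s := pow_le_of_le_one h0.le h1 (by norm_num)
    linarith
  by_contra hne
  have hp : 0 < ‖e t‖ := norm_pos_iff.2 hne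
  have := h (min 1 (‖e t‖ / 20)) (by positivity) (min_le_left _ _)
  have h2 := min_le_right 1 (‖e t‖ / 20)
  linarith

/-- weak form of the divergence free condition -/
lemma GoodField.weak_div {U C : ℝ} {v : ℝ × ℝ → ℝ × ℝ} (hv : GoodField U C v) (hC : 1 ≤ C)
    (ρ : ℝ × ℝ → ℝ) (hρ : ContDiff ℝ 1 ρ) (hc : HasCompactSupport ρ) :
    ∫ y, fderiv ℝ ρ y (v y) = 0 := by
  have hdρ : Continuous (fderiv ℝ ρ) := hρ.continuous_fderiv (by norm_num)
  have hcd : HasCompactSupport (fderiv ℝ ρ) := hc.fderiv ℝ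
  have hni : Integrable (fun y => ‖fderiv ℝ ρ y‖) :=
    (hdρ.integrable_of_hasCompactSupport hcd).norm
  set B := ∫ y, ‖fderiv ℝ ρ y‖ with hB
  have hint : ∀ g : ℝ × ℝ → ℝ × ℝ, Continuous g → Integrable fun y => fderiv ℝ ρ y (g y) := by
    intro g hg
    refine (hdρ.clm_apply hg).integrable_of_hasCompactSupport ?_
    refine hcd.mono ?_
    intro y hy
    contrapose! hy
    simp only [Function.mem_support, not_not] at hy ⊢
    simp [hy]
  have hvc := hv.continuous hC
  have key : ∀ J : ℕ, |∫ y, fderiv ℝ ρ y (v y)| ≤ C * (1/2) ^ J * B := by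
    intro J
    obtain ⟨g, g', hg, hg', hdiv, hvg⟩ := hv.reg J
    have hgd : Differentiable ℝ g := fun x => (hg x).differentiableAt
    have hgc : Continuous g := hgd.continuous
    have hρd : Differentiable ℝ ρ := hρ.differentiable (by norm_num)
    have h1 : ∀ x, HasFDerivAt (fun x => (g x).1) ((ContinuousLinearMap.fst ℝ ℝ ℝ).comp (g' x)) x :=
      fun x => (hg x).fst
    have h2 : ∀ x, HasFDerivAt (fun x => (g x).2) ((ContinuousLinearMap.snd ℝ ℝ ℝ).comp (g' x)) x :=
      fun x => (hg x).snd
    have hρi : Integrable ρ := hρ.continuous.integrable_of_hasCompactSupport hc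
    have hbd : ∀ (f : ℝ × ℝ → ℝ) (c : ℝ) (z : ℝ × ℝ), (∀ x, |fderiv ℝ f x z| ≤ c) →
        Integrable (fun x => ρ x * fderiv ℝ f x z) := by
      intro f c z hf
      refine Integrable.mul_bdd (c := c) hρi ?_ (Eventually.of_forall hf)
      exact (measurable_fderiv_apply_const ℝ f z).aestronglyMeasurable
    have hcs : ∀ (f : ℝ × ℝ → ℝ) (z : ℝ × ℝ), Continuous f →
        Integrable (fun x => fderiv ℝ ρ x z * f x) := by
      intro f z hf
      refine ((hdρ.clm_apply continuous_const).mul hf).integrable_of_hasCompactSupport ?_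
      refine hcd.mono ?_
      intro y hy
      contrapose! hy
      simp only [Function.mem_support, not_not] at hy ⊢
      simp [hy]
    have hbp : ∀ (f : ℝ × ℝ → ℝ) (c : ℝ) (z : ℝ × ℝ), Differentiable ℝ f → (∀ x, |fderiv ℝ f x z| ≤ c) →
        ∫ x, ρ x * fderiv ℝ f x z = -∫ x, fderiv ℝ ρ x z * f x := by
      intro f c z hfd hf
      exact integral_mul_fderiv_eq_neg_fderiv_mul_of_integrable (hcs f z hfd.continuous)
        (hbd f c z hf) ((hρ.continuous.mul hfd.continuous).integrable_of_hasCompactSupport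
          hc.mul_right) (fun x _ => hρd x) (fun x _ => hfd x)
    have f1 : ∀ x z, fderiv ℝ (fun x => (g x).1) x z = (g' x z).1 := fun x z => by
      rw [(h1 x).fderiv]; rfl
    have f2 : ∀ x z, fderiv ℝ (fun x => (g x).2) x z = (g' x z).2 := fun x z => by
      rw [(h2 x).fderiv]; rfl
    have hg'b : ∀ x z, ‖g' x z‖ ≤ C * (J + 1) * ‖z‖ := fun x z =>
      (ContinuousLinearMap.le_opNorm _ _).trans (by gcongr; exact hg' x)
    have b1 : ∀ x z, |fderiv ℝ (fun x => (g x).1) x z| ≤ C * (J + 1) * ‖z‖ := fun x z => by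
      rw [f1]; exact (norm_fst_le _).trans (hg'b x z)
    have b2 : ∀ x z, |fderiv ℝ (fun x => (g x).2) x z| ≤ C * (J + 1) * ‖z‖ := fun x z => by
      rw [f2]; exact (norm_snd_le _).trans (hg'b x z)
    have d1 : Differentiable ℝ (fun x => (g x).1) := fun x => (h1 x).differentiableAt
    have d2 : Differentiable ℝ (fun x => (g x).2) := fun x => (h2 x).differentiableAt
    have e1 := hbp _ _ (1, 0) d1 (fun x => b1 x _)
    have e2 := hbp _ _ (0, 1) d2 (fun x => b2 x _)
    have hsplit : ∀ y, fderiv ℝ ρ y (g y) =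
        fderiv ℝ ρ y (1, 0) * (g y).1 + fderiv ℝ ρ y (0, 1) * (g y).2 := by
      intro y
      have : g y = (g y).1 • ((1 : ℝ), (0 : ℝ)) + (g y).2 • ((0 : ℝ), (1 : ℝ)) := by
        ext <;> simp
      conv_lhs => rw [this]
      rw [map_add, map_smul, map_smul]; simp [mul_comm]
    have hzero : ∫ y, fderiv ℝ ρ y (g y) = 0 := by
      simp_rw [hsplit]
      rw [integral_add (hcs _ _ d1.continuous) (hcs _ _ d2.continuous)]
      have e3 : (∫ x, ρ x * fderiv ℝ (fun x => (g x).1) x (1, 0)) +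
          ∫ x, ρ x * fderiv ℝ (fun x => (g x).2) x (0, 1) = 0 := by
        rw [← integral_add (hbd _ _ _ (fun x => b1 x _)) (hbd _ _ _ (fun x => b2 x _))]
        refine integral_eq_zero_of_ae (Eventually.of_forall fun x => ?_)
        simp only [Pi.zero_apply]
        rw [f1, f2, ← mul_add, hdiv, mul_zero]
      linarith
    have : ∫ y, fderiv ℝ ρ y (v y) = ∫ y, fderiv ℝ ρ y (v y - g y) := by
      simp_rw [map_sub]
      rw [integral_sub (hint v hvc) (hint g hgc), hzero, sub_zero]
    rw [this, ← Real.norm_eq_abs, hB, ← integral_const_mul]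
    refine norm_integral_le_of_norm_le (hni.const_mul _) (Eventually.of_forall fun y => ?_)
    refine (ContinuousLinearMap.le_opNorm _ _).trans ?_
    rw [mul_comm]
    gcongr
    exact hvg y
  have hlim : Tendsto (fun J : ℕ => C * (1/2 : ℝ) ^ J * B) atTop (𝓝 (C * 0 * B)) :=
    ((tendsto_pow_atTop_nhds_zero_of_lt_one (by norm_num) (by norm_num)).const_mul C).mul_const B
  have := ge_of_tendsto' hlim key
  simp at this
  exact this

end part4

section part5
lemma exists_bump : ∃ B : ℝ, 1 ≤ B ∧ ∀ ε : ℝ, 0 < ε → ∃ ρ : ℝ × ℝ → ℝ, ContDiff ℝ 1 ρ ∧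
    HasCompactSupport ρ ∧ (∀ x, 0 ≤ ρ x) ∧ ∫ x, ρ x = 1 ∧ Function.support ρ ⊆ Metric.ball 0 ε ∧
    ∫ x, ‖fderiv ℝ ρ x‖ ≤ B / ε := by
  let φ : ContDiffBump (0 : ℝ × ℝ) := ⟨1/2, 1, by norm_num, by norm_num⟩
  set r : ℝ × ℝ → ℝ := φ.normed volume with hr
  have hrc : ContDiff ℝ 1 r := φ.contDiff_normed
  have hrs : HasCompactSupport r := φ.hasCompactSupport_normed
  set B := ∫ x, ‖fderiv ℝ r x‖ with hB
  have hB0 : 0 ≤ B := integral_nonneg fun x => norm_nonneg _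
  refine ⟨1 + B, by linarith, fun ε hε => ?_⟩
  have hdim : Module.finrank ℝ (ℝ × ℝ) = 2 := by simp
  have hrd : Differentiable ℝ r := hrc.differentiable (by norm_num)
  refine ⟨fun x => (ε ^ 2)⁻¹ * r (ε⁻¹ • x), ?_, ?_, ?_, ?_, ?_, ?_⟩
  · exact contDiff_const.mul (hrc.comp (contDiff_const_smul _))
  · refine HasCompactSupport.mul_left ?_
    exact hrs.comp_smul (inv_ne_zero hε.ne')
  · intro x
    have := φ.nonneg_normed (μ := volume) (ε⁻¹ • x)
    positivity
  · rw [integral_const_mul, Measure.integral_comp_inv_smul, hdim, hr, φ.integral_normed,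
      abs_of_pos (by positivity)]
    simp [hε.ne']
  · intro x hx
    have hx' : ε⁻¹ • x ∈ Function.support r := by
      intro h
      apply hx
      simp [h]
    rw [hr, φ.support_normed_eq] at hx'
    simp only [Metric.mem_ball, dist_zero_right, norm_smul, norm_inv, Real.norm_eq_abs,
      abs_of_pos hε] at hx' ⊢
    change ε⁻¹ * ‖x‖ < 1 at hx'
    rwa [inv_mul_lt_iff₀ hε, mul_one] at hx'
  · have hfd : ∀ x, ‖fderiv ℝ (fun x => (ε ^ 2)⁻¹ * r (ε⁻¹ • x)) x‖ =
        (ε ^ 2)⁻¹ * ε⁻¹ * ‖fderiv ℝ r (ε⁻¹ • x)‖ := by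
      intro x
      have h1 : HasFDerivAt (fun x : ℝ × ℝ => ε⁻¹ • x) (ε⁻¹ • ContinuousLinearMap.id ℝ (ℝ × ℝ)) x :=
        (hasFDerivAt_id x).const_smul ε⁻¹
      have h2 := ((hrd (ε⁻¹ • x)).hasFDerivAt.comp x h1).const_mul (ε ^ 2)⁻¹
      have h3 := h2.fderiv
      simp only [Function.comp_def] at h3
      rw [h3, norm_smul, ContinuousLinearMap.comp_smul, norm_smul, ContinuousLinearMap.comp_id]
      rw [Real.norm_eq_abs, Real.norm_eq_abs, abs_of_pos (by positivity), abs_of_pos (by positivity)]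
      ring
    simp_rw [hfd]
    rw [integral_const_mul, Measure.integral_comp_inv_smul volume (fun x => ‖fderiv ℝ r x‖), hdim, ← hB,
      abs_of_pos (by positivity), smul_eq_mul]
    have : (ε ^ 2)⁻¹ * ε⁻¹ * (ε ^ 2 * B) = B / ε := by field_simp
    rw [this]
    gcongr
    linarith

lemma det_formula (A : (ℝ × ℝ) →L[ℝ] (ℝ × ℝ)) :
    A.det = (A (1, 0)).1 * (A (0, 1)).2 - (A (0, 1)).1 * (A (1, 0)).2 := by
  rw [ContinuousLinearMap.det, ← LinearMap.det_toMatrix (Module.Basis.finTwoProd ℝ),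
    Matrix.det_fin_two]
  simp [LinearMap.toMatrix_apply]

lemma det_near (A : (ℝ × ℝ) →L[ℝ] (ℝ × ℝ)) (a b : ℝ) (ha : ∀ v, ‖A v‖ ≤ a * ‖v‖)
    (hb : |(A (1, 0)).1 + (A (0, 1)).2| ≤ b) (ha0 : 0 ≤ a) (hsm : b + 2 * a ^ 2 ≤ 1) :
    |1 - abs ((ContinuousLinearMap.id ℝ (ℝ × ℝ) + A).det)| ≤ b + 2 * a ^ 2 := by
  have h1 := ha (1, 0)
  have h2 := ha (0, 1)
  have n1 : ‖((1 : ℝ), (0 : ℝ))‖ = 1 := by simp [Prod.norm_def]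
  have n2 : ‖((0 : ℝ), (1 : ℝ))‖ = 1 := by simp [Prod.norm_def]
  rw [n1, mul_one] at h1
  rw [n2, mul_one] at h2
  have p1 := (norm_fst_le (A (1, 0))).trans h1
  have p2 := (norm_snd_le (A (1, 0))).trans h1
  have p3 := (norm_fst_le (A (0, 1))).trans h2
  have p4 := (norm_snd_le (A (0, 1))).trans h2
  have hdet : (ContinuousLinearMap.id ℝ (ℝ × ℝ) + A).det = 1 + ((A (1, 0)).1 + (A (0, 1)).2) +
      ((A (1, 0)).1 * (A (0, 1)).2 - (A (0, 1)).1 * (A (1, 0)).2) := by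
    rw [det_formula]
    simp
    ring
  set d := (ContinuousLinearMap.id ℝ (ℝ × ℝ) + A).det
  rw [Real.norm_eq_abs] at p1 p2 p3 p4
  have q1 : |(A (1, 0)).1 * (A (0, 1)).2| ≤ a ^ 2 := by
    rw [abs_mul, sq]; gcongr
  have q2 : |(A (0, 1)).1 * (A (1, 0)).2| ≤ a ^ 2 := by
    rw [abs_mul, sq]; gcongr
  have h : |1 - d| ≤ b + 2 * a ^ 2 := by
    rw [hdet, abs_le]
    rw [abs_le] at q1 q2 hb
    constructor <;> linarith [q1.1, q1.2, q2.1, q2.2, hb.1, hb.2]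
  have hd : 0 ≤ d := by
    rw [abs_le] at h; linarith [h.2]
  rwa [abs_of_nonneg hd]

end part5

section part6
lemma mollify (ρ : ℝ × ℝ → ℝ) (hρ : ContDiff ℝ 1 ρ) (hc : HasCompactSupport ρ)
    (hpos : ∀ x, 0 ≤ ρ x) (hone : ∫ x, ρ x = 1) (ε b : ℝ)
    (hsupp : Function.support ρ ⊆ Metric.ball 0 ε) (hb : ∫ x, ‖fderiv ℝ ρ x‖ ≤ b)
    (w : ℝ × ℝ → ℝ × ℝ) (hw : Continuous w) (c d : ℝ) (hc0 : 0 ≤ c) (hd0 : 0 ≤ d)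
    (hosc : ∀ x y, ‖x - y‖ ≤ ε → ‖w x - w y‖ ≤ c)
    (hdiv : ∀ φ : ℝ × ℝ → ℝ, ContDiff ℝ 1 φ → HasCompactSupport φ →
      |∫ y, fderiv ℝ φ y (w y)| ≤ d * ∫ y, ‖fderiv ℝ φ y‖) :
    ∃ W : ℝ × ℝ → ℝ × ℝ, ∃ W' : ℝ × ℝ → (ℝ × ℝ) →L[ℝ] (ℝ × ℝ),
      (∀ x, HasFDerivAt W (W' x) x) ∧ (∀ x, ‖W x - w x‖ ≤ c) ∧
      (∀ x v, ‖W' x v‖ ≤ b * c * ‖v‖) ∧ (∀ x, |(W' x (1, 0)).1 + (W' x (0, 1)).2| ≤ d * b) := by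
  have hdρ : Continuous (fderiv ℝ ρ) := hρ.continuous_fderiv (by norm_num)
  have hρd : Differentiable ℝ ρ := hρ.differentiable (by norm_num)
  have hcd : HasCompactSupport (fderiv ℝ ρ) := hc.fderiv ℝ
  have hni : Integrable (fun y => ‖fderiv ℝ ρ y‖) :=
    (hdρ.integrable_of_hasCompactSupport hcd).norm
  have hwl : LocallyIntegrable w := hw.locallyIntegrable
  set L : ℝ →L[ℝ] (ℝ × ℝ) →L[ℝ] (ℝ × ℝ) := ContinuousLinearMap.lsmul ℝ ℝ with hL
  set W' : ℝ × ℝ → (ℝ × ℝ) →L[ℝ] (ℝ × ℝ) :=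
    convolution (fderiv ℝ ρ) w (ContinuousLinearMap.precompL (ℝ × ℝ) L) volume with hW'
  have hcsi : ∀ (f : ℝ × ℝ → ℝ × ℝ) (z : ℝ × ℝ), Continuous f →
      Integrable (fun x => fderiv ℝ ρ x z • f x) := by
    intro f z hf
    refine ((hdρ.clm_apply continuous_const).smul hf).integrable_of_hasCompactSupport ?_
    refine hcd.mono ?_
    intro y hy
    contrapose! hy
    simp only [Function.mem_support, not_not] at hy ⊢
    simp [hy]
  have hW'a : ∀ x z, W' x z = ∫ t, fderiv ℝ ρ t z • w (x - t) := by
    intro x z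
    have hex := hcd.convolutionExists_left (ContinuousLinearMap.precompL (ℝ × ℝ) L) hdρ hwl x
    rw [hW', convolution, ContinuousLinearMap.integral_apply hex]
    rfl
  have hsuppd : ∀ t, ε ≤ ‖t‖ → fderiv ℝ ρ t = 0 := by
    intro t ht
    have : ∀ y, 0 ≤ ρ y := hpos
    have ht0 : ρ t = 0 := by
      by_contra h
      have := hsupp h
      simp at this; linarith
    have hmin : IsLocalMin ρ t := Eventually.of_forall fun y => by rw [ht0]; exact hpos y
    exact hmin.fderiv_eq_zero
  refine ⟨convolution ρ w L volume, W', fun x => hc.hasFDerivAt_convolution_left L hρ hwl x, ?_, ?_, ?_⟩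
  · intro x
    rw [← dist_eq_norm]
    refine dist_convolution_le hc0 hsupp hpos hone hw.aestronglyMeasurable ?_
    intro y hy
    rw [dist_eq_norm]
    apply hosc
    rw [Metric.mem_ball, dist_eq_norm] at hy
    exact hy.le
  · intro x z
    have hz : ∫ t, fderiv ℝ ρ t z = 0 := by
      have h1 : Integrable (fun t => fderiv ℝ ρ t z) := by
        refine (hdρ.clm_apply continuous_const).integrable_of_hasCompactSupport ?_
        refine hcd.mono ?_
        intro y hy
        contrapose! hy
        simp only [Function.mem_support, not_not] at hy ⊢
        simp [hy]
      have := integral_mul_fderiv_eq_neg_fderiv_mul_of_integrable (μ := volume)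
        (f := fun _ : ℝ × ℝ => (1:ℝ)) (g := ρ) (v := z) (by simp) (by simpa using h1)
        (by simpa using hρ.continuous.integrable_of_hasCompactSupport hc)
        (fun x _ => differentiableAt_const _) (fun x _ => hρd x)
      simpa using this
    have hz2 : ∫ t, fderiv ℝ ρ t z • w x = 0 := by
      rw [integral_smul_const, hz, zero_smul]
    have : W' x z = ∫ t, fderiv ℝ ρ t z • (w (x - t) - w x) := by
      simp_rw [smul_sub]
      rw [integral_sub (hcsi (fun t => w (x - t)) z (by fun_prop)) (hcsi (fun _ => w x) z (by fun_prop)), hz2, sub_zero, hW'a]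
    rw [this]
    have hle : ‖∫ t, fderiv ℝ ρ t z • (w (x - t) - w x)‖ ≤ ∫ t, ‖fderiv ℝ ρ t‖ * (c * ‖z‖) := by
      refine norm_integral_le_of_norm_le (hni.mul_const _) (Eventually.of_forall fun t => ?_)
      rcases le_or_gt ε ‖t‖ with h | h
      · rw [hsuppd t h]; simp
      · rw [norm_smul]
        have h1 := (fderiv ℝ ρ t).le_opNorm z
        have h2 : ‖w (x - t) - w x‖ ≤ c := hosc _ _ (by simpa using h.le)
        calc ‖fderiv ℝ ρ t z‖ * ‖w (x - t) - w x‖ ≤ ‖fderiv ℝ ρ t‖ * ‖z‖ * c := by gcongr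
          _ = _ := by ring
    refine hle.trans ?_
    rw [integral_mul_const]
    calc (∫ t, ‖fderiv ℝ ρ t‖) * (c * ‖z‖) ≤ b * (c * ‖z‖) := by gcongr
      _ = _ := by ring
  · intro x
    have h1 : (W' x (1, 0)).1 + (W' x (0, 1)).2 = ∫ t, fderiv ℝ ρ t (w (x - t)) := by
      have i1 := hcsi (fun t => w (x - t)) (1, 0) (by fun_prop)
      have i2 := hcsi (fun t => w (x - t)) (0, 1) (by fun_prop)
      rw [hW'a, hW'a, fst_integral i1, snd_integral i2, ← integral_add i1.fst i2.snd]
      congr 1; ext t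
      have : w (x - t) = (w (x - t)).1 • ((1 : ℝ), (0 : ℝ)) + (w (x - t)).2 • ((0 : ℝ), (1 : ℝ)) := by
        ext <;> simp
      conv_rhs => rw [this]
      rw [map_add, map_smul, map_smul]; simp [mul_comm]
    have hfd : ∀ y, fderiv ℝ (fun y => ρ (x - y)) y = -fderiv ℝ ρ (x - y) := by
      intro y
      have h1 : HasFDerivAt (fun y : ℝ × ℝ => x - y) (-ContinuousLinearMap.id ℝ (ℝ × ℝ)) y :=
        (hasFDerivAt_id y).const_sub x
      have h2 := ((hρd (x - y)).hasFDerivAt.comp y h1).fderiv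
      simp only [Function.comp_def] at h2
      rw [h2]; simp
    have h2 : ∫ t, fderiv ℝ ρ t (w (x - t)) = -∫ y, fderiv ℝ (fun y => ρ (x - y)) y (w y) := by
      rw [← integral_sub_left_eq_self (fun t => fderiv ℝ ρ t (w (x - t))) volume x, ← integral_neg]
      congr 1; ext y
      rw [hfd]; simp
    have h3 := hdiv (fun y => ρ (x - y)) (by fun_prop) (hc.comp_homeomorph (Homeomorph.subLeft x))
    rw [h1, h2, abs_neg]
    refine h3.trans ?_
    simp_rw [hfd, norm_neg]
    rw [integral_sub_left_eq_self (fun t => ‖fderiv ℝ ρ t‖) volume x]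
    gcongr

end part6

section part7
lemma core (A R : ℝ) (hA : 1 ≤ A) : ∃ K η0 : ℝ, 0 < η0 ∧ η0 ≤ 1 ∧
    ∀ η : ℝ, 0 < η → η ≤ η0 → ∀ (w : ℝ × ℝ → ℝ × ℝ) (F : ℝ × ℝ → ℝ), Continuous w → Continuous F →
    (∀ x, ‖w x‖ ≤ A * η ^ 32) →
    (∀ s : ℝ, 0 < s → s ≤ 1 → ∀ x y, ‖x - y‖ ≤ s ^ 4 → ‖w x - w y‖ ≤ A * η ^ 32 * s ^ 3) →
    (∀ φ : ℝ × ℝ → ℝ, ContDiff ℝ 1 φ → HasCompactSupport φ →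
      |∫ y, fderiv ℝ φ y (w y)| ≤ A * η ^ 56 * ∫ y, ‖fderiv ℝ φ y‖) →
    (∀ x, |F x| ≤ A) → (∀ x, R < ‖x‖ → F x = 0) →
    (∀ s : ℝ, 0 < s → s ≤ 1 → ∀ x y, ‖x - y‖ ≤ s ^ 4 → |F x - F y| ≤ A * s ^ 3) →
    |(∫ x, F (x + w x)) - ∫ x, F x| ≤ K * η ^ 33 := by
  obtain ⟨B, hB, hbump⟩ := exists_bump
  have hAB : 1 ≤ A ^ 2 * B ^ 2 := by
    have : 1 ≤ A * B := by nlinarith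
    have : 1 ≤ (A * B) ^ 2 := one_le_pow₀ this
    linarith [mul_pow A B 2]
  refine ⟨(A ^ 4 + 3 * A ^ 3 * B ^ 2) * volume.real (Metric.closedBall (0 : ℝ × ℝ) (R + 2)),
    1 / (4 * (A ^ 2 * B ^ 2)), by positivity, ?_, ?_⟩
  · rw [div_le_one (by positivity)]; linarith
  intro η hη0 hη w F hwc hFc hwb hwh hdiv hFb hFs hFh
  have hη' : A ^ 2 * B ^ 2 * η ≤ 1 / 4 := by
    rw [le_div_iff₀ (by positivity)] at hη; linarith
  have hη1 : η ≤ 1 := by nlinarith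
  have hpw : ∀ n : ℕ, n ≠ 0 → η ^ n ≤ η := fun n hn => pow_le_of_le_one hη0.le hη1 hn
  have hABη : A * B * η ≤ 1 / 4 := by
    have : A * B ≤ A ^ 2 * B ^ 2 := by nlinarith [mul_pos (by linarith : 0 < A) (by linarith : 0 < B)]
    nlinarith
  have hAη : A * η ≤ 1 / 4 := by
    have : A ≤ A * B := by nlinarith
    nlinarith
  obtain ⟨ρ, hρ, hcs, hpos, hone, hsupp, hb⟩ := hbump (η ^ 16) (by positivity)
  obtain ⟨W, W', hW, hWw, hWb, hWt⟩ := mollify ρ hρ hcs hpos hone (η ^ 16) (B / η ^ 16) hsupp hb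
    w hwc (A * η ^ 44) (A * η ^ 56) (by positivity) (by positivity)
    (fun x y hxy => by
      have := hwh (η ^ 4) (by positivity) (pow_le_one₀ hη0.le hη1) x y (by rw [← pow_mul]; exact hxy)
      refine this.trans (le_of_eq (by ring))) hdiv
  have e1 : B / η ^ 16 * (A * η ^ 44) = A * B * η ^ 28 := by field_simp
  have e2 : A * η ^ 56 * (B / η ^ 16) = A * B * η ^ 40 := by field_simp
  simp_rw [e1] at hWb
  simp_rw [e2] at hWt
  have hsm1 : A * B * η ^ 28 ≤ 1 / 2 := by
    have := mul_le_mul_of_nonneg_left (hpw 28 (by norm_num)) (by positivity : 0 ≤ A * B)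
    linarith
  have hdet1 : A * B * η ^ 40 + 2 * (A * B * η ^ 28) ^ 2 ≤ 3 * (A ^ 2 * B ^ 2) * η ^ 33 := by
    have h1 : η ^ 40 ≤ η ^ 33 := pow_le_pow_of_le_one hη0.le hη1 (by norm_num)
    have h2 : η ^ 56 ≤ η ^ 33 := pow_le_pow_of_le_one hη0.le hη1 (by norm_num)
    have h3 : A * B ≤ A ^ 2 * B ^ 2 := by
      nlinarith [mul_pos (by linarith : 0 < A) (by linarith : 0 < B)]
    calc A * B * η ^ 40 + 2 * (A * B * η ^ 28) ^ 2 = A * B * η ^ 40 + 2 * (A ^ 2 * B ^ 2) * η ^ 56 := by ring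
      _ ≤ (A ^ 2 * B ^ 2) * η ^ 33 + 2 * (A ^ 2 * B ^ 2) * η ^ 33 := by gcongr
      _ = _ := by ring
  have hdet2 : 3 * (A ^ 2 * B ^ 2) * η ^ 33 ≤ 1 := by
    have := mul_le_mul_of_nonneg_left (hpw 33 (by norm_num)) (by positivity : 0 ≤ A ^ 2 * B ^ 2)
    linarith
  have hdet : ∀ x, |1 - abs ((ContinuousLinearMap.id ℝ (ℝ × ℝ) + W' x).det)| ≤
      3 * (A ^ 2 * B ^ 2) * η ^ 33 := fun x =>
    (det_near (W' x) (A * B * η ^ 28) (A * B * η ^ 40) (hWb x) (hWt x) (by positivity)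
      (hdet1.trans hdet2)).trans hdet1
  have hΦ : ∀ x, HasFDerivAt (fun x => x + W x) (ContinuousLinearMap.id ℝ (ℝ × ℝ) + W' x) x :=
    fun x => (hasFDerivAt_id x).add (hW x)
  have hWn : ∀ x, ‖W' x‖ ≤ 1/2 := fun x =>
    ContinuousLinearMap.opNorm_le_bound _ (by norm_num) fun v => (hWb x v).trans (by gcongr)
  have hLip : ∀ x y, ‖W x - W y‖ ≤ 1/2 * ‖x - y‖ := fun x y =>
    Convex.norm_image_sub_le_of_norm_hasFDerivWithin_le (s := Set.univ) (x := y) (y := x)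
      (fun z _ => (hW z).hasFDerivWithinAt) (fun z _ => hWn z) convex_univ trivial trivial
  have happ : ApproximatesLinearOn (fun x => x + W x)
      ((ContinuousLinearEquiv.refl ℝ (ℝ × ℝ) : (ℝ × ℝ) ≃L[ℝ] (ℝ × ℝ)) : (ℝ × ℝ) →L[ℝ] (ℝ × ℝ))
      Set.univ (1/2) := by
    intro x _ y _
    have h1 : x + W x - (y + W y) - (x - y) = W x - W y := by abel
    have h2 := hLip x y
    rw [← h1] at h2
    simpa using h2
  have hlt : Subsingleton (ℝ × ℝ) ∨ (1/2 : NNReal) <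
      ‖((ContinuousLinearEquiv.refl ℝ (ℝ × ℝ)).symm : (ℝ × ℝ) →L[ℝ] (ℝ × ℝ))‖₊⁻¹ := by
    right
    have : ‖((ContinuousLinearEquiv.refl ℝ (ℝ × ℝ)).symm : (ℝ × ℝ) →L[ℝ] (ℝ × ℝ))‖₊ = 1 := by
      simp
    rw [this]
    rw [inv_one]
    exact NNReal.half_lt_self one_ne_zero
  have hsurj := happ.surjective hlt
  have hinj : Function.Injective (fun x => x + W x) := by
    intro x y hxy
    have h := hLip x y
    have : W x - W y = y - x := by
      have : x + W x = y + W y := hxy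
      rw [sub_eq_sub_iff_add_eq_add]
      rw [add_comm (W x), this]
    rw [this, norm_sub_rev] at h
    have h0 : ‖x - y‖ = 0 := by linarith [norm_nonneg (x - y)]
    exact sub_eq_zero.1 (norm_eq_zero.1 h0)
  have hcv := integral_image_eq_integral_abs_det_fderiv_smul volume MeasurableSet.univ
    (fun x _ => (hΦ x).hasFDerivWithinAt) hinj.injOn F
  have hFcs : HasCompactSupport F := by
    refine HasCompactSupport.of_support_subset_isCompact (isCompact_closedBall (0 : ℝ × ℝ) R) ?_
    intro x hx
    by_contra h
    exact hx (hFs x (by simpa using h))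
  have hFi : Integrable F := hFc.integrable_of_hasCompactSupport hFcs
  have hcvi := (integrableOn_image_iff_integrableOn_abs_det_fderiv_smul volume MeasurableSet.univ
    (fun x _ => (hΦ x).hasFDerivWithinAt) hinj.injOn F).1 hFi.integrableOn
  rw [Set.image_univ, hsurj.range_eq] at hcv
  simp only [Measure.restrict_univ, IntegrableOn, smul_eq_mul] at hcv hcvi
  have hwsm : ∀ x, ‖w x‖ ≤ 1 := fun x => (hwb x).trans (by
    have := mul_le_mul_of_nonneg_left (hpw 32 (by norm_num)) (by positivity : 0 ≤ A)
    linarith)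
  have hWsm : ∀ x, ‖W x‖ ≤ 2 := fun x => by
    have h1 := hWw x
    have h2 := hwsm x
    have h3 := mul_le_mul_of_nonneg_left (hpw 44 (by norm_num)) (by positivity : 0 ≤ A)
    have h4 : ‖W x‖ ≤ ‖W x - w x‖ + ‖w x‖ := by simpa using norm_add_le (W x - w x) (w x)
    linarith
  have hz : ∀ (V : ℝ × ℝ → ℝ × ℝ), (∀ x, ‖V x‖ ≤ 2) → ∀ x ∉ Metric.closedBall (0 : ℝ × ℝ) (R + 2),
      F (x + V x) = 0 := by
    intro V hV x hx
    apply hFs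
    simp at hx
    have h1 := hV x
    have h2 : ‖x‖ ≤ ‖x + V x‖ + ‖V x‖ := by simpa using norm_sub_le (x + V x) (V x)
    linarith
  have hFwi : Integrable (fun x => F (x + w x)) := by
    refine (hFc.comp (continuous_id.add hwc)).integrable_of_hasCompactSupport ?_
    refine HasCompactSupport.of_support_subset_isCompact (isCompact_closedBall (0 : ℝ × ℝ) (R + 2)) ?_
    intro x hx
    by_contra h
    exact hx (hz w (fun x => (hwsm x).trans (by norm_num)) x h)
  rw [hcv, ← integral_sub hFwi hcvi, ← Real.norm_eq_abs]
  rw [← setIntegral_eq_integral_of_forall_compl_eq_zero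
    (s := Metric.closedBall (0 : ℝ × ℝ) (R + 2))]
  · refine (norm_setIntegral_le_of_norm_le_const (C := (A ^ 4 + 3 * A ^ 3 * B ^ 2) * η ^ 33)
      measure_closedBall_lt_top ?_).trans (le_of_eq (by ring))
    intro x _
    have h1 : |F (x + w x) - F (x + W x)| ≤ A * (A * η ^ 11) ^ 3 := by
      apply hFh _ (by positivity)
      · have h3 := mul_le_mul_of_nonneg_left (hpw 11 (by norm_num)) (by positivity : 0 ≤ A)
        linarith
      · have : x + w x - (x + W x) = -(W x - w x) := by abel
        rw [this, norm_neg]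
        refine (hWw x).trans ?_
        have : A ≤ A ^ 4 := le_self_pow₀ hA (by norm_num)
        calc A * η ^ 44 ≤ A ^ 4 * η ^ 44 := by gcongr
          _ = _ := by ring
    have h2 := hdet x
    set D := abs ((ContinuousLinearMap.id ℝ (ℝ × ℝ) + W' x).det)
    have h3 : |(1 - D) * F (x + W x)| ≤ 3 * (A ^ 2 * B ^ 2) * η ^ 33 * A := by
      rw [abs_mul]
      gcongr
      exact hFb _
    have h4 : F (x + w x) - D * F (x + W x) = (F (x + w x) - F (x + W x)) + (1 - D) * F (x + W x) := by
      ring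
    rw [h4, Real.norm_eq_abs]
    refine (abs_add_le _ _).trans ((add_le_add h1 h3).trans (le_of_eq (by ring)))
  · intro x hx
    rw [hz w (fun x => (hwsm x).trans (by norm_num)) x hx, hz W hWsm x hx]
    simp

end part7

section part8
lemma GoodField.mono {U U' C : ℝ} {v : ℝ × ℝ → ℝ × ℝ} (hv : GoodField U C v) (h : U ≤ U') :
    GoodField U' C v := ⟨fun x => (hv.bdd x).trans h, hv.reg⟩

/-- flow of a time dependent family of good fields -/
structure IsFlow (U C : ℝ) (u : ℝ → ℝ × ℝ → ℝ × ℝ) (X : ℝ × ℝ → ℝ → ℝ × ℝ) : Prop where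
  hU : 1 ≤ U
  hC : 1 ≤ C
  good : ∀ t ≥ (0 : ℝ), GoodField U C (u t)
  zero : ∀ x, X x 0 = x
  ode : ∀ x, ∀ t ≥ (0 : ℝ), HasDerivAt (X x) (u t (X x t)) t
  surj : ∀ t ≥ (0 : ℝ), ∀ y : ℝ × ℝ, ∃ x, X x t = y

section flow
variable {U C : ℝ} {u : ℝ → ℝ × ℝ → ℝ × ℝ} {X : ℝ × ℝ → ℝ → ℝ × ℝ}

lemma IsFlow.curve_stab (hF : IsFlow U C u X) {Z Z' : ℝ → ℝ × ℝ}
    (hZ : ∀ t ≥ (0 : ℝ), HasDerivAt Z (u t (Z t)) t)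
    (hZ' : ∀ t ≥ (0 : ℝ), HasDerivAt Z' (u t (Z' t)) t) {a b : ℝ} (ha : 0 ≤ a)
    (hab : b - a ≤ 1 / (10 * C)) (s : ℝ) (hs0 : 0 < s) (hs1 : s ≤ 1)
    (hs : ‖Z a - Z' a‖ ≤ s ^ 4) : ∀ t ∈ Set.Icc a b,
    ‖Z t - Z' t‖ ≤ 10 * s ^ 3 ∧ ‖u t (Z t) - u t (Z' t)‖ ≤ 152 * C * s ^ 3 :=
  stability hF.hC (e := fun t => Z t - Z' t) (e' := fun t => u t (Z t) - u t (Z' t)) hab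
    (fun t ht => ((hZ t (ha.trans ht.1)).sub (hZ' t (ha.trans ht.1))).hasDerivWithinAt)
    (fun t ht J => (hF.good t (ha.trans ht.1)).modulus J _ _) s hs0 hs1 hs

lemma IsFlow.curve_uniq (hF : IsFlow U C u X) {Z Z' : ℝ → ℝ × ℝ}
    (hZ : ∀ t ≥ (0 : ℝ), HasDerivAt Z (u t (Z t)) t)
    (hZ' : ∀ t ≥ (0 : ℝ), HasDerivAt Z' (u t (Z' t)) t) (h0 : Z 0 = Z' 0) :
    ∀ t ≥ (0 : ℝ), Z t = Z' t := by
  have hC := hF.hC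
  have hτ : 0 < 1 / (10 * C) := by positivity
  have key : ∀ n : ℕ, ∀ t ≥ (0 : ℝ), t ≤ n * (1 / (10 * C)) → Z t = Z' t := by
    intro n
    induction n with
    | zero =>
      intro t ht ht'
      simp at ht'
      have : t = 0 := le_antisymm ht' ht
      rw [this, h0]
    | succ n ih =>
      intro t ht ht'
      set a := max 0 (t - 1 / (10 * C)) with ha
      have ha0 : 0 ≤ a := le_max_left _ _
      have h1 : Z a = Z' a := by
        apply ih a ha0
        apply max_le (by positivity)
        push_cast at ht'; linarith
      have hta : t - a ≤ 1 / (10 * C) := by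
        have := le_max_right 0 (t - 1 / (10 * C)); linarith
      have hat : a ≤ t := max_le ht (by linarith)
      have := stability_zero hC (e := fun t => Z t - Z' t) (e' := fun t => u t (Z t) - u t (Z' t))
        hta (fun t ht => ((hZ t (ha0.trans ht.1)).sub (hZ' t (ha0.trans ht.1))).hasDerivWithinAt)
        (fun t ht J => (hF.good t (ha0.trans ht.1)).modulus J _ _) (by simp [h1]) t ⟨hat, le_rfl⟩
      exact sub_eq_zero.1 this
  intro t ht
  obtain ⟨n, hn⟩ := exists_nat_ge (t / (1 / (10 * C)))
  exact key n t ht (by rwa [div_le_iff₀ hτ] at hn)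

lemma IsFlow.inj (hF : IsFlow U C u X) {t : ℝ} (ht : 0 ≤ t) :
    Function.Injective (fun x => X x t) := by
  intro x x' hxx
  have hC := hF.hC
  have hτ : 0 < 1 / (10 * C) := by positivity
  have key : ∀ n : ℕ, ∀ t ≥ (0 : ℝ), t ≤ n * (1 / (10 * C)) → X x t = X x' t → x = x' := by
    intro n
    induction n with
    | zero =>
      intro t ht ht' h
      simp at ht'
      have : t = 0 := le_antisymm ht' ht
      rwa [this, hF.zero, hF.zero] at h
    | succ n ih =>
      intro t ht ht' h
      set a := max 0 (t - 1 / (10 * C)) with ha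
      have ha0 : 0 ≤ a := le_max_left _ _
      have hta : t - a ≤ 1 / (10 * C) := by
        have := le_max_right 0 (t - 1 / (10 * C)); linarith
      have hat : a ≤ t := max_le ht (by linarith)
      apply ih a ha0
      · apply max_le (by positivity)
        push_cast at ht'; linarith
      · have hpos : ∀ r ∈ Set.Icc 0 (t - a), 0 ≤ t - r := fun r hr => by linarith [hr.2]
        have := stability_zero hC (e := fun r => X x (t - r) - X x' (t - r))
          (e' := fun r => -(u (t - r) (X x (t - r)) - u (t - r) (X x' (t - r)))) (a := 0) (b := t - a)
          (by simpa using hta)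
          (fun r hr => by
            have d1 := (hF.ode x (t - r) (hpos r hr)).scomp r ((hasDerivAt_id r).const_sub t)
            have d2 := (hF.ode x' (t - r) (hpos r hr)).scomp r ((hasDerivAt_id r).const_sub t)
            have := (d1.sub d2).hasDerivWithinAt (s := Set.Icc 0 (t - a))
            refine HasDerivWithinAt.congr_deriv this ?_
            rw [neg_one_smul, neg_one_smul]; abel)
          (fun r hr J => by
            rw [norm_neg]
            exact (hF.good (t - r) (hpos r hr)).modulus J _ _) (by simpa using sub_eq_zero.2 h)
            (t - a) ⟨by linarith, le_rfl⟩
        simp only [sub_sub_cancel] at this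
        exact sub_eq_zero.1 this
  obtain ⟨n, hn⟩ := exists_nat_ge (t / (1 / (10 * C)))
  exact key n t ht (by rwa [div_le_iff₀ hτ] at hn) hxx

lemma IsFlow.speed (hF : IsFlow U C u X) (x : ℝ × ℝ) {s t : ℝ} (hs : 0 ≤ s) (hst : s ≤ t) :
    ‖X x t - X x s‖ ≤ U * (t - s) :=
  norm_image_sub_le_of_norm_deriv_le_segment' (f := X x) (f' := fun r => u r (X x r)) (a := s) (b := t)
    (fun r hr => (hF.ode x r (hs.trans hr.1)).hasDerivWithinAt)
    (fun r hr => (hF.good r (hs.trans hr.1)).bdd _) t ⟨hst, le_rfl⟩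

/-- two parameter flow -/
noncomputable def Psi (X : ℝ × ℝ → ℝ → ℝ × ℝ) (s t : ℝ) (y : ℝ × ℝ) : ℝ × ℝ :=
  X (Function.invFun (fun x => X x s) y) t

lemma IsFlow.psi_X (hF : IsFlow U C u X) {s : ℝ} (hs : 0 ≤ s) (t : ℝ) (x : ℝ × ℝ) :
    Psi X s t (X x s) = X x t := by
  have := Function.leftInverse_invFun (hF.inj hs) x
  exact congrArg (fun z => X z t) this

lemma IsFlow.psi_self (hF : IsFlow U C u X) {s : ℝ} (hs : 0 ≤ s) (y : ℝ × ℝ) :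
    Psi X s s y = y := by
  obtain ⟨x, rfl⟩ := hF.surj s hs y
  rw [hF.psi_X hs]

lemma IsFlow.psi_comp (hF : IsFlow U C u X) {s t : ℝ} (hs : 0 ≤ s) (ht : 0 ≤ t) (r : ℝ) (y : ℝ × ℝ) :
    Psi X t r (Psi X s t y) = Psi X s r y := by
  obtain ⟨x, rfl⟩ := hF.surj s hs y
  rw [hF.psi_X hs, hF.psi_X hs, hF.psi_X ht]

lemma IsFlow.psi_speed (hF : IsFlow U C u X) {s t : ℝ} (hs : 0 ≤ s) (hst : s ≤ t) (y : ℝ × ℝ) :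
    ‖Psi X s t y - y‖ ≤ U * (t - s) := by
  obtain ⟨x, rfl⟩ := hF.surj s hs y
  rw [hF.psi_X hs]; exact hF.speed x hs hst

lemma IsFlow.psi_hol (hF : IsFlow U C u X) {s t : ℝ} (hs : 0 ≤ s) (hst : s ≤ t)
    (hts : t - s ≤ 1 / (10 * C)) (σ : ℝ) (hσ0 : 0 < σ) (hσ1 : σ ≤ 1) (y y' : ℝ × ℝ)
    (hy : ‖y - y'‖ ≤ σ ^ 4) : ‖Psi X s t y - Psi X s t y'‖ ≤ 10 * σ ^ 3 := by
  obtain ⟨x, rfl⟩ := hF.surj s hs y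
  obtain ⟨x', rfl⟩ := hF.surj s hs y'
  rw [hF.psi_X hs, hF.psi_X hs]
  exact (hF.curve_stab (hF.ode x) (hF.ode x') hs hts σ hσ0 hσ1 hy t ⟨hst, le_rfl⟩).1

lemma IsFlow.psi_hol2 (hF : IsFlow U C u X) {s t : ℝ} (hs : 0 ≤ s) (hst : s ≤ t)
    (hts : t - s ≤ 1 / (10 * C)) (σ : ℝ) (hσ0 : 0 < σ) (hσ1 : σ ≤ 1) (y y' : ℝ × ℝ)
    (hy : ‖y - y'‖ ≤ σ ^ 4) :
    ‖(Psi X s t y - y) - (Psi X s t y' - y')‖ ≤ 152 * C * σ ^ 3 * (t - s) := by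
  obtain ⟨x, rfl⟩ := hF.surj s hs y
  obtain ⟨x', rfl⟩ := hF.surj s hs y'
  rw [hF.psi_X hs, hF.psi_X hs]
  have h1 := hF.curve_stab (hF.ode x) (hF.ode x') hs hts σ hσ0 hσ1 hy
  have := norm_image_sub_le_of_norm_deriv_le_segment' (f := fun r => X x r - X x' r)
    (f' := fun r => u r (X x r) - u r (X x' r)) (a := s) (b := t) (C := 152 * C * σ ^ 3)
    (fun r hr => ((hF.ode x r (hs.trans hr.1)).sub (hF.ode x' r (hs.trans hr.1))).hasDerivWithinAt)
    (fun r hr => (h1 r ⟨hr.1, hr.2.le⟩).2) t ⟨hst, le_rfl⟩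
  rw [sub_sub_sub_comm]
  exact this

lemma continuous_of_hol {E : Type*} [SeminormedAddCommGroup E] (g : ℝ × ℝ → E) (c : ℝ) (hc : 0 ≤ c)
    (h : ∀ σ : ℝ, 0 < σ → σ ≤ 1 → ∀ y y', ‖y - y'‖ ≤ σ ^ 4 → ‖g y - g y'‖ ≤ c * σ ^ 3) :
    Continuous g := by
  rw [Metric.continuous_iff]
  intro b ε hε
  set s := min 1 (ε / (c + 1)) with hs
  have h0 : 0 < s := by positivity
  have h1 : s ≤ 1 := min_le_left _ _
  have h2 : s ≤ ε / (c + 1) := min_le_right _ _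
  rw [le_div_iff₀ (by positivity)] at h2
  have h3 : s ^ 3 ≤ s := pow_le_of_le_one h0.le h1 (by norm_num)
  refine ⟨s ^ 4, by positivity, fun a ha => ?_⟩
  rw [dist_eq_norm] at ha ⊢
  refine (h s h0 h1 a b ha.le).trans_lt ?_
  nlinarith [mul_le_mul_of_nonneg_left h3 hc]

lemma IsFlow.psi_cont (hF : IsFlow U C u X) {s t : ℝ} (hs : 0 ≤ s) (hst : s ≤ t)
    (hts : t - s ≤ 1 / (10 * C)) : Continuous (Psi X s t) :=
  continuous_of_hol _ 10 (by norm_num) (hF.psi_hol hs hst hts)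

/-- weak divergence bound for displacement -/
lemma IsFlow.disp_div (hF : IsFlow U C u X) {s δ : ℝ} (hs : 0 ≤ s) (hδ0 : 0 ≤ δ)
    (hδ : δ ≤ 1 / (20 * C)) (σ : ℝ) (hσ0 : 0 < σ) (hσ1 : σ ≤ 1) (hσ : U * δ ≤ σ ^ 4)
    (φ : ℝ × ℝ → ℝ) (hφ : ContDiff ℝ 1 φ) (hc : HasCompactSupport φ) :
    |∫ y, fderiv ℝ φ y (Psi X s (s + δ) y - y)| ≤ 44 * C * σ ^ 3 * δ * ∫ y, ‖fderiv ℝ φ y‖ := by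
  have hC := hF.hC
  have hU := hF.hU
  have hdφ : Continuous (fderiv ℝ φ) := hφ.continuous_fderiv (by norm_num)
  have hcd : HasCompactSupport (fderiv ℝ φ) := hc.fderiv ℝ
  have hni : Integrable (fun y => ‖fderiv ℝ φ y‖) :=
    (hdφ.integrable_of_hasCompactSupport hcd).norm
  have hint : ∀ g : ℝ × ℝ → ℝ × ℝ, Continuous g → Integrable fun y => fderiv ℝ φ y (g y) := by
    intro g hg
    refine (hdφ.clm_apply hg).integrable_of_hasCompactSupport ?_
    refine hcd.mono ?_
    intro y hy
    contrapose! hy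
    simp only [Function.mem_support, not_not] at hy ⊢
    simp [hy]
  set B := ∫ y, ‖fderiv ℝ φ y‖ with hB
  have hB0 : 0 ≤ B := integral_nonneg fun y => norm_nonneg _
  have hlt : 1 / (20 * C) < 1 / (10 * C) := by
    apply one_div_lt_one_div_of_lt <;> linarith
  have hPc : ∀ r, 0 ≤ r → r ≤ 1 / (10 * C) → Continuous (Psi X s (s + r)) := fun r h0 h1 =>
    hF.psi_cont hs (by linarith) (by linarith)
  have hder : ∀ r, 0 < r → r ≤ δ → HasDerivAt (fun r => ∫ y, fderiv ℝ φ y (Psi X s (s + r) y - y))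
      (∫ y, fderiv ℝ φ y (u (s + r) (Psi X s (s + r) y))) r := by
    intro r hr0 hr
    have hmem : Set.Ioo 0 (1 / (10 * C)) ∈ 𝓝 r := Ioo_mem_nhds hr0 (by linarith)
    refine (hasDerivAt_integral_of_dominated_loc_of_deriv_le (μ := volume)
      (bound := fun y => ‖fderiv ℝ φ y‖ * U)
      (F := fun r y => fderiv ℝ φ y (Psi X s (s + r) y - y))
      (F' := fun r y => fderiv ℝ φ y (u (s + r) (Psi X s (s + r) y))) (x₀ := r)
      hmem ?_ ?_ ?_ ?_ (hni.mul_const U) ?_).2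
    · filter_upwards [hmem] with q hq
      exact (hint _ ((hPc q hq.1.le hq.2.le).sub continuous_id)).aestronglyMeasurable
    · exact hint _ ((hPc r hr0.le (by linarith)).sub continuous_id)
    · exact (hint _ (((hF.good (s + r) (by linarith)).continuous hC).comp
        (hPc r hr0.le (by linarith)))).aestronglyMeasurable
    · refine Eventually.of_forall fun y q hq => ?_
      refine (ContinuousLinearMap.le_opNorm _ _).trans ?_
      gcongr
      exact (hF.good (s + q) (by linarith [hq.1])).bdd _
    · refine Eventually.of_forall fun y q hq => ?_
      obtain ⟨x, rfl⟩ := hF.surj s hs y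
      simp_rw [hF.psi_X hs]
      have h1 := (hF.ode x (s + q) (by linarith [hq.1])).comp_const_add s q
      exact (fderiv ℝ φ (X x s)).hasFDerivAt.comp_hasDerivAt q (h1.sub_const (X x s))
  have hbd : ∀ r, 0 < r → r ≤ δ →
      ‖∫ y, fderiv ℝ φ y (u (s + r) (Psi X s (s + r) y))‖ ≤ 44 * C * σ ^ 3 * B := by
    intro r hr0 hr
    have hg := hF.good (s + r) (by linarith)
    have hgc := hg.continuous hC
    have h0 := hg.weak_div hC φ hφ hc
    have : ∫ y, fderiv ℝ φ y (u (s + r) (Psi X s (s + r) y)) =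
        ∫ y, fderiv ℝ φ y (u (s + r) (Psi X s (s + r) y) - u (s + r) y) := by
      simp_rw [map_sub]
      rw [integral_sub (hint (fun y => u (s + r) (Psi X s (s + r) y)) (hgc.comp (hPc r hr0.le (by linarith)))) (hint _ hgc), h0, sub_zero]
    rw [this, hB, ← integral_const_mul]
    refine norm_integral_le_of_norm_le (hni.const_mul _) (Eventually.of_forall fun y => ?_)
    refine (ContinuousLinearMap.le_opNorm _ _).trans ?_
    rw [mul_comm]
    gcongr
    apply hg.hol hC σ hσ0 hσ1
    refine (hF.psi_speed hs (by linarith) y).trans (le_trans ?_ hσ)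
    have : s + r - s = r := by ring
    rw [this]
    gcongr
  set I : ℝ → ℝ := fun r => ∫ y, fderiv ℝ φ y (Psi X s (s + r) y - y) with hI
  have hsmall : ∀ r, 0 < r → r ≤ δ → ‖I r‖ ≤ U * r * B := by
    intro r hr0 hr
    rw [hB, ← integral_const_mul]
    refine norm_integral_le_of_norm_le (hni.const_mul _) (Eventually.of_forall fun y => ?_)
    refine (ContinuousLinearMap.le_opNorm _ _).trans ?_
    rw [mul_comm]
    gcongr
    refine (hF.psi_speed hs (by linarith) y).trans (le_of_eq (by ring))
  rcases hδ0.eq_or_lt with h | h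
  · subst h
    simp [hF.psi_self hs]
  have hall : ∀ r, 0 < r → r ≤ δ → ‖I δ‖ ≤ 44 * C * σ ^ 3 * B * δ + U * r * B := by
    intro r hr0 hr
    have h1 := norm_image_sub_le_of_norm_deriv_le_segment' (f := I)
      (f' := fun r => ∫ y, fderiv ℝ φ y (u (s + r) (Psi X s (s + r) y))) (a := r) (b := δ)
      (fun q hq => (hder q (hr0.trans_le hq.1) hq.2).hasDerivWithinAt)
      (fun q hq => hbd q (hr0.trans_le hq.1) hq.2.le) δ ⟨hr, le_rfl⟩
    have h2 := hsmall r hr0 hr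
    have h3 : ‖I δ‖ ≤ ‖I δ - I r‖ + ‖I r‖ := by simpa using norm_add_le (I δ - I r) (I r)
    have h4 : 44 * C * σ ^ 3 * B * (δ - r) ≤ 44 * C * σ ^ 3 * B * δ := by gcongr; linarith
    linarith
  have hlim : Tendsto (fun r : ℝ => 44 * C * σ ^ 3 * B * δ + U * r * B) (𝓝[>] 0)
      (𝓝 (44 * C * σ ^ 3 * B * δ + U * 0 * B)) := by
    apply Tendsto.mono_left _ nhdsWithin_le_nhds
    exact (by fun_prop : Continuous fun r : ℝ => 44 * C * σ ^ 3 * B * δ + U * r * B).tendsto 0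
  have := ge_of_tendsto hlim (by
    filter_upwards [Ioc_mem_nhdsGT h] with r hr
    exact hall r hr.1 hr.2)
  rw [Real.norm_eq_abs] at this
  refine this.trans (le_of_eq (by ring))

end flow

end part8

section part9
section flow
variable {U C : ℝ} {u : ℝ → ℝ × ℝ → ℝ × ℝ} {X : ℝ × ℝ → ℝ → ℝ × ℝ}

lemma IsFlow.step (hF : IsFlow U C u X) {T : ℝ} (f : ℝ × ℝ → ℝ) (Lf R0 : ℝ) (hL : 0 ≤ Lf)
    (hf : ∀ x y, |f x - f y| ≤ Lf * ‖x - y‖) (hfb : ∀ x, |f x| ≤ Lf)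
    (hfs : ∀ x, R0 < ‖x‖ → f x = 0) :
    ∃ K η0 : ℝ, 0 < η0 ∧ ∀ η : ℝ, 0 < η → η ≤ η0 → ∀ t, 0 ≤ t → t + η ^ 32 ≤ T →
      T - t ≤ 1 / (20 * C) →
      |(∫ x, f (Psi X t T x)) - ∫ x, f (Psi X (t + η ^ 32) T x)| ≤ K * η ^ 33 := by
  have hC := hF.hC
  have hU := hF.hU
  set A := 1 + U + 152 * C + 44 * C * U ^ 3 + 11 * Lf with hA
  have p1 : 0 ≤ 44 * C * U ^ 3 := by positivity
  have hA1 : 1 ≤ A := by linarith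
  obtain ⟨K, η0, h0, h1, hK⟩ := core A (R0 + U) hA1
  refine ⟨K, min η0 (1 / U), by positivity, fun η hη0 hη t ht htT hTt => ?_⟩
  have hη1 : η ≤ η0 := hη.trans (min_le_left _ _)
  have hηU : η ≤ 1 / U := hη.trans (min_le_right _ _)
  have hη1' : η ≤ 1 := hη1.trans h1
  rw [le_div_iff₀ (by positivity)] at hηU
  have hδ : 0 < η ^ 32 := by positivity
  have hlt : 1 / (20 * C) ≤ 1 / (10 * C) := by
    apply one_div_le_one_div_of_le <;> linarith
  have hle1 : 1 / (20 * C) ≤ 1 := by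
    rw [div_le_one (by positivity)]; linarith
  have ht' : 0 ≤ t + η ^ 32 := by positivity
  have hFc : Continuous (fun x => f (Psi X (t + η ^ 32) T x)) := by
    have hfc : Continuous f := by
      refine (LipschitzWith.of_dist_le_mul (K := Lf.toNNReal) fun x y => ?_).continuous
      rw [Real.dist_eq, dist_eq_norm, Real.coe_toNNReal _ hL]; exact hf x y
    exact hfc.comp (hF.psi_cont ht' htT (by linarith))
  have hwc : Continuous (fun x => Psi X t (t + η ^ 32) x - x) :=
    (hF.psi_cont ht (by linarith) (by linarith)).sub continuous_id
  have := hK η hη0 hη1 (fun x => Psi X t (t + η ^ 32) x - x)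
    (fun x => f (Psi X (t + η ^ 32) T x)) hwc hFc ?_ ?_ ?_ ?_ ?_ ?_
  · simpa [hF.psi_comp ht ht'] using this
  · intro x
    refine (hF.psi_speed ht (by linarith) x).trans ?_
    rw [add_sub_cancel_left]
    gcongr
    linarith
  · intro s hs0 hs1 x y hxy
    refine (hF.psi_hol2 ht (by linarith) (by linarith) s hs0 hs1 x y hxy).trans ?_
    rw [add_sub_cancel_left]
    have : 152 * C ≤ A := by linarith
    calc 152 * C * s ^ 3 * η ^ 32 = 152 * C * η ^ 32 * s ^ 3 := by ring
      _ ≤ A * η ^ 32 * s ^ 3 := by gcongr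
  · intro φ hφ hc
    refine (hF.disp_div ht hδ.le (by linarith) (U * η ^ 8) (by positivity) ?_ ?_ φ hφ hc).trans ?_
    · have : η ^ 8 ≤ η := pow_le_of_le_one hη0.le hη1' (by norm_num)
      nlinarith
    · have : U ≤ U ^ 4 := le_self_pow₀ hU (by norm_num)
      calc U * η ^ 32 ≤ U ^ 4 * η ^ 32 := by gcongr
        _ = _ := by ring
    · have : 44 * C * U ^ 3 ≤ A := by linarith
      calc 44 * C * (U * η ^ 8) ^ 3 * η ^ 32 * ∫ y, ‖fderiv ℝ φ y‖
          = 44 * C * U ^ 3 * η ^ 56 * ∫ y, ‖fderiv ℝ φ y‖ := by ring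
        _ ≤ A * η ^ 56 * ∫ y, ‖fderiv ℝ φ y‖ := by
          have : 0 ≤ ∫ y, ‖fderiv ℝ φ y‖ := integral_nonneg fun _ => norm_nonneg _
          gcongr
  · intro x
    exact (hfb _).trans (by linarith)
  · intro x hx
    apply hfs
    have h1 := hF.psi_speed ht' htT x
    have h2 : U * (T - (t + η ^ 32)) ≤ U * 1 := by gcongr; linarith
    have h3 : ‖x‖ ≤ ‖Psi X (t + η ^ 32) T x‖ + ‖Psi X (t + η ^ 32) T x - x‖ := by
      have := norm_sub_le (Psi X (t + η ^ 32) T x) (Psi X (t + η ^ 32) T x - x)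
      simpa using this
    linarith
  · intro s hs0 hs1 x y hxy
    refine (hf _ _).trans ?_
    have := hF.psi_hol ht' htT (by linarith) s hs0 hs1 x y hxy
    calc Lf * _ ≤ Lf * (10 * s ^ 3) := by gcongr
      _ = 10 * Lf * s ^ 3 := by ring
      _ ≤ A * s ^ 3 := by gcongr; linarith

lemma telescope (g : ℕ → ℝ) (c : ℝ) (n : ℕ) (h : ∀ i < n, |g i - g (i + 1)| ≤ c) :
    |g 0 - g n| ≤ n * c := by
  induction n with
  | zero => simp
  | succ n ih =>
    have h1 := ih fun i hi => h i (by omega)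
    have h2 := h n (by omega)
    have h3 := abs_add_le (g 0 - g n) (g n - g (n + 1))
    push_cast
    rw [sub_add_sub_cancel] at h3
    linarith

lemma IsFlow.int_pres (hF : IsFlow U C u X) {S T : ℝ} (hS : 0 ≤ S) (hST : S ≤ T)
    (hTS : T - S ≤ 1 / (20 * C)) (f : ℝ × ℝ → ℝ) (Lf R0 : ℝ) (hL : 0 ≤ Lf)
    (hf : ∀ x y, |f x - f y| ≤ Lf * ‖x - y‖) (hfb : ∀ x, |f x| ≤ Lf)
    (hfs : ∀ x, R0 < ‖x‖ → f x = 0) : ∫ x, f (Psi X S T x) = ∫ x, f x := by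
  rcases hST.eq_or_lt with h | h
  · subst h
    simp [hF.psi_self hS]
  obtain ⟨K, η0, h0, hK⟩ := hF.step (T := T) f Lf R0 hL hf hfb hfs
  set L := T - S with hLd
  have hLp : 0 < L := by linarith
  have hη : Tendsto (fun n : ℕ => (L / n) ^ ((1 : ℝ) / 32)) atTop (𝓝 0) := by
    have h1 : Tendsto (fun n : ℕ => L / (n : ℝ)) atTop (𝓝 0) := tendsto_const_div_atTop_nhds_zero_nat L
    have h2 := h1.rpow_const (p := (1 : ℝ) / 32) (Or.inr (by norm_num))
    rwa [Real.zero_rpow (by norm_num)] at h2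
  have hb : ∀ᶠ n : ℕ in atTop, |(∫ x, f (Psi X S T x)) - ∫ x, f x| ≤
      L * K * (L / n) ^ ((1 : ℝ) / 32) := by
    filter_upwards [hη.eventually_le_const h0, eventually_ge_atTop 1] with n hn hn1
    have hn0 : (0 : ℝ) < n := by exact_mod_cast hn1
    set η := (L / n) ^ ((1 : ℝ) / 32) with hηd
    have hηp : 0 < η := by positivity
    have hη32 : η ^ 32 = L / n := by
      rw [hηd, ← Real.rpow_natCast, ← Real.rpow_mul (by positivity)]; norm_num
    have hnη : n * η ^ 32 = L := by rw [hη32]; field_simp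
    have := telescope (fun i => ∫ x, f (Psi X (S + i * η ^ 32) T x)) (K * η ^ 33) n ?_
    · simp only [Nat.cast_zero, zero_mul, add_zero, hnη] at this
      have e : S + L = T := by rw [hLd]; ring
      rw [e] at this
      simp only [hF.psi_self (hS.trans hST)] at this
      refine this.trans (le_of_eq ?_)
      calc n * (K * η ^ 33) = (n * η ^ 32) * K * η := by ring
        _ = _ := by rw [hnη]
    · intro i hi
      have hi' : (i : ℝ) + 1 ≤ n := by exact_mod_cast hi
      have e : S + ((i + 1 : ℕ) : ℝ) * η ^ 32 = S + i * η ^ 32 + η ^ 32 := by push_cast; ring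
      simp only [e]
      have h3 : 0 ≤ i * η ^ 32 := by positivity
      have h4 : (i + 1) * η ^ 32 ≤ n * η ^ 32 := by gcongr
      apply hK η hηp hn
      · linarith
      · linarith
      · linarith
  have hlim := (hη.const_mul (L * K))
  rw [mul_zero] at hlim
  have := ge_of_tendsto hlim hb
  exact sub_eq_zero.1 (abs_nonpos_iff.1 this)

lemma IsFlow.psi_mp (hF : IsFlow U C u X) {S T : ℝ} (hS : 0 ≤ S) (hST : S ≤ T)
    (hTS : T - S ≤ 1 / (20 * C)) : MeasurePreserving (Psi X S T) := by
  have hC := hF.hC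
  have hU := hF.hU
  have hle1 : 1 / (20 * C) ≤ 1 := by
    rw [div_le_one (by positivity)]; linarith
  have hlt : 1 / (20 * C) ≤ 1 / (10 * C) := by
    apply one_div_le_one_div_of_le <;> linarith
  have hPc : Continuous (Psi X S T) := hF.psi_cont hS hST (by linarith)
  have hopen : ∀ s : Set (ℝ × ℝ), IsOpen s → Bornology.IsBounded s →
      Measure.map (Psi X S T) volume s = volume s := by
    intro s hs hsb
    obtain ⟨R0, hR0⟩ := hsb.exists_norm_le
    have hne : sᶜ.Nonempty := by
      rw [Set.nonempty_compl]
      rintro rfl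
      have := hR0 (|R0| + 1, 0) (Set.mem_univ _)
      simp [Prod.norm_def] at this
      rw [abs_of_nonneg (by positivity)] at this
      linarith [le_abs_self R0]
    set f : ℕ → ℝ × ℝ → ℝ := fun n x => min 1 (n * Metric.infDist x sᶜ) with hfd
    have hfc : ∀ n, Continuous (f n) := fun n =>
      continuous_const.min (continuous_const.mul (Metric.continuous_infDist_pt _))
    have hf0 : ∀ n x, 0 ≤ f n x := fun n x => le_min zero_le_one
      (mul_nonneg n.cast_nonneg Metric.infDist_nonneg)
    have hf1 : ∀ n x, f n x ≤ 1 := fun n x => min_le_left _ _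
    have hfz : ∀ n x, x ∉ s → f n x = 0 := fun n x hx => by
      simp [hfd, Metric.infDist_zero_of_mem (Set.mem_compl hx)]
    have hfR : ∀ n x, R0 < ‖x‖ → f n x = 0 := fun n x hx => hfz n x fun h => by
      linarith [hR0 x h]
    have hlip : ∀ n x y, |f n x - f n y| ≤ ((n : ℝ) + 1) * ‖x - y‖ := fun n x y => by
      refine (abs_min_sub_min_le_max _ _ _ _).trans ?_
      rw [← mul_sub, abs_mul, abs_of_nonneg (n.cast_nonneg : (0 : ℝ) ≤ n)]
      have := (Metric.lipschitz_infDist_pt sᶜ).dist_le_mul x y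
      simp only [NNReal.coe_one, one_mul, Real.dist_eq, dist_eq_norm] at this
      have h0 := norm_nonneg (x - y)
      apply max_le
      · simp; positivity
      · have : (n : ℝ) * |Metric.infDist x sᶜ - Metric.infDist y sᶜ| ≤ n * ‖x - y‖ := by
          gcongr; exact this
        linarith
    have hpres : ∀ n, ∫ x, f n (Psi X S T x) = ∫ x, f n x := fun n =>
      hF.int_pres hS hST hTS (f n) (n + 1) R0 (by positivity) (hlip n)
        (fun x => by
          rw [abs_of_nonneg (hf0 n x)]
          have : (0:ℝ) ≤ n := n.cast_nonneg
          linarith [hf1 n x]) (hfR n)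
    have hsup : ∀ g : ℝ × ℝ → ℝ, Continuous g → (∀ x, R0 + U < ‖x‖ → g x = 0) → Integrable g := by
      intro g hg hz
      refine hg.integrable_of_hasCompactSupport
        (HasCompactSupport.of_support_subset_isCompact (isCompact_closedBall 0 (R0 + U)) ?_)
      intro x hx
      rw [mem_closedBall_zero_iff]
      by_contra h
      exact hx (hz x (not_le.1 h))
    have hlint : ∀ n, ∫⁻ x, ENNReal.ofReal (f n (Psi X S T x)) = ∫⁻ x, ENNReal.ofReal (f n x) := by
      intro n
      rw [← ofReal_integral_eq_lintegral_ofReal (hsup (fun x => f n (Psi X S T x)) ((hfc n).comp hPc) ?_)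
        (Eventually.of_forall fun x => hf0 n _),
        ← ofReal_integral_eq_lintegral_ofReal (hsup _ (hfc n) ?_)
        (Eventually.of_forall fun x => hf0 n _)]
      · congr 1; exact hpres n
      · intro x hx; exact hfR n x (by linarith)
      · intro x hx
        apply hfR
        have h1 := hF.psi_speed hS hST x
        have h2 : U * (T - S) ≤ U * 1 := by gcongr; linarith
        have h3 : ‖x‖ ≤ ‖Psi X S T x‖ + ‖Psi X S T x - x‖ := by
          have := norm_sub_le (Psi X S T x) (Psi X S T x - x)
          simpa using this
        linarith
    have hmono : ∀ x, Monotone fun n => ENNReal.ofReal (f n x) := fun x n m hnm => by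
      apply ENNReal.ofReal_le_ofReal
      apply min_le_min_left
      have : 0 ≤ Metric.infDist x sᶜ := Metric.infDist_nonneg
      gcongr
    have hlim : ∀ x, Tendsto (fun n => ENNReal.ofReal (f n x)) atTop (𝓝 (s.indicator 1 x)) := by
      intro x
      by_cases hx : x ∈ s
      · have hd : 0 < Metric.infDist x sᶜ :=
          (hs.isClosed_compl.notMem_iff_infDist_pos hne).1 (by simpa using hx)
        obtain ⟨N, hN⟩ := exists_nat_ge (1 / Metric.infDist x sᶜ)
        rw [div_le_iff₀ hd] at hN
        refine tendsto_const_nhds.congr' ?_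
        filter_upwards [eventually_ge_atTop N] with n hn
        have : (N : ℝ) * Metric.infDist x sᶜ ≤ n * Metric.infDist x sᶜ := by gcongr
        have e : f n x = 1 := min_eq_left (by linarith)
        simp [hx, e]
      · simp [hx, hfz _ x hx]
    have key : ∀ ν : Measure (ℝ × ℝ), Tendsto (fun n => ∫⁻ x, ENNReal.ofReal (f n x) ∂ν) atTop
        (𝓝 (ν s)) := by
      intro ν
      rw [← lintegral_indicator_one hs.measurableSet]
      exact lintegral_tendsto_of_tendsto_of_monotone
        (fun n => ((hfc n).measurable.ennreal_ofReal).aemeasurable)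
        (Eventually.of_forall hmono) (Eventually.of_forall hlim)
    refine tendsto_nhds_unique (key _) ?_
    refine (key volume).congr fun n => ?_
    rw [lintegral_map ((hfc n).measurable.ennreal_ofReal) hPc.measurable, hlint]
  refine ⟨hPc.measurable, ?_⟩
  have : IsLocallyFiniteMeasure (Measure.map (Psi X S T) (volume : Measure (ℝ × ℝ))) := by
    refine ⟨fun x => ⟨Metric.ball x 1, Metric.ball_mem_nhds x one_pos, ?_⟩⟩
    rw [hopen _ Metric.isOpen_ball Metric.isBounded_ball]
    exact measure_ball_lt_top
  exact Measure.OuterRegular.ext_isOpen_isBounded fun s hs hb => hopen s hs hb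

lemma IsFlow.X_mp (hF : IsFlow U C u X) {t : ℝ} (ht : 0 ≤ t) :
    Continuous (fun x => X x t) ∧ MeasurePreserving (fun x => X x t) := by
  have hC := hF.hC
  have hτ : 0 < 1 / (20 * C) := by positivity
  have hlt : 1 / (20 * C) ≤ 1 / (10 * C) := by
    apply one_div_le_one_div_of_le <;> linarith
  have key : ∀ n : ℕ, ∀ t ≥ (0 : ℝ), t ≤ n * (1 / (20 * C)) →
      Continuous (fun x => X x t) ∧ MeasurePreserving (fun x => X x t) := by
    intro n
    induction n with
    | zero =>
      intro t ht ht'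
      simp at ht'
      have : t = 0 := le_antisymm ht' ht
      subst this
      simp only [hF.zero]
      exact ⟨continuous_id, MeasurePreserving.id _⟩
    | succ n ih =>
      intro t ht ht'
      set a := max 0 (t - 1 / (20 * C)) with ha
      have ha0 : 0 ≤ a := le_max_left _ _
      have hta : t - a ≤ 1 / (20 * C) := by
        have := le_max_right 0 (t - 1 / (20 * C)); linarith
      have hat : a ≤ t := max_le ht (by linarith)
      obtain ⟨h1, h2⟩ := ih a ha0 (by
        apply max_le (by positivity)
        push_cast at ht'; linarith)
      have e : (fun x => X x t) = Psi X a t ∘ (fun x => X x a) := by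
        funext x; simp [hF.psi_X ha0]
      rw [e]
      exact ⟨(hF.psi_cont ha0 hat (by linarith)).comp h1, (hF.psi_mp ha0 hat hta).comp h2⟩
  obtain ⟨n, hn⟩ := exists_nat_ge (t / (1 / (20 * C)))
  exact key n t ht (by rwa [div_le_iff₀ hτ] at hn)

end flow

end part9

section part10
lemma vv_zsmul (n : ℤ) : n • ((0, 2 * π) : ℝ × ℝ) = (0, n * (2 * π)) := by
  ext <;> simp

lemma fund_dom_of {t : Set (ℝ × ℝ)} (ht : NullMeasurableSet t)
    (h : ∀ x : ℝ × ℝ, ∃! n : ℤ, n • ((0, 2 * π) : ℝ × ℝ) + x ∈ t) :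
    IsAddFundamentalDomain (AddSubgroup.zmultiples ((0, 2 * π) : ℝ × ℝ)) t volume := by
  refine IsAddFundamentalDomain.mk' ht fun x => ?_
  have hinj : Function.Injective (fun n : ℤ => n • ((0, 2 * π) : ℝ × ℝ)) := by
    intro n m hnm
    simp only [vv_zsmul, Prod.mk.injEq, true_and] at hnm
    have := mul_right_cancel₀ (by positivity) hnm
    exact_mod_cast this
  have : Function.Bijective (Set.codRestrict (fun n : ℤ => n • ((0, 2 * π) : ℝ × ℝ))
      (AddSubgroup.zmultiples ((0, 2 * π) : ℝ × ℝ)) (fun n => ⟨n, rfl⟩)) :=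
    (Equiv.ofInjective _ hinj).bijective
  refine this.existsUnique_iff.2 ?_
  exact h x

lemma ioc_unique (x : ℝ × ℝ) :
    ∃! n : ℤ, n • ((0, 2 * π) : ℝ × ℝ) + x ∈ (Set.univ ×ˢ Set.Ioc 0 (2 * π) : Set (ℝ × ℝ)) := by
  have := existsUnique_add_zsmul_mem_Ioc (by positivity : (0:ℝ) < 2 * π) x.2 0
  simpa [vv_zsmul, Set.mem_prod, add_comm x.2] using this

lemma strip_ae : (strip : Set (ℝ × ℝ)) =ᵐ[volume] (Set.univ ×ˢ Set.Ioc 0 (2 * π) : Set (ℝ × ℝ)) := by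
  rw [strip, Measure.volume_eq_prod]
  exact Measure.set_prod_ae_eq (ae_eq_refl _) Ioc_ae_eq_Icc.symm

section flow
variable {U C : ℝ} {u : ℝ → ℝ × ℝ → ℝ × ℝ} {X : ℝ × ℝ → ℝ → ℝ × ℝ}

lemma IsFlow.per (hF : IsFlow U C u X)
    (hu : ∀ t ≥ (0 : ℝ), ∀ x : ℝ × ℝ, u t (x + (0, 2 * π)) = u t x) {t : ℝ} (ht : 0 ≤ t) (x : ℝ × ℝ) :
    X (x + (0, 2 * π)) t = X x t + (0, 2 * π) := by
  refine hF.curve_uniq (Z := X (x + (0, 2 * π))) (Z' := fun t => X x t + (0, 2 * π))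
    (hF.ode _) (fun s hs => ?_) (by simp [hF.zero]) t ht
  rw [hu s hs]
  exact (hF.ode x s hs).add_const _

lemma IsFlow.per_zsmul (hF : IsFlow U C u X)
    (hu : ∀ t ≥ (0 : ℝ), ∀ x : ℝ × ℝ, u t (x + (0, 2 * π)) = u t x) {t : ℝ} (ht : 0 ≤ t) (n : ℤ)
    (x : ℝ × ℝ) : X (n • ((0, 2 * π) : ℝ × ℝ) + x) t = n • ((0, 2 * π) : ℝ × ℝ) + X x t := by
  induction n with
  | zero => simp
  | succ n ih =>
    rw [add_zsmul, one_zsmul, add_right_comm, hF.per hu ht, ih]; abel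
  | pred n ih =>
    have := hF.per hu ht ((-(n : ℤ) - 1) • ((0, 2 * π) : ℝ × ℝ) + x)
    have e : (-(n : ℤ) - 1) • ((0, 2 * π) : ℝ × ℝ) + x + (0, 2 * π) = (-(n : ℤ)) • ((0, 2 * π) : ℝ × ℝ) + x := by
      rw [sub_zsmul, one_zsmul]; abel
    rw [e, ih] at this
    rw [← sub_eq_iff_eq_add] at this
    rw [← this, sub_zsmul, one_zsmul]; abel

lemma per_zsmul_fun {E : Type*} (g : ℝ × ℝ → E) (hg : ∀ x : ℝ × ℝ, g (x + (0, 2 * π)) = g x) (n : ℤ) (x : ℝ × ℝ) :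
    g (n • ((0, 2 * π) : ℝ × ℝ) + x) = g x := by
  induction n with
  | zero => simp
  | succ n ih =>
    rw [add_zsmul, one_zsmul, add_right_comm, hg, ih]
  | pred n ih =>
    rw [← hg, ← ih]
    congr 1
    rw [sub_zsmul, one_zsmul]; abel

lemma IsFlow.strip_int (hF : IsFlow U C u X)
    (hu : ∀ t ≥ (0 : ℝ), ∀ x : ℝ × ℝ, u t (x + (0, 2 * π)) = u t x) {t : ℝ} (ht : 0 ≤ t)
    (g : ℝ × ℝ → ℝ) (hg : ∀ x : ℝ × ℝ, g (x + (0, 2 * π)) = g x) :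
    ∫ x in strip, g (X x t) = ∫ x in strip, g x := by
  obtain ⟨hc, hmp⟩ := hF.X_mp ht
  have hemb : MeasurableEmbedding (fun x => X x t) := hc.measurableEmbedding (hF.inj ht)
  rw [setIntegral_congr_set strip_ae, setIntegral_congr_set strip_ae]
  set s : Set (ℝ × ℝ) := Set.univ ×ˢ Set.Ioc 0 (2 * π) with hs
  have hsm : MeasurableSet s := MeasurableSet.univ.prod measurableSet_Ioc
  have d1 := fund_dom_of hsm.nullMeasurableSet ioc_unique
  have d2 : IsAddFundamentalDomain (AddSubgroup.zmultiples ((0, 2 * π) : ℝ × ℝ))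
      ((fun x => X x t) ⁻¹' s) volume := by
    refine fund_dom_of (hc.measurable hsm).nullMeasurableSet fun x => ?_
    simp only [Set.mem_preimage, hF.per_zsmul hu ht]
    exact ioc_unique _
  rw [← hmp.setIntegral_preimage_emb hemb g s]
  refine d1.setIntegral_eq d2 ?_
  rintro ⟨_, n, rfl⟩ x
  change g (X (n • ((0, 2 * π) : ℝ × ℝ) + x) t) = g (X x t)
  rw [hF.per_zsmul hu ht, per_zsmul_fun g hg]

end flow

end part10

section part11
lemma DD_half (x y : ℝ × ℝ) :
    DD x y = 2 * sinh ((x.1 - y.1) / 2) ^ 2 + 2 * sin ((x.2 - y.2) / 2) ^ 2 := by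
  have h1 := cosh_sub_one_eq (x.1 - y.1)
  have h2 := Real.sin_sq_eq_half_sub ((x.2 - y.2) / 2)
  rw [show 2 * ((x.2 - y.2) / 2) = x.2 - y.2 by ring] at h2
  unfold DD; linarith

lemma K1_antisymm (x y : ℝ × ℝ) : K1 y x = - K1 x y := by
  unfold K1
  rw [← neg_sub x.1 y.1, ← neg_sub x.2 y.2, Real.cosh_neg, Real.cos_neg, Real.sin_neg]
  ring

lemma K1_sinh (x y : ℝ × ℝ) : |K1 x y| * |sinh ((x.1 - y.1) / 2)| ≤ 1 / 4 := by
  have hD := DD_half x y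
  have hs : sin (x.2 - y.2) = 2 * sin ((x.2 - y.2) / 2) * cos ((x.2 - y.2) / 2) := by
    rw [← Real.sin_two_mul]; congr 1; ring
  have hc := Real.abs_cos_le_one ((x.2 - y.2) / 2)
  set p := sinh ((x.1 - y.1) / 2)
  set q := sin ((x.2 - y.2) / 2)
  rw [K1, DD_eq, abs_div, abs_neg, hs, abs_mul, abs_mul, abs_of_nonneg (by positivity : (0:ℝ) ≤ 2),
    abs_of_nonneg (by linarith [DD_nonneg x y] : 0 ≤ 2 * DD x y)]
  rcases (DD_nonneg x y).eq_or_lt with h | h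
  · rw [← h]; simp
  rw [div_mul_eq_mul_div, div_le_iff₀ (by positivity), hD]
  have h1 : |q| * |cos ((x.2 - y.2) / 2)| ≤ |q| * 1 := by gcongr
  have h2 : |q| * |cos ((x.2 - y.2) / 2)| * |p| ≤ |q| * 1 * |p| := by gcongr
  nlinarith [sq_nonneg (|p| - |q|), sq_abs p, sq_abs q]

lemma sinh_lower (z : ℝ) : |z| + |z| ^ 3 / 8 ≤ |sinh z| := by
  have h1 := abs_le_abs_sinh (z / 2)
  have h2 := half_sq_le (z / 2)
  have h3 : sinh z = 2 * sinh (z / 2) * cosh (z / 2) := by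
    rw [← Real.sinh_two_mul]; congr 1; ring
  rw [h3, abs_mul, abs_mul, abs_of_nonneg (by positivity : (0:ℝ) ≤ 2), abs_of_pos (Real.cosh_pos _)]
  rw [abs_div, abs_of_nonneg (by positivity : (0:ℝ) ≤ 2)] at h1
  have h4 : 1 + |z| ^ 2 / 8 ≤ cosh (z / 2) := by rw [sq_abs]; nlinarith
  have h0 := abs_nonneg z
  calc |z| + |z| ^ 3 / 8 = 2 * (|z| / 2) * (1 + |z| ^ 2 / 8) := by ring
    _ ≤ _ := by gcongr

lemma K1_weight (x y : ℝ × ℝ) : |x.1 - y.1| * (1 + |x.1 - y.1|) * |K1 x y| ≤ 2 := by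
  have h1 := K1_sinh x y
  have h2 := sinh_lower ((x.1 - y.1) / 2)
  set a := x.1 - y.1
  have hK := abs_nonneg (K1 x y)
  have e : |a| = 2 * |a / 2| := by rw [abs_div, abs_of_nonneg (by positivity : (0:ℝ) ≤ 2)]; ring
  rw [e]
  have hz := abs_nonneg (a / 2)
  set z := |a / 2|
  have h3 : 2 * z * (1 + 2 * z) ≤ 8 * |sinh (a / 2)| := by
    have : 0 ≤ z * ((z - 2) ^ 2 + 2) := by positivity
    nlinarith
  nlinarith

lemma K1_near (x y : ℝ × ℝ) (σ : ℝ) (h0 : 0 < σ) (h1 : σ ≤ 1) :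
    |K1 x y| ≤ 1 + (σ ^ 2)⁻¹ + σ * WW x y := by
  have hs := sin_sq_le x y
  have hD0 := DD_nonneg x y
  have hW := WW_nonneg x y
  rw [K1, DD_eq, abs_div, abs_of_nonneg (by linarith : 0 ≤ 2 * DD x y)]
  set a := |-sin (x.2 - y.2)| with ha
  have hs : a ^ 2 ≤ DD x y * (DD x y + 2) := by rw [ha, sq_abs]; exact hs
  have ha0 : 0 ≤ a := abs_nonneg _
  rcases hD0.eq_or_lt with h | h
  · rw [← h]; simp; positivity
  -- d = D^(1/4)
  set d := DD x y ^ ((1:ℝ) / 4) with hd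
  have hd0 : 0 < d := by positivity
  have hd4 : d ^ 4 = DD x y := by
    rw [hd, ← Real.rpow_natCast, ← Real.rpow_mul hD0]; norm_num
  have hle : a / (2 * DD x y) ≤ 1 + (d ^ 2)⁻¹ := by
    rw [div_le_iff₀ (by positivity), ← hd4]
    rw [← hd4] at hs
    have e : (1 + (d ^ 2)⁻¹) * (2 * d ^ 4) = 2 * d ^ 4 + 2 * d ^ 2 := by field_simp
    rw [e]
    apply abs_le_of_sq_le_sq' _ (by positivity) |>.2
    nlinarith [pow_pos hd0 4, pow_pos hd0 6, pow_pos hd0 8]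
  rcases le_or_gt σ d with hσ | hσ
  · have : (d ^ 2)⁻¹ ≤ (σ ^ 2)⁻¹ := by gcongr
    have : 0 ≤ σ * WW x y := by positivity
    linarith
  · have hD1 : DD x y ≤ 1 := by rw [← hd4]; exact pow_le_one₀ hd0.le (by linarith)
    have hWW : WW x y = (d ^ 3)⁻¹ := by
      rw [WW, if_pos hD1, hd, ← Real.rpow_natCast, ← Real.rpow_mul hD0, Real.rpow_neg hD0]; norm_num
    have : (d ^ 2)⁻¹ ≤ σ * WW x y := by
      rw [hWW]
      have : (d ^ 2)⁻¹ = d * (d ^ 3)⁻¹ := by field_simp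
      rw [this]; gcongr
    have : 0 ≤ (σ ^ 2)⁻¹ := by positivity
    linarith

lemma sinh_sub_le (p q : ℝ) : |sinh p - sinh q| ≤ |p - q| * (cosh p + cosh q) := by
  have h := Convex.norm_image_sub_le_of_norm_hasDerivWithin_le (f := sinh) (f' := cosh)
    (s := Set.uIcc q p) (x := q) (y := p) (C := cosh p + cosh q)
    (fun x _ => (Real.hasDerivAt_sinh x).hasDerivWithinAt) (fun x hx => ?_) (convex_uIcc q p)
    Set.left_mem_uIcc Set.right_mem_uIcc
  · rw [Real.norm_eq_abs, Real.norm_eq_abs] at h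
    linarith
  · rw [Real.norm_eq_abs, abs_of_pos (Real.cosh_pos x)]
    have hp := Real.cosh_pos p
    have hq := Real.cosh_pos q
    have : |x| ≤ |p| ∨ |x| ≤ |q| := by
      rw [Set.mem_uIcc] at hx
      rcases abs_cases x with ⟨e, _⟩ | ⟨e, _⟩ <;> rw [e] <;> rcases hx with hx | hx
      · left; exact hx.2.trans (le_abs_self p)
      · right; exact hx.2.trans (le_abs_self q)
      · right; linarith [neg_abs_le q]
      · left; linarith [neg_abs_le p]
    rcases this with h | h
    · have := Real.cosh_le_cosh.2 h; linarith
    · have := Real.cosh_le_cosh.2 h; linarith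

variable {M m : ℝ} {w : ℝ × ℝ → ℝ}

/-- velocity bound far from the bulk -/
lemma Dens.vel (hw : Dens M m w) (hM : 0 ≤ M) {CW : ℝ}
    (hCW : ∀ x : ℝ × ℝ, IntegrableOn (WW x) strip ∧ ∫ y in strip, WW x y ≤ CW)
    {R ν σ : ℝ} (hR : 0 < R) (h0 : 0 < σ) (h1 : σ ≤ 1)
    (hν : ∫ y in strip, Set.indicator {y : ℝ × ℝ | 3 * R / 4 ≤ |y.1|} w y ≤ ν)
    (x : ℝ × ℝ) (hx : R ≤ |x.1|) :
    |∫ y in strip, K1 x y * w y| ≤ m / (4 * sinh (R / 8)) + (1 + (σ ^ 2)⁻¹) * ν + σ * (M * CW) := by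
  set μ := (volume : Measure (ℝ × ℝ)).restrict strip with hμ
  have hwi : Integrable w μ := hw.int
  have hS : MeasurableSet {y : ℝ × ℝ | 3 * R / 4 ≤ |y.1|} :=
    measurableSet_le measurable_const (by fun_prop)
  set S := {y : ℝ × ℝ | 3 * R / 4 ≤ |y.1|} with hSd
  have hsh : 0 < sinh (R / 8) := Real.sinh_pos_iff.2 (by positivity)
  have hII : Integrable (S.indicator w) μ := hwi.indicator hS
  have hWi : Integrable (WW x) μ := (hCW x).1
  have hpt : ∀ y, ‖K1 x y * w y‖ ≤ 1 / (4 * sinh (R / 8)) * w y +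
      (1 + (σ ^ 2)⁻¹) * S.indicator w y + σ * M * WW x y := by
    intro y
    have hwy := hw.nonneg y
    have hwM := hw.le y
    have hW := WW_nonneg x y
    rw [norm_mul, Real.norm_eq_abs, Real.norm_of_nonneg hwy]
    by_cases hy : y ∈ S
    · rw [Set.indicator_of_mem hy]
      have h2 := K1_near x y σ h0 h1
      have h3 : |K1 x y| * w y ≤ (1 + (σ ^ 2)⁻¹ + σ * WW x y) * w y := by gcongr
      have h4 : σ * WW x y * w y ≤ σ * WW x y * M := by gcongr
      have h5 : 0 ≤ 1 / (4 * sinh (R / 8)) * w y := by positivity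
      nlinarith
    · rw [Set.indicator_of_notMem hy]
      have hy' : |y.1| < 3 * R / 4 := by simpa [hSd] using hy
      have h2 := K1_sinh x y
      have h3 : sinh (R / 8) ≤ |sinh ((x.1 - y.1) / 2)| := by
        rw [Real.abs_sinh, Real.sinh_le_sinh, abs_div, abs_of_pos (by norm_num : (0:ℝ) < 2)]
        have := abs_sub_abs_le_abs_sub x.1 y.1
        linarith
      have h4 : |K1 x y| ≤ 1 / (4 * sinh (R / 8)) := by
        rw [le_div_iff₀ (by positivity)]
        have := mul_le_mul_of_nonneg_left h3 (abs_nonneg (K1 x y))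
        linarith
      have h5 : 0 ≤ σ * M * WW x y := by positivity
      have := mul_le_mul_of_nonneg_right h4 hwy
      linarith
  have hi1 := hwi.const_mul (1 / (4 * sinh (R / 8)))
  have hi2 := hII.const_mul (1 + (σ ^ 2)⁻¹)
  have hi3 := hWi.const_mul (σ * M)
  have := norm_integral_le_of_norm_le ((hi1.add hi2).add hi3) (Eventually.of_forall hpt)
  rw [Real.norm_eq_abs] at this
  refine this.trans ?_
  have e : ∫ y, (((fun y => 1 / (4 * sinh (R / 8)) * w y) + fun y => (1 + (σ ^ 2)⁻¹) * S.indicator w y) + fun y => σ * M * WW x y) y ∂μ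
      = 1 / (4 * sinh (R / 8)) * (∫ y, w y ∂μ) + (1 + (σ ^ 2)⁻¹) * (∫ y, S.indicator w y ∂μ) +
        σ * M * ∫ y, WW x y ∂μ := by
    rw [integral_add' (hi1.add hi2) hi3, integral_add' hi1 hi2, integral_const_mul,
      integral_const_mul, integral_const_mul]
  rw [e]
  have a1 : 1 / (4 * sinh (R / 8)) * (∫ y, w y ∂μ) ≤ m / (4 * sinh (R / 8)) := by
    rw [div_mul_eq_mul_div, one_mul]
    gcongr
    exact hw.mass
  have a2 : (1 + (σ ^ 2)⁻¹) * (∫ y, S.indicator w y ∂μ) ≤ (1 + (σ ^ 2)⁻¹) * ν := by gcongr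
  have a3 : σ * M * (∫ y, WW x y ∂μ) ≤ σ * M * CW := by
    gcongr; exact (hCW x).2
  linarith

end part11

section part11b
variable {M m : ℝ} {w : ℝ × ℝ → ℝ}
lemma measurable_K1_sec (x : ℝ × ℝ) : Measurable (K1 x) := by
  have : K1 x = fun y => K1 x y := rfl
  rw [this]; unfold K1; fun_prop

set_option maxHeartbeats 400000 in
/-- static bound on the derivative of the exponential moment -/
lemma Dens.exp_moment (hw : Dens M m w) (hM : 0 ≤ M) {B : ℝ} (hB : ∀ y, w y ≠ 0 → |y.1| ≤ B)
    (hi1 : IntegrableOn (fun y : ℝ × ℝ => |y.1| * w y) strip) {Cm : ℝ}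
    (hCm : ∫ y in strip, |y.1| * w y ≤ Cm) (hm1 : 0 ≤ m + Cm) {l R : ℝ} (hl : 0 < l) (hR : 0 < R) :
    ∫ y in strip, (l * sinh (l * y.1) * ∫ z in strip, K1 y z * w z) * w y ≤
      2 * l ^ 2 * (m + Cm) * ((2 / R) * (∫ y in strip, cosh (l * y.1) * w y) + m * cosh (l * R / 2)) := by
  obtain ⟨CW, hCW0, hCW⟩ := exists_integral_WW
  set μ := (volume : Measure (ℝ × ℝ)).restrict strip with hμ
  have hwi : Integrable w μ := hw.int
  set F : (ℝ × ℝ) × (ℝ × ℝ) → ℝ := fun p => l * sinh (l * p.1.1) * (K1 p.1 p.2 * w p.2) * w p.1 with hF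
  have hwm := hwi.aestronglyMeasurable
  have hFm : AEStronglyMeasurable F (μ.prod μ) := by
    have e1 : AEStronglyMeasurable (fun p : (ℝ × ℝ) × (ℝ × ℝ) => w p.1) (μ.prod μ) :=
      hwm.comp_fst
    have e2 : AEStronglyMeasurable (fun p : (ℝ × ℝ) × (ℝ × ℝ) => w p.2) (μ.prod μ) :=
      hwm.comp_snd
    have e3 : Measurable (fun p : (ℝ × ℝ) × (ℝ × ℝ) => l * sinh (l * p.1.1)) := by
      have := Real.measurable_sinh; fun_prop
    exact (e3.aestronglyMeasurable.mul (measurable_K1.aestronglyMeasurable.mul e2)).mul e1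
  have hsec : ∀ y, Integrable (fun z => K1 y z * w z) μ ∧ ∫ z, |K1 y z| * w z ∂μ ≤ 1 * (m + M * CW) :=
    fun y => hw.dom hM hCW y (K1 y) (measurable_K1_sec y) 1 zero_le_one
      (fun z => by rw [one_mul]; exact abs_K1_le y z)
  have hFi : Integrable F (μ.prod μ) := by
    rw [integrable_prod_iff hFm]
    refine ⟨Eventually.of_forall fun y => ((hsec y).1.const_mul (l * sinh (l * y.1))).mul_const (w y), ?_⟩
    refine Integrable.mono' ((hwi.const_mul (l * cosh (l * B) * (1 * (m + M * CW)))))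
      hFm.norm.integral_prod_right' (Eventually.of_forall fun y => ?_)
    rw [Real.norm_of_nonneg (integral_nonneg fun _ => norm_nonneg _)]
    have e : ∀ z, ‖F (y, z)‖ = l * |sinh (l * y.1)| * w y * (|K1 y z| * w z) := by
      intro z
      simp only [hF, norm_mul, Real.norm_eq_abs, abs_of_pos hl, abs_of_nonneg (hw.nonneg _)]
      ring
    simp_rw [e]
    rw [integral_const_mul]
    by_cases hy : w y = 0
    · simp [hy]
    have hb := hB y hy
    have hs : |sinh (l * y.1)| ≤ cosh (l * B) := by
      refine (Real.abs_sinh _).trans_le ((Real.sinh_lt_cosh _).le.trans ?_)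
      rw [Real.cosh_le_cosh, abs_abs, abs_mul, abs_mul]
      exact mul_le_mul_of_nonneg_left (hb.trans (le_abs_self B)) (abs_nonneg l)
    have h1 := (hsec y).2
    have h2 : 0 ≤ ∫ z, |K1 y z| * w z ∂μ := integral_nonneg fun z =>
      mul_nonneg (abs_nonneg _) (hw.nonneg z)
    have h3 := hw.nonneg y
    calc l * |sinh (l * y.1)| * w y * ∫ z, |K1 y z| * w z ∂μ
        ≤ l * cosh (l * B) * w y * (1 * (m + M * CW)) := by
          have := Real.cosh_pos (l * B)
          gcongr
      _ = _ := by ring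
  have hL : ∫ y in strip, (l * sinh (l * y.1) * ∫ z in strip, K1 y z * w z) * w y = ∫ p, F p ∂(μ.prod μ) := by
    rw [integral_prod _ hFi]
    congr 1; ext y
    simp only [hF]
    rw [integral_mul_const, integral_const_mul]
  -- the majorant
  have hcosh : Measurable (fun y : ℝ × ℝ => cosh (l * y.1)) := by
    have := Real.measurable_cosh; fun_prop
  have hcb : ∀ y, w y ≠ 0 → cosh (l * y.1) ≤ cosh (l * B) := fun y hy => by
    rw [Real.cosh_le_cosh, abs_mul, abs_mul]
    exact mul_le_mul_of_nonneg_left ((hB y hy).trans (le_abs_self B)) (abs_nonneg l)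
  have hci : Integrable (fun y : ℝ × ℝ => cosh (l * y.1) * w y) μ := by
    refine Integrable.mono' (hwi.const_mul (cosh (l * B))) (hcosh.aestronglyMeasurable.mul hwm)
      (Eventually.of_forall fun y => ?_)
    rw [Real.norm_of_nonneg (mul_nonneg (Real.cosh_pos _).le (hw.nonneg y))]
    by_cases hy : w y = 0
    · simp [hy]
    · have := hw.nonneg y
      gcongr ?_ * _
      exact hcb y hy
  have hgi : Integrable (fun y : ℝ × ℝ => cosh (l * y.1) / (1 + |y.1|) * w y) μ := by
    have hm' : Measurable (fun y : ℝ × ℝ => cosh (l * y.1) / (1 + |y.1|)) :=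
      hcosh.div (by fun_prop)
    refine Integrable.mono' hci (hm'.aestronglyMeasurable.mul hwm)
      (Eventually.of_forall fun y => ?_)
    have hp := Real.cosh_pos (l * y.1)
    have := hw.nonneg y
    rw [Real.norm_of_nonneg (by positivity)]
    gcongr ?_ * _
    exact div_le_self hp.le (by linarith [abs_nonneg y.1])
  have hzi : Integrable (fun z : ℝ × ℝ => (1 + |z.1|) * w z) μ := by
    have := hwi.add hi1
    refine this.congr (Eventually.of_forall fun z => ?_)
    simp only [Pi.add_apply]; ring
  have hz : ∫ z, (1 + |z.1|) * w z ∂μ ≤ m + Cm := by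
    have : ∫ z, (1 + |z.1|) * w z ∂μ = (∫ z, w z ∂μ) + ∫ z, |z.1| * w z ∂μ := by
      rw [← integral_add hwi hi1]
      congr 1; ext z; ring
    rw [this]; exact add_le_add hw.mass hCm
  set G : (ℝ × ℝ) × (ℝ × ℝ) → ℝ := fun p =>
    2 * l ^ 2 * ((cosh (l * p.1.1) / (1 + |p.1.1|) * w p.1) * ((1 + |p.2.1|) * w p.2)) with hG
  have hGi : Integrable G (μ.prod μ) := (hgi.mul_prod hzi).const_mul _
  have hGint : ∫ p, G p ∂(μ.prod μ) = 2 * l ^ 2 *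
      ((∫ y, cosh (l * y.1) / (1 + |y.1|) * w y ∂μ) * ∫ z, (1 + |z.1|) * w z ∂μ) := by
    rw [← integral_prod_mul, ← integral_const_mul]
  have hpt : ∀ y z : ℝ × ℝ, l * l * (|y.1 - z.1| * cosh (l * y.1)) * |K1 y z| * (w y * w z) ≤ G (y, z) := by
    intro y z
    have h1 := K1_weight y z
    have hwy := hw.nonneg y
    have hwz := hw.nonneg z
    have hc := Real.cosh_pos (l * y.1)
    have htri : 1 + |y.1| ≤ (1 + |y.1 - z.1|) * (1 + |z.1|) := by
      have := abs_sub_abs_le_abs_sub y.1 z.1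
      nlinarith [abs_nonneg (y.1 - z.1), abs_nonneg z.1]
    have key : |y.1 - z.1| * |K1 y z| ≤ 2 * (1 + |z.1|) / (1 + |y.1|) := by
      rw [le_div_iff₀ (by positivity)]
      calc |y.1 - z.1| * |K1 y z| * (1 + |y.1|)
          ≤ |y.1 - z.1| * |K1 y z| * ((1 + |y.1 - z.1|) * (1 + |z.1|)) := by gcongr
        _ = (|y.1 - z.1| * (1 + |y.1 - z.1|) * |K1 y z|) * (1 + |z.1|) := by ring
        _ ≤ 2 * (1 + |z.1|) := by gcongr
    calc l * l * (|y.1 - z.1| * cosh (l * y.1)) * |K1 y z| * (w y * w z)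
        = l * l * cosh (l * y.1) * (|y.1 - z.1| * |K1 y z|) * (w y * w z) := by ring
      _ ≤ l * l * cosh (l * y.1) * (2 * (1 + |z.1|) / (1 + |y.1|)) * (w y * w z) := by gcongr
      _ = G (y, z) := by simp only [hG]; ring
  have hsym : ∀ p, F p + F p.swap ≤ G p + G p.swap := by
    rintro ⟨y, z⟩
    have h1 := hpt y z
    have h2 := hpt z y
    rw [K1_antisymm y z, abs_neg, abs_sub_comm] at h2
    have hwy := hw.nonneg y
    have hwz := hw.nonneg z
    have h3 := sinh_sub_le (l * y.1) (l * z.1)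
    rw [← mul_sub, abs_mul, abs_of_pos hl] at h3
    have e : F (y, z) + F (z, y) = l * ((sinh (l * y.1) - sinh (l * z.1)) * K1 y z) * (w y * w z) := by
      simp only [hF, K1_antisymm y z]; ring
    simp only [Prod.swap_prod_mk]
    rw [e]
    calc l * ((sinh (l * y.1) - sinh (l * z.1)) * K1 y z) * (w y * w z)
        ≤ l * (|sinh (l * y.1) - sinh (l * z.1)| * |K1 y z|) * (w y * w z) := by
          refine mul_le_mul_of_nonneg_right (mul_le_mul_of_nonneg_left ?_ hl.le) (mul_nonneg hwy hwz)
          rw [← abs_mul]; exact le_abs_self _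
      _ ≤ l * (l * |y.1 - z.1| * (cosh (l * y.1) + cosh (l * z.1)) * |K1 y z|) * (w y * w z) := by
          gcongr
      _ = l * l * (|y.1 - z.1| * cosh (l * y.1)) * |K1 y z| * (w y * w z) +
          l * l * (|y.1 - z.1| * cosh (l * z.1)) * |K1 y z| * (w z * w y) := by ring
      _ ≤ _ := add_le_add h1 h2
  have hint2 := integral_mono (hFi.add hFi.swap) (hGi.add hGi.swap) hsym
  simp only [Pi.add_apply, Function.comp_apply] at hint2
  have es : ∀ H : (ℝ × ℝ) × (ℝ × ℝ) → ℝ, Integrable H (μ.prod μ) →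
      ∫ p, (H p + H p.swap) ∂(μ.prod μ) = 2 * ∫ p, H p ∂(μ.prod μ) := by
    intro H hH
    rw [integral_add (g := fun p : (ℝ × ℝ) × (ℝ × ℝ) => H p.swap) hH hH.swap]
    have : ∫ p, (H ∘ Prod.swap) p ∂(μ.prod μ) = ∫ p, H p ∂(μ.prod μ) := integral_prod_swap H
    simp only [Function.comp_apply] at this
    rw [this]; ring
  have hint3 : ∫ p, F p ∂(μ.prod μ) ≤ ∫ p, G p ∂(μ.prod μ) := by
    have h1 := es F hFi
    have h2 := es G hGi
    have : ∫ p, (F p + F p.swap) ∂(μ.prod μ) ≤ ∫ p, (G p + G p.swap) ∂(μ.prod μ) := hint2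
    linarith
  have hgb : ∫ y, cosh (l * y.1) / (1 + |y.1|) * w y ∂μ ≤
      (2 / R) * (∫ y, cosh (l * y.1) * w y ∂μ) + m * cosh (l * R / 2) := by
    have h1 : ∫ y, cosh (l * y.1) / (1 + |y.1|) * w y ∂μ ≤
        ∫ y, ((2 / R) * (cosh (l * y.1) * w y) + cosh (l * R / 2) * w y) ∂μ := by
      refine integral_mono hgi ((hci.const_mul _).add (hwi.const_mul _)) fun y => ?_
      have hwy := hw.nonneg y
      have hc := Real.cosh_pos (l * y.1)
      have hc2 := Real.cosh_pos (l * R / 2)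
      simp only
      rw [← mul_assoc, ← add_mul]
      refine mul_le_mul_of_nonneg_right ?_ hwy
      rcases le_total (R / 2) |y.1| with h | h
      · have : cosh (l * y.1) / (1 + |y.1|) ≤ cosh (l * y.1) / (R / 2) := by
          gcongr; linarith
        have e : cosh (l * y.1) / (R / 2) = 2 / R * cosh (l * y.1) := by field_simp
        linarith
      · have h2 : cosh (l * y.1) ≤ cosh (l * R / 2) := by
          rw [Real.cosh_le_cosh, abs_mul, abs_of_pos hl, abs_of_pos (by positivity : 0 < l * R / 2), mul_div_assoc]
          exact mul_le_mul_of_nonneg_left h hl.le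
        have h3 : cosh (l * y.1) / (1 + |y.1|) ≤ cosh (l * y.1) :=
          div_le_self hc.le (by linarith [abs_nonneg y.1])
        have : 0 ≤ 2 / R * cosh (l * y.1) := by positivity
        linarith
    rw [integral_add (hci.const_mul _) (hwi.const_mul _), integral_const_mul, integral_const_mul] at h1
    have := mul_le_mul_of_nonneg_left hw.mass (Real.cosh_pos (l * R / 2)).le
    linarith
  rw [hL]
  refine hint3.trans ?_
  rw [hGint, mul_assoc (2 * l ^ 2)]
  have h0 : 0 ≤ ∫ y, cosh (l * y.1) / (1 + |y.1|) * w y ∂μ := integral_nonneg fun y => by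
    have := Real.cosh_pos (l * y.1)
    have := hw.nonneg y
    positivity
  refine mul_le_mul_of_nonneg_left ?_ (by positivity)
  rw [mul_comm]
  exact mul_le_mul hz hgb h0 hm1

end part11b

section part12
structure Setup (M m Cb Cm U C : ℝ) (ω : ℝ → ℝ × ℝ → ℝ) (u : ℝ → ℝ × ℝ → ℝ × ℝ)
    (X : ℝ × ℝ → ℝ → ℝ × ℝ) : Prop where
  hM : 0 < M
  hm : 1 ≤ m
  hCm : 0 ≤ Cm
  hCb : 0 < Cb
  flow : IsFlow U C u X
  dens : ∀ t ≥ (0 : ℝ), Dens M m (ω t)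
  supp0 : ∀ x : ℝ × ℝ, ω 0 x ≠ 0 → |x.1| ≤ Cb
  transport : ∀ x, ∀ t ≥ (0 : ℝ), ω t (X x t) = ω 0 x
  uper : ∀ t ≥ (0 : ℝ), ∀ x : ℝ × ℝ, u t (x + (0, 2 * π)) = u t x
  wper : ∀ t, ∀ x : ℝ × ℝ, ω t (x + (0, 2 * π)) = ω t x
  u1 : ∀ t ≥ (0 : ℝ), ∀ x : ℝ × ℝ, (u t x).1 = ∫ y in strip, K1 x y * ω t y
  int1 : ∀ t ≥ (0 : ℝ), IntegrableOn (fun y : ℝ × ℝ => |y.1| * ω t y) strip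
  mom : ∀ t ≥ (0 : ℝ), ∫ y in strip, |y.1| * ω t y ≤ Cm

section setup
variable {M m Cb Cm U C : ℝ} {ω : ℝ → ℝ × ℝ → ℝ} {u : ℝ → ℝ × ℝ → ℝ × ℝ}
    {X : ℝ × ℝ → ℝ → ℝ × ℝ}

lemma Setup.X_bound (h : Setup M m Cb Cm U C ω u X) {t : ℝ} (ht : 0 ≤ t) (x : ℝ × ℝ)
    (hx : ω 0 x ≠ 0) : |(X x t).1| ≤ Cb + U * t := by
  have h1 := h.flow.speed x le_rfl ht
  rw [h.flow.zero, sub_zero] at h1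
  have h2 : |(X x t).1 - x.1| ≤ ‖X x t - x‖ := norm_fst_le (X x t - x)
  have h3 := h.supp0 x hx
  have h4 := abs_sub_abs_le_abs_sub (X x t).1 x.1
  linarith

lemma Setup.supp (h : Setup M m Cb Cm U C ω u X) {t : ℝ} (ht : 0 ≤ t) (y : ℝ × ℝ)
    (hy : ω t y ≠ 0) : |y.1| ≤ Cb + U * t := by
  obtain ⟨x, rfl⟩ := h.flow.surj t ht y
  rw [h.transport x t ht] at hy
  exact h.X_bound ht x hy

lemma Setup.push (h : Setup M m Cb Cm U C ω u X) {t : ℝ} (ht : 0 ≤ t) (g : ℝ × ℝ → ℝ)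
    (hg : ∀ x : ℝ × ℝ, g (x + (0, 2 * π)) = g x) :
    ∫ x in strip, g (X x t) * ω 0 x = ∫ y in strip, g y * ω t y := by
  rw [← h.flow.strip_int h.uper ht (fun y => g y * ω t y) (fun x => by rw [hg, h.wper])]
  simp only [h.transport _ t ht]

lemma Setup.phi_deriv (h : Setup M m Cb Cm U C ω u X) {l : ℝ} (hl : 0 < l) {t : ℝ} (ht : 0 < t) :
    HasDerivAt (fun t => ∫ x in strip, cosh (l * (X x t).1) * ω 0 x)
      (∫ x in strip, (l * sinh (l * (X x t).1) * (u t (X x t)).1) * ω 0 x) t := by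
  have hw0 := h.dens 0 le_rfl
  have hwi : Integrable (ω 0) (volume.restrict strip) := hw0.int
  have hwm := hwi.aestronglyMeasurable
  have hU := h.flow.hU
  have hcont : ∀ s, 0 ≤ s → Continuous fun x => (X x s).1 := fun s hs =>
    continuous_fst.comp (h.flow.X_mp hs).1
  have hmem : Set.Ioo 0 (t + 1) ∈ 𝓝 t := Ioo_mem_nhds ht (by linarith)
  have hcm : ∀ s, 0 ≤ s → AEStronglyMeasurable (fun x => cosh (l * (X x s).1) * ω 0 x)
      (volume.restrict strip) := fun s hs =>
    (Real.continuous_cosh.comp (continuous_const.mul (hcont s hs))).aestronglyMeasurable.mul hwm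
  have hbd : ∀ s, 0 ≤ s → s ≤ t + 1 → ∀ x, ω 0 x ≠ 0 →
      cosh (l * (X x s).1) ≤ cosh (l * (Cb + U * (t + 1))) := by
    intro s hs hst x hx
    have h1 := h.X_bound hs x hx
    rw [Real.cosh_le_cosh, abs_mul, abs_mul]
    refine mul_le_mul_of_nonneg_left ?_ (abs_nonneg l)
    refine h1.trans (le_trans ?_ (le_abs_self _))
    gcongr
  refine (hasDerivAt_integral_of_dominated_loc_of_deriv_le (μ := volume.restrict strip)
      (bound := fun x => (l * cosh (l * (Cb + U * (t + 1))) * U) * ω 0 x)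
      (F := fun t x => cosh (l * (X x t).1) * ω 0 x)
      (F' := fun t x => (l * sinh (l * (X x t).1) * (u t (X x t)).1) * ω 0 x) (x₀ := t)
      hmem ?_ ?_ ?_ ?_ (hwi.const_mul _) ?_).2
  · filter_upwards [hmem] with s hs
    exact hcm s hs.1.le
  · refine Integrable.mono' (hwi.const_mul (cosh (l * (Cb + U * (t + 1))))) (hcm t ht.le)
      (Eventually.of_forall fun x => ?_)
    have h0 := hw0.nonneg x
    have hc := Real.cosh_pos (l * (X x t).1)
    rw [Real.norm_of_nonneg (by positivity)]
    by_cases hx : ω 0 x = 0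
    · simp [hx]
    · exact mul_le_mul_of_nonneg_right (hbd t ht.le (by linarith) x hx) h0
  · refine AEStronglyMeasurable.mul (Continuous.aestronglyMeasurable ?_) hwm
    refine (continuous_const.mul (Real.continuous_sinh.comp (continuous_const.mul (hcont t ht.le)))).mul ?_
    exact continuous_fst.comp (((h.flow.good t ht.le).continuous h.flow.hC).comp (h.flow.X_mp ht.le).1)
  · refine Eventually.of_forall fun x s hs => ?_
    have h0 := hw0.nonneg x
    by_cases hx : ω 0 x = 0
    · simp [hx]
    rw [norm_mul, norm_mul, norm_mul, Real.norm_of_nonneg h0, Real.norm_of_nonneg hl.le]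
    have h1 : ‖sinh (l * (X x s).1)‖ ≤ cosh (l * (Cb + U * (t + 1))) := by
      refine le_trans ?_ (hbd s hs.1.le hs.2.le x hx)
      rw [Real.norm_eq_abs, Real.abs_sinh, ← Real.cosh_abs (l * (X x s).1)]
      exact (Real.sinh_lt_cosh _).le
    have h2 : ‖(u s (X x s)).1‖ ≤ U :=
      (norm_fst_le _).trans ((h.flow.good s hs.1.le).bdd _)
    have := Real.cosh_pos (l * (Cb + U * (t + 1)))
    gcongr
  · refine Eventually.of_forall fun x s hs => ?_
    have h1 : HasDerivAt (fun s => (X x s).1) (u s (X x s)).1 s :=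
      (h.flow.ode x s hs.1.le).fst
    have h2 := ((h1.const_mul l).cosh).mul_const (ω 0 x)
    refine HasDerivAt.congr_deriv h2 ?_
    ring

lemma Setup.phi_cont (h : Setup M m Cb Cm U C ω u X) {l : ℝ} (hl : 0 < l) (T : ℝ) :
    ContinuousOn (fun t => ∫ x in strip, cosh (l * (X x t).1) * ω 0 x) (Set.Icc 0 T) := by
  have hw0 := h.dens 0 le_rfl
  have hwi : Integrable (ω 0) (volume.restrict strip) := hw0.int
  have hwm := hwi.aestronglyMeasurable
  have hU := h.flow.hU
  refine continuousOn_of_dominated (bound := fun x => cosh (l * (Cb + U * T)) * ω 0 x) ?_ ?_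
    (hwi.const_mul _) ?_
  · intro s hs
    exact (Real.continuous_cosh.comp (continuous_const.mul
      (continuous_fst.comp (h.flow.X_mp hs.1).1))).aestronglyMeasurable.mul hwm
  · intro s hs
    refine Eventually.of_forall fun x => ?_
    have h0 := hw0.nonneg x
    have hc := Real.cosh_pos (l * (X x s).1)
    rw [Real.norm_of_nonneg (by positivity)]
    by_cases hx : ω 0 x = 0
    · simp [hx]
    · refine mul_le_mul_of_nonneg_right ?_ h0
      have h1 := h.X_bound hs.1 x hx
      rw [Real.cosh_le_cosh, abs_mul, abs_mul]
      refine mul_le_mul_of_nonneg_left ?_ (abs_nonneg l)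
      refine h1.trans (le_trans ?_ (le_abs_self _))
      gcongr
      exact hs.2
  · refine Eventually.of_forall fun x => ?_
    have hX : ContinuousOn (X x) (Set.Icc 0 T) := fun s hs =>
      (h.flow.ode x s hs.1).continuousAt.continuousWithinAt
    have : ContinuousOn (fun s => (X x s).1) (Set.Icc 0 T) := continuous_fst.comp_continuousOn hX
    exact (Real.continuous_cosh.comp_continuousOn (continuousOn_const.mul this)).mul continuousOn_const

lemma Setup.gron (h : Setup M m Cb Cm U C ω u X) {l R : ℝ} (hl : 0 < l) (hR : 0 < R) {t : ℝ}
    (ht : 0 ≤ t) :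
    ∫ y in strip, cosh (l * y.1) * ω t y ≤ exp (4 * l ^ 2 * (m + Cm) / R * t) *
      (m * cosh (l * Cb) + 2 * l ^ 2 * (m + Cm) * (m * cosh (l * R / 2)) * t) := by
  have hm := h.hm
  have hCm := h.hCm
  set Φ : ℝ → ℝ := fun t => ∫ x in strip, cosh (l * (X x t).1) * ω 0 x with hΦ
  have hΦe : ∀ t, 0 ≤ t → Φ t = ∫ y in strip, cosh (l * y.1) * ω t y := fun t ht =>
    h.push ht (fun y => cosh (l * y.1)) (fun x => by simp)
  set k := 4 * l ^ 2 * (m + Cm) / R with hk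
  set c := 2 * l ^ 2 * (m + Cm) * (m * cosh (l * R / 2)) with hc
  have hcosh := Real.cosh_pos (l * R / 2)
  have hc0 : 0 ≤ c := by positivity
  have hk0 : 0 ≤ k := by positivity
  have hder : ∀ t, 0 < t →
      (∫ x in strip, (l * sinh (l * (X x t).1) * (u t (X x t)).1) * ω 0 x) ≤ k * Φ t + c := by
    intro t ht
    rw [h.push ht.le (fun y => l * sinh (l * y.1) * (u t y).1) (fun x => by
      simp [h.uper t ht.le])]
    simp_rw [h.u1 t ht.le]
    have := (h.dens t ht.le).exp_moment h.hM.le (h.supp ht.le) (h.int1 t ht.le) (h.mom t ht.le)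
      (by linarith) hl hR
    refine this.trans (le_of_eq ?_)
    rw [hΦe t ht.le, hk, hc]
    ring
  set g : ℝ → ℝ := fun t => exp (-(k * t)) * Φ t - c * t with hg
  have hgd : ∀ t, 0 < t → HasDerivAt g (exp (-(k * t)) *
      ((∫ x in strip, (l * sinh (l * (X x t).1) * (u t (X x t)).1) * ω 0 x) - k * Φ t) - c) t := by
    intro t ht
    have e1 : HasDerivAt (fun t => exp (-(k * t))) (exp (-(k * t)) * (-k)) t := by
      have := ((hasDerivAt_id t).const_mul k).neg.exp
      simpa using this
    have e2 := (e1.mul (h.phi_deriv hl ht)).sub ((hasDerivAt_id t).const_mul c)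
    refine HasDerivAt.congr_deriv e2 ?_
    simp only [hΦ]
    ring
  have hanti : AntitoneOn g (Set.Icc 0 t) := by
    refine antitoneOn_of_deriv_nonpos (convex_Icc 0 t) ?_ ?_ ?_
    · have : ContinuousOn Φ (Set.Icc 0 t) := h.phi_cont hl t
      exact ((by fun_prop : Continuous fun t => exp (-(k * t))).continuousOn.mul this).sub
        (by fun_prop : Continuous fun t : ℝ => c * t).continuousOn
    · intro s hs
      rw [interior_Icc] at hs
      exact (hgd s hs.1).differentiableAt.differentiableWithinAt
    · intro s hs
      rw [interior_Icc] at hs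
      rw [(hgd s hs.1).deriv]
      have h1 := hder s hs.1
      have h2 : exp (-(k * s)) ≤ 1 := by
        rw [Real.exp_le_one_iff]
        have := mul_nonneg hk0 hs.1.le
        linarith
      have h3 := Real.exp_pos (-(k * s))
      have h4 : exp (-(k * s)) * ((∫ x in strip, (l * sinh (l * (X x s).1) * (u s (X x s)).1) * ω 0 x) - k * Φ s)
          ≤ exp (-(k * s)) * c := by gcongr; linarith
      have h5 : exp (-(k * s)) * c ≤ 1 * c := by gcongr
      linarith
  have h1 := hanti ⟨le_rfl, ht⟩ ⟨ht, le_rfl⟩ ht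
  simp only [hg, mul_zero, neg_zero, Real.exp_zero, one_mul, sub_zero] at h1
  have h0 : Φ 0 ≤ m * cosh (l * Cb) := by
    have hw0 := h.dens 0 le_rfl
    have hwi : Integrable (ω 0) (volume.restrict strip) := hw0.int
    have : Φ 0 ≤ ∫ x in strip, cosh (l * Cb) * ω 0 x := by
      refine integral_mono_of_nonneg (Eventually.of_forall fun x => ?_) (hwi.const_mul _)
        (Eventually.of_forall fun x => ?_)
      · exact mul_nonneg (Real.cosh_pos _).le (hw0.nonneg x)
      · simp only [h.flow.zero]
        by_cases hx : ω 0 x = 0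
        · simp [hx]
        · refine mul_le_mul_of_nonneg_right ?_ (hw0.nonneg x)
          rw [Real.cosh_le_cosh, abs_mul, abs_mul]
          exact mul_le_mul_of_nonneg_left ((h.supp0 x hx).trans (le_abs_self _)) (abs_nonneg l)
    rw [integral_const_mul] at this
    refine this.trans ?_
    rw [mul_comm]
    exact mul_le_mul_of_nonneg_right hw0.mass (Real.cosh_pos _).le
  rw [← hΦe t ht]
  have e : Φ t = exp (k * t) * (exp (-(k * t)) * Φ t) := by
    rw [← mul_assoc, ← Real.exp_add]; simp
  rw [e]
  gcongr
  linarith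

lemma Setup.tail (h : Setup M m Cb Cm U C ω u X) {l R : ℝ} (hl : 0 < l) (hR : 0 < R) {t : ℝ}
    (ht : 0 ≤ t) :
    ∫ y in strip, Set.indicator {y : ℝ × ℝ | 3 * R / 4 ≤ |y.1|} (ω t) y ≤
      2 * exp (-(3 * l * R / 4)) * ∫ y in strip, cosh (l * y.1) * ω t y := by
  have hw := h.dens t ht
  have hwi : Integrable (ω t) (volume.restrict strip) := hw.int
  rw [← integral_const_mul]
  refine integral_mono_of_nonneg (Eventually.of_forall fun x => ?_) ?_
    (Eventually.of_forall fun y => ?_)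
  · exact Set.indicator_nonneg (fun y _ => hw.nonneg y) x
  · refine Integrable.const_mul ?_ _
    refine Integrable.mono' (hwi.const_mul (cosh (l * (Cb + U * t))))
      ((Real.continuous_cosh.comp (continuous_const.mul continuous_fst)).aestronglyMeasurable.mul hwi.aestronglyMeasurable)
      (Eventually.of_forall fun y => ?_)
    have h0 := hw.nonneg y
    have hc := Real.cosh_pos (l * y.1)
    change ‖cosh (l * y.1) * ω t y‖ ≤ _
    rw [Real.norm_of_nonneg (by positivity)]
    by_cases hy : ω t y = 0
    · simp [hy]
    · refine mul_le_mul_of_nonneg_right ?_ h0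
      rw [Real.cosh_le_cosh, abs_mul, abs_mul]
      exact mul_le_mul_of_nonneg_left ((h.supp ht y hy).trans (le_abs_self _)) (abs_nonneg l)
  · have h0 := hw.nonneg y
    have hc := Real.cosh_pos (l * y.1)
    by_cases hy : y ∈ {y : ℝ × ℝ | 3 * R / 4 ≤ |y.1|}
    · simp only [Set.indicator_of_mem hy]
      rw [← mul_assoc]
      refine le_mul_of_one_le_left h0 ?_
      have hy' : 3 * R / 4 ≤ |y.1| := hy
      have h1 : exp (3 * l * R / 4) ≤ 2 * cosh (l * y.1) := by
        rw [← Real.cosh_abs, abs_mul, abs_of_pos hl, Real.cosh_eq]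
        have e1 : exp (3 * l * R / 4) ≤ exp (l * |y.1|) := by
          apply Real.exp_le_exp.2
          have := mul_le_mul_of_nonneg_left hy' hl.le
          linarith
        have := Real.exp_pos (-(l * |y.1|))
        linarith
      calc (1:ℝ) = exp (-(3 * l * R / 4)) * exp (3 * l * R / 4) := by rw [← Real.exp_add]; simp
        _ ≤ exp (-(3 * l * R / 4)) * (2 * cosh (l * y.1)) := by gcongr
        _ = _ := by ring
    · simp only [Set.indicator_of_notMem hy]
      positivity

lemma Setup.confine (h : Setup M m Cb Cm U C ω u X) {CW : ℝ}
    (hCW : ∀ x : ℝ × ℝ, IntegrableOn (WW x) strip ∧ ∫ y in strip, WW x y ≤ CW)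
    {l R t ν σ : ℝ} (hl : 0 < l) (hR : 0 < R) (ht : 0 < t) (h0 : 0 < σ) (h1 : σ ≤ 1)
    (hCbR : Cb ≤ R)
    (hν : 2 * exp (-(3 * l * R / 4)) * (exp (4 * l ^ 2 * (m + Cm) / R * t) *
      (m * cosh (l * Cb) + 2 * l ^ 2 * (m + Cm) * (m * cosh (l * R / 2)) * t)) ≤ ν)
    (hv : m / (4 * sinh (R / 8)) + (1 + (σ ^ 2)⁻¹) * ν + σ * (M * CW) < 1 / t) :
    horizDiam ω t ≤ 2 * (R + 1) := by
  have hm := h.hm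
  have hCm := h.hCm
  have key : ∀ x, ω 0 x ≠ 0 → |(X x t).1| ≤ R + 1 := by
    intro x hx
    have hd : ∀ s ≥ (0 : ℝ), HasDerivAt (fun s => (X x s).1) (u s (X x s)).1 s :=
      fun s hs => (h.flow.ode x s hs).fst
    have := image_norm_le_of_norm_deriv_right_lt_deriv_boundary' (f := fun s => (X x s).1)
      (f' := fun s => (u s (X x s)).1) (a := 0) (b := t)
      (fun s hs => (hd s hs.1).continuousAt.continuousWithinAt)
      (fun s hs => (hd s hs.1).hasDerivWithinAt)
      (B := fun s => R + s * (1 / t)) (B' := fun _ => 1 / t)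
      (by simpa [h.flow.zero] using (h.supp0 x hx).trans hCbR)
      (by fun_prop)
      (fun s hs => by
        have := (((hasDerivAt_id s).mul_const (1 / t)).const_add R).hasDerivWithinAt (s := Set.Ici s)
        simpa using this)
      (fun s hs he => by
        rw [Real.norm_eq_abs] at he ⊢
        have hs0 := hs.1
        rw [h.u1 s hs.1]
        refine lt_of_le_of_lt ((h.dens s hs.1).vel h.hM.le hCW hR h0 h1 (ν := ν) ?_ _ ?_) hv
        · refine (h.tail hl hR hs.1).trans (le_trans ?_ hν)
          refine mul_le_mul_of_nonneg_left ((h.gron hl hR hs.1).trans ?_) (by positivity)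
          have := hs.2.le
          have := Real.cosh_pos (l * R / 2)
          have := Real.cosh_pos (l * Cb)
          gcongr
        · rw [he]
          have : 0 ≤ s * (1 / t) := by positivity
          linarith) (x := t) ⟨ht.le, le_rfl⟩
    rw [Real.norm_eq_abs] at this
    refine this.trans (le_of_eq ?_)
    field_simp
  have key2 : ∀ y, ω t y ≠ 0 → |y.1| ≤ R + 1 := by
    intro y hy
    obtain ⟨x, rfl⟩ := h.flow.surj t ht.le y
    rw [h.transport x t ht.le] at hy
    exact key x hy
  unfold horizDiam
  apply Real.sSup_le
  · rintro r ⟨x, y, hx, hy, rfl⟩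
    have := abs_sub x.1 y.1
    linarith [key2 x hx, key2 y hy]
  · positivity

end setup

end part12

section part13
section fin
variable {M m Cb Cm U C : ℝ} {ω : ℝ → ℝ × ℝ → ℝ} {u : ℝ → ℝ × ℝ → ℝ × ℝ}
    {X : ℝ × ℝ → ℝ → ℝ × ℝ}

lemma cosh_le_exp_of_abs_le {a b : ℝ} (h : |a| ≤ b) : cosh a ≤ exp b := by
  rw [← Real.cosh_abs, Real.cosh_eq]
  have h1 : exp |a| ≤ exp b := exp_le_exp.2 h
  have h2 : exp (-|a|) ≤ exp b := exp_le_exp.2 (by have := abs_nonneg a; linarith)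
  linarith

lemma Setup.diam_at (h : Setup M m Cb Cm U C ω u X) {CW : ℝ}
    (hCW : ∀ x : ℝ × ℝ, IntegrableOn (WW x) strip ∧ ∫ y in strip, WW x y ≤ CW)
    {t a : ℝ} (ht : 66 ≤ t) (hl1 : 1 ≤ log t) (hm1 : m + Cm ≤ t) (hM4 : 4 * (M * CW) ≤ t)
    (ha1 : 1 ≤ a) (haC : Cb ≤ a) (hat : a ≤ t) (ha : a ^ 3 = (m + Cm) * t * log t) :
    horizDiam ω t ≤ 34 * a := by
  have hm := h.hm
  have hCm := h.hCm
  have hCb := h.hCb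
  have hlt : log t ≤ t := (Real.log_le_sub_one_of_pos (by linarith)).trans (by linarith)
  have hE : exp (log t) = t := exp_log (by linarith)
  set ℓ := log t with hℓ
  have hE' : ∀ n : ℕ, exp (n * ℓ) = t ^ n := fun n => by rw [exp_nat_mul, hE]
  have ht0 : 0 < t := by linarith
  have ha0 : 0 < a := by linarith
  have hℓ0 : 0 < ℓ := by linarith
  have key := h.confine hCW (l := 4 * ℓ / a) (R := 16 * a) (t := t) (ν := (t ^ 8)⁻¹)
    (σ := (t ^ 2)⁻¹) (by positivity) (by positivity) ht0 (by positivity)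
    (inv_le_one_of_one_le₀ (one_le_pow₀ (by linarith))) (by linarith) ?_ ?_
  · linarith
  · have e1 : 3 * (4 * ℓ / a) * (16 * a) / 4 = 48 * ℓ := by field_simp; ring
    have e2 : 4 * (4 * ℓ / a) ^ 2 * (m + Cm) / (16 * a) * t = 4 * ℓ := by
      have : 4 * (4 * ℓ / a) ^ 2 * (m + Cm) / (16 * a) * t = 4 * ℓ * ((m + Cm) * t * ℓ) / a ^ 3 := by
        field_simp; ring
      rw [this, ← ha]; field_simp
    have e3 : 2 * (4 * ℓ / a) ^ 2 * (m + Cm) * t = 32 * ℓ * a := by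
      have : 2 * (4 * ℓ / a) ^ 2 * (m + Cm) * t = 32 * ℓ * ((m + Cm) * t * ℓ) / a ^ 2 := by
        field_simp; ring
      rw [this, ← ha]; field_simp
    have c1 : cosh (4 * ℓ / a * Cb) ≤ t ^ 32 := by
      rw [← hE' 32]
      apply cosh_le_exp_of_abs_le
      rw [abs_of_pos (by positivity), div_mul_eq_mul_div, div_le_iff₀ ha0]
      push_cast
      nlinarith
    have c2 : cosh (4 * ℓ / a * (16 * a) / 2) ≤ t ^ 32 := by
      rw [← hE' 32]
      apply cosh_le_exp_of_abs_le
      rw [abs_of_pos (by positivity)]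
      apply le_of_eq; push_cast; field_simp; ring
    rw [e1, e2]
    have e4 : exp (4 * ℓ) = t ^ 4 := by rw [← hE' 4]; norm_num
    have e5 : exp (-(48 * ℓ)) = (t ^ 48)⁻¹ := by rw [exp_neg, ← hE' 48]; norm_num
    rw [e4, e5]
    have b1 : m * cosh (4 * ℓ / a * Cb) + 2 * (4 * ℓ / a) ^ 2 * (m + Cm) *
        (m * cosh (4 * ℓ / a * (16 * a) / 2)) * t ≤ 33 * t ^ 35 := by
      have : 2 * (4 * ℓ / a) ^ 2 * (m + Cm) *
        (m * cosh (4 * ℓ / a * (16 * a) / 2)) * t = 32 * ℓ * a * (m * cosh (4 * ℓ / a * (16 * a) / 2)) := by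
        rw [← e3]; ring
      rw [this]
      have hmt : m ≤ t := by linarith
      have q := Real.cosh_pos (4 * ℓ / a * (16 * a) / 2)
      have q' := Real.cosh_pos (4 * ℓ / a * Cb)
      calc m * cosh (4 * ℓ / a * Cb) + 32 * ℓ * a * (m * cosh (4 * ℓ / a * (16 * a) / 2))
          ≤ t * t ^ 32 + 32 * t * t * (t * t ^ 32) := by gcongr
        _ ≤ 33 * t ^ 35 := by
          have : t ^ 33 ≤ t ^ 35 := pow_le_pow_right₀ (by linarith) (by norm_num)
          nlinarith
    calc 2 * (t ^ 48)⁻¹ * (t ^ 4 * _) ≤ 2 * (t ^ 48)⁻¹ * (t ^ 4 * (33 * t ^ 35)) := by gcongr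
      _ = 66 * (t ^ 9)⁻¹ := by field_simp; ring
      _ ≤ t * (t ^ 9)⁻¹ := by gcongr
      _ = (t ^ 8)⁻¹ := by field_simp
  · have s1 : (m + Cm) * t * ℓ ≤ sinh (16 * a / 8) := by
      rw [← ha]
      have := sinh_lower (16 * a / 8)
      rw [abs_of_pos (by positivity), abs_of_pos (Real.sinh_pos_iff.2 (by positivity))] at this
      refine le_trans ?_ this
      have : (16 * a / 8) ^ 3 / 8 = a ^ 3 := by ring
      rw [this]; linarith
    have s2 : m * t ≤ sinh (16 * a / 8) := by
      refine le_trans ?_ s1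
      calc m * t = m * t * 1 := by ring
        _ ≤ (m + Cm) * t * ℓ := by gcongr; linarith
    have s3 : m / (4 * sinh (16 * a / 8)) ≤ 1 / 4 * (1 / t) := by
      calc m / (4 * sinh (16 * a / 8)) ≤ m / (4 * (m * t)) := by gcongr
        _ = _ := by field_simp
    have s4 : (t ^ 2)⁻¹ * (M * CW) ≤ 1 / 4 * (1 / t) := by
      calc (t ^ 2)⁻¹ * (M * CW) ≤ (t ^ 2)⁻¹ * (t / 4) := by gcongr; linarith
        _ = _ := by field_simp
    have s5 : (1 + (((t ^ 2)⁻¹) ^ 2)⁻¹) * (t ^ 8)⁻¹ ≤ 1 / 4 * (1 / t) := by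
      have p4 : 1 ≤ t ^ 4 := one_le_pow₀ (by linarith)
      have p2 : 8 ≤ t ^ 3 := by
        calc (8 : ℝ) = 2 ^ 3 := by norm_num
          _ ≤ t ^ 3 := by gcongr; linarith
      calc (1 + (((t ^ 2)⁻¹) ^ 2)⁻¹) * (t ^ 8)⁻¹ = (1 + t ^ 4) * (t ^ 8)⁻¹ := by
            congr 2; field_simp
        _ ≤ (t ^ 4 + t ^ 4) * (t ^ 8)⁻¹ := by gcongr
        _ = 2 * (t ^ 3)⁻¹ * (1 / t) := by field_simp; ring
        _ ≤ 2 * (8)⁻¹ * (1 / t) := by gcongr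
        _ = _ := by ring
    have : 0 < 1 / t := by positivity
    linarith

lemma Setup.diam_ev (h : Setup M m Cb Cm U C ω u X) :
    ∀ᶠ t in atTop, horizDiam ω t ≤ 34 * (m + Cm) ^ (1 / 3 : ℝ) * (t * log t) ^ (1 / 3 : ℝ) := by
  obtain ⟨CW, hCW0, hCW⟩ := exists_integral_WW
  have hm := h.hm
  have hCm := h.hCm
  have hCb := h.hCb
  filter_upwards [eventually_ge_atTop (66 : ℝ), Real.tendsto_log_atTop.eventually_ge_atTop 1,
    eventually_ge_atTop (m + Cm), eventually_ge_atTop (4 * (M * CW)),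
    eventually_ge_atTop (Cb ^ 3)] with t h1 h2 h3 h4 h5
  have ht0 : 0 < t := by linarith
  have hlt : log t ≤ t := (Real.log_le_sub_one_of_pos (by linarith)).trans (by linarith)
  rw [mul_assoc, ← Real.mul_rpow (by linarith) (by positivity), ← mul_assoc]
  set b := (m + Cm) * t * log t with hb
  have hb0 : 0 ≤ b := by positivity
  have hbt : t ≤ b := by
    calc t = 1 * t * 1 := by ring
      _ ≤ b := by rw [hb]; gcongr; linarith
  have ha : (b ^ (1 / 3 : ℝ)) ^ 3 = b := by
    rw [← Real.rpow_natCast, ← Real.rpow_mul hb0]; norm_num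
  have ha0 : 0 ≤ b ^ (1 / 3 : ℝ) := by positivity
  refine h.diam_at hCW h1 h2 h3 h4 ?_ ?_ ?_ ha
  · exact Real.one_le_rpow (by linarith) (by norm_num)
  · refine le_of_pow_le_pow_left₀ (n := 3) (by norm_num) ha0 ?_
    rw [ha]; linarith
  · refine le_of_pow_le_pow_left₀ (n := 3) (by norm_num) ht0.le ?_
    rw [ha]
    calc b ≤ t * t * t := by rw [hb]; gcongr
      _ = t ^ 3 := by ring

lemma horizDiam_nonneg (ω : ℝ → ℝ × ℝ → ℝ) (t : ℝ) : 0 ≤ horizDiam ω t := by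
  apply Real.sSup_nonneg
  rintro r ⟨x, y, -, -, rfl⟩
  exact abs_nonneg _

lemma Setup.final (h : Setup M m Cb Cm U C ω u X) {α : ℝ} (hα : 1 < α) :
    Tendsto (fun t : ℝ => (t * Real.log t ^ α) ^ (-(1 / 3) : ℝ) * horizDiam ω t)
        atTop (𝓝 0) := by
  set K := 34 * (m + Cm) ^ (1 / 3 : ℝ)
  have hz : Tendsto (fun t : ℝ => K * (log t) ^ (-((α - 1) / 3))) atTop (𝓝 0) := by
    have := ((tendsto_rpow_neg_atTop (y := (α - 1) / 3) (by linarith)).comp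
      Real.tendsto_log_atTop).const_mul K
    simpa using this
  refine tendsto_of_tendsto_of_tendsto_of_le_of_le' tendsto_const_nhds hz ?_ ?_
  · filter_upwards [eventually_ge_atTop (1 : ℝ)] with t ht
    have := Real.log_nonneg ht
    have := horizDiam_nonneg ω t
    positivity
  · filter_upwards [h.diam_ev, eventually_ge_atTop (1 : ℝ),
      Real.tendsto_log_atTop.eventually_ge_atTop 1] with t h1 h2 h3
    have ht0 : 0 < t := by linarith
    have hl0 : 0 < log t := by linarith
    calc (t * Real.log t ^ α) ^ (-(1 / 3) : ℝ) * horizDiam ω t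
        ≤ (t * Real.log t ^ α) ^ (-(1 / 3) : ℝ) * (K * (t * log t) ^ (1 / 3 : ℝ)) := by gcongr
      _ = K * (t ^ (-(1 / 3) : ℝ) * t ^ (1 / 3 : ℝ)) * (log t ^ (α * -(1 / 3)) * log t ^ (1 / 3 : ℝ)) := by
        rw [Real.mul_rpow ht0.le (by positivity), Real.mul_rpow ht0.le hl0.le, ← Real.rpow_mul hl0.le]
        ring
      _ = K * (log t) ^ (-((α - 1) / 3)) := by
        rw [← Real.rpow_add ht0, ← Real.rpow_add hl0]
        have e : α * -(1 / 3) + 1 / 3 = -((α - 1) / 3) := by ring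
        rw [e]; norm_num
      _ ≤ _ := le_rfl
end fin

lemma dens_of_mom {M Cm : ℝ} {w : ℝ × ℝ → ℝ} (hM : 0 < M) (h0 : ∀ y, 0 ≤ w y) (h1 : ∀ y, w y ≤ M)
    (hi : IntegrableOn w strip) (hi1 : IntegrableOn (fun y : ℝ × ℝ => |y.1| * w y) strip)
    (hm : ∫ y in strip, |y.1| * w y ≤ Cm) : Dens M (4 * π * M + |Cm| + 1) w := by
  refine ⟨h0, h1, hi, ?_⟩
  set S : Set (ℝ × ℝ) := Set.Icc (-1) 1 ×ˢ Set.univ with hS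
  have hSm : MeasurableSet S := measurableSet_Icc.prod MeasurableSet.univ
  have hv : (volume.restrict strip) S = ENNReal.ofReal (4 * π) := by
    rw [Measure.restrict_apply hSm, hS, strip, Set.prod_inter_prod, Set.inter_univ, Set.univ_inter,
      Measure.volume_eq_prod, Measure.prod_prod, Real.volume_Icc, Real.volume_Icc,
      ← ENNReal.ofReal_mul (by norm_num)]
    congr 1; ring
  have hind : IntegrableOn (S.indicator fun _ => M) strip := by
    rw [IntegrableOn, integrable_indicator_iff hSm]
    exact integrableOn_const (by rw [hv]; exact ENNReal.ofReal_ne_top)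
  have hs : ∫ y in strip, S.indicator (fun _ => M) y = 4 * π * M := by
    rw [integral_indicator hSm, setIntegral_const, measureReal_def, hv,
      ENNReal.toReal_ofReal (by positivity)]
    rfl
  calc ∫ y in strip, w y ≤ ∫ y in strip, (S.indicator (fun _ => M) y + |y.1| * w y) := by
        refine integral_mono hi (hind.add hi1) fun y => ?_
        have := h0 y
        by_cases hy : y ∈ S
        · have h3 : 0 ≤ |y.1| * w y := by positivity
          simp only [Set.indicator_of_mem hy]
          linarith [h1 y]
        · simp only [Set.indicator_of_notMem hy, zero_add]
          have : 1 ≤ |y.1| := by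
            by_contra hc
            push Not at hc
            exact hy ⟨⟨(abs_lt.1 hc).1.le, (abs_lt.1 hc).2.le⟩, trivial⟩
          nlinarith
    _ = 4 * π * M + ∫ y in strip, |y.1| * w y := by rw [integral_add hind hi1, hs]
    _ ≤ _ := by linarith [le_abs_self Cm]

lemma K1_per (x y : ℝ × ℝ) : K1 (x + (0, 2 * π)) y = K1 x y := by
  simp only [K1, Prod.fst_add, Prod.snd_add, add_zero, add_sub_right_comm, Real.sin_add_two_pi,
    Real.cos_add_two_pi]

lemma K2_per (x y : ℝ × ℝ) : K2 (x + (0, 2 * π)) y = K2 x y := by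
  simp only [K2, Prod.fst_add, Prod.snd_add, add_zero, add_sub_right_comm,
    Real.cos_add_two_pi]

end part13

/-- Confinement for the Euler flow on the cylinder: if the vorticity `ω` is transported
along the flow of the velocity given by the cylindrical Biot–Savart law, the initial
vorticity is nonnegative, bounded and compactly supported, and the uniform first-moment
bound `sup_t ∫ |x₁| ω dx < ∞` holds, then for every `α > 1` the horizontal diameter of
the support of `ω(·,t)` is `o((t log^α t)^{1/3})` as `t → ∞`. -/
theorem euler_confinement
    (ω : ℝ → ℝ × ℝ → ℝ) (u : ℝ → ℝ × ℝ → ℝ × ℝ) (X : ℝ × ℝ → ℝ → ℝ × ℝ)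
    -- periodicity in the second spatial variable
    (hper : ∀ t x1 x2, ω t (x1, x2 + 2 * Real.pi) = ω t (x1, x2))
    -- the initial vorticity is nonnegative, bounded and compactly supported
    (M : ℝ) (hM : 0 < M) (hω₀nonneg : ∀ x, 0 ≤ ω 0 x) (hω₀bdd : ∀ x, ω 0 x ≤ M)
    (Cb : ℝ) (hCb : 0 < Cb) (hsupp : ∀ x : ℝ × ℝ, ω 0 x ≠ 0 → |x.1| ≤ Cb)
    -- flow of the velocity field
    (hX0 : ∀ x, X x 0 = x)
    (hXode : ∀ x, ∀ t ≥ (0 : ℝ), HasDerivAt (X x) (u t (X x t)) t)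
    (hXsurj : ∀ t ≥ (0 : ℝ), ∀ y : ℝ × ℝ, ∃ x, X x t = y)
    -- the vorticity is transported along the flow
    (htransport : ∀ x, ∀ t ≥ (0 : ℝ), ω t (X x t) = ω 0 x)
    -- cylindrical Biot–Savart law `u = ∫ ∇ₓ^⊥G(x,y) ω(y,t) dy`
    (hBS : ∀ t ≥ (0 : ℝ), ∀ x : ℝ × ℝ,
      u t x = (∫ y in strip, K1 x y * ω t y, ∫ y in strip, K2 x y * ω t y))
    -- integrability
    (hint : ∀ t ≥ (0 : ℝ), IntegrableOn (ω t) strip)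
    (hint1 : ∀ t ≥ (0 : ℝ), IntegrableOn (fun y : ℝ × ℝ => |y.1| * ω t y) strip)
    -- uniform first-moment bound
    (Cm : ℝ) (hmom : ∀ t ≥ (0 : ℝ), ∫ y in strip, |y.1| * ω t y ≤ Cm) :
    ∀ α > (1 : ℝ),
      Tendsto (fun t : ℝ => (t * Real.log t ^ α) ^ (-(1 / 3) : ℝ) * horizDiam ω t)
        atTop (𝓝 0) := by
  intro α hα
  have hm1 : 1 ≤ 4 * π * M + |Cm| + 1 := by
    have : 0 ≤ 4 * π * M + |Cm| := by positivity
    linarith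
  have hd : ∀ t ≥ (0 : ℝ), Dens M (4 * π * M + |Cm| + 1) (ω t) := by
    intro t ht
    refine dens_of_mom hM (fun y => ?_) (fun y => ?_) (hint t ht) (hint1 t ht) (hmom t ht)
    · obtain ⟨x, rfl⟩ := hXsurj t ht y
      rw [htransport x t ht]; exact hω₀nonneg x
    · obtain ⟨x, rfl⟩ := hXsurj t ht y
      rw [htransport x t ht]; exact hω₀bdd x
  obtain ⟨U, C, hU, hC, hG⟩ := exists_goodField M (4 * π * M + |Cm| + 1) hM (by linarith)
  have hS : Setup M (4 * π * M + |Cm| + 1) Cb |Cm| (max U 1) C ω u X :=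
    { hM := hM
      hm := hm1
      hCm := abs_nonneg _
      hCb := hCb
      flow :=
        { hU := le_max_right _ _
          hC := hC
          good := fun t ht => by
            have e : u t = fun x => (∫ y in strip, K1 x y * ω t y, ∫ y in strip, K2 x y * ω t y) :=
              funext (hBS t ht)
            rw [e]
            exact (hG _ (hd t ht)).mono (le_max_left _ _)
          zero := hX0
          ode := hXode
          surj := hXsurj }
      dens := hd
      supp0 := hsupp
      transport := htransport
      uper := fun t ht x => by
        rw [hBS t ht, hBS t ht]
        simp only [K1_per, K2_per]
      wper := fun t x => by
        have := hper t x.1 x.2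
        rw [← this]
        congr 1
        ext <;> simp
      u1 := fun t ht x => by rw [hBS t ht]
      int1 := hint1
      mom := fun t ht => (hmom t ht).trans (le_abs_self _) }
  exact hS.final hα
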